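/- Let Ω ⊂ ℂ^n be a strictly convex bounded domain and φ a nonnegative smooth function on the closure of Ω whose real Hessian (viewing ℂ^n ≅ ℝ^{2n}) satisfies Σ_{j,k=1}^{2n} (∂²φ/∂x_j∂x_k) ξ_j ξ_k ≥ c|ξ|² for all ξ ∈ ℝ^{2n}, with c > 0. Then for every (1,1)-form f ∈ L²_{(1,1)}(Ω, e^{−φ}) with ∂f = ∂̄f = 0 (distributionally), there exists u ∈ L²(Ω, e^{−φ}) with i ∂∂̄ u = f in the sense of distributions and ∫_Ω |u|² e^{−φ} ≤ (8/c²) ∫_Ω |f|² e^{−φ}. -/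

import Mathlib

open Complex MeasureTheory

/-- Partial derivative in the `j`-th coordinate direction. -/
noncomputable def pd {N : ℕ} {F : Type*} [NormedAddCommGroup F] [NormedSpace ℝ F]
    (j : Fin N) (f : EuclideanSpace ℝ (Fin N) → F) (x : EuclideanSpace ℝ (Fin N)) : F :=
  fderiv ℝ f x (EuclideanSpace.single j 1)

/-- The index of `x_j` in `ℝ^{2n}` under the identification `z_j = x_j + i x_{j+n}`. -/
def idx1 {n : ℕ} (j : Fin n) : Fin (2 * n) := ⟨j.1, by have := j.2; omega⟩

/-- The index of `x_{j+n}` in `ℝ^{2n}`. -/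
def idx2 {n : ℕ} (j : Fin n) : Fin (2 * n) := ⟨j.1 + n, by have := j.2; omega⟩

/-- Wirtinger derivative `∂/∂z_j = (1/2)(∂/∂x_j - i ∂/∂x_{j+n})`. -/
noncomputable def wz {n : ℕ} (j : Fin n) (f : EuclideanSpace ℝ (Fin (2 * n)) → ℂ)
    (x : EuclideanSpace ℝ (Fin (2 * n))) : ℂ :=
  (1 / 2 : ℂ) * (pd (idx1 j) f x - Complex.I * pd (idx2 j) f x)

/-- Wirtinger derivative `∂/∂z̄_j = (1/2)(∂/∂x_j + i ∂/∂x_{j+n})`. -/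
noncomputable def wzbar {n : ℕ} (j : Fin n) (f : EuclideanSpace ℝ (Fin (2 * n)) → ℂ)
    (x : EuclideanSpace ℝ (Fin (2 * n))) : ℂ :=
  (1 / 2 : ℂ) * (pd (idx1 j) f x + Complex.I * pd (idx2 j) f x)

/-- A complex-valued test function on `Ω`. -/
def IsTestFun {n : ℕ} (Ω : Set (EuclideanSpace ℝ (Fin (2 * n))))
    (χ : EuclideanSpace ℝ (Fin (2 * n)) → ℂ) : Prop :=
  ContDiff ℝ (⊤ : ℕ∞) χ ∧ HasCompactSupport χ ∧ tsupport χ ⊆ Ω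

section Part1
open Complex MeasureTheory Set Filter Topology
open scoped ENNReal NNReal ContDiff Convolution

section Moll
variable {X : Type*} [NormedAddCommGroup X] [InnerProductSpace ℝ X] [FiniteDimensional ℝ X]
  [MeasurableSpace X] [BorelSpace X]
variable {E : Type*} [NormedAddCommGroup E] [NormedSpace ℝ E] [CompleteSpace E]

/-- Square of the `L²` seminorm. -/
lemma eLpNorm_two_sq {Y : Type*} [MeasurableSpace Y] (μ : Measure Y) {F : Type*}
    [NormedAddCommGroup F] (f : Y → F) :
    eLpNorm f 2 μ ^ 2 = ∫⁻ x, ‖f x‖ₑ ^ 2 ∂μ := by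
  have := eLpNorm_nnreal_pow_eq_lintegral (μ := μ) (f := f) (p := 2) (by norm_num)
  simpa using this

lemma translate_small {g : X → E} (hg : MemLp g 2 (volume : Measure X)) {ε : ℝ≥0∞}
    (hε : ε ≠ 0) : ∃ δ > 0, ∀ t : X, ‖t‖ < δ →
      eLpNorm (fun x => g (x - t) - g x) 2 (volume : Measure X) ≤ ε := by
  let G : X → C(X, X) := fun t => ⟨fun x => x - t, by fun_prop⟩
  have hmp : ∀ t, MeasurePreserving (G t) (volume : Measure X) volume :=
    fun t => measurePreserving_sub_right volume t
  have hGc : Continuous G := by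
    apply ContinuousMap.continuous_of_continuous_uncurry
    show Continuous fun p : X × X => p.2 - p.1
    fun_prop
  have hc : Continuous (fun t => Lp.compMeasurePreserving (G t) (hmp t) (hg.toLp g)) :=
    Continuous.compMeasurePreservingLp continuous_const hGc hmp (by norm_num)
  have h0 : Lp.compMeasurePreserving (G 0) (hmp 0) (hg.toLp g) = hg.toLp g := by
    rw [Lp.toLp_compMeasurePreserving hg (hmp 0)]
    congr 1
    ext x; simp [G]
  have ht := EMetric.tendsto_nhds_nhds.1 (hc.tendsto 0) ε (pos_iff_ne_zero.2 hε)
  obtain ⟨δ, hδ, H⟩ := ht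
  obtain ⟨r, hr, hr'⟩ : ∃ r : ℝ, 0 < r ∧ ENNReal.ofReal r ≤ δ := by
    rcases eq_or_ne δ ∞ with h | h
    · exact ⟨1, one_pos, by simp [h]⟩
    · exact ⟨δ.toReal, ENNReal.toReal_pos hδ.ne' h, by rw [ENNReal.ofReal_toReal h]⟩
  refine ⟨r, hr, fun t htr => ?_⟩
  have h1 := H (x := t) (lt_of_lt_of_le (by
    rw [edist_zero_right, ← ofReal_norm]
    exact (ENNReal.ofReal_lt_ofReal_iff hr).2 htr) hr')
  rw [h0, Lp.toLp_compMeasurePreserving hg (hmp t), Lp.edist_toLp_toLp] at h1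
  exact h1.le

lemma moll_aux {ρ : X → ℝ} (hρ0 : ∀ x, 0 ≤ ρ x) (hρm : Measurable ρ)
    (hρ1 : ∫⁻ t, ENNReal.ofReal (ρ t) = 1) {F : X → ℝ≥0∞} (hF : Measurable F) :
    (∫⁻ t, ENNReal.ofReal (ρ t) * F t) ^ 2 ≤ ∫⁻ t, ENNReal.ofReal (ρ t) * (F t) ^ 2 := by
  have hw : Measurable fun t => ENNReal.ofReal (ρ t) := by fun_prop
  have h := ENNReal.lintegral_mul_le_Lp_mul_Lq (volume : Measure X) (p := 2) (q := 2)
    (Real.HolderConjugate.two_two)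
    (f := fun t => ENNReal.ofReal (ρ t) ^ (1/2 : ℝ)) (g := fun t => ENNReal.ofReal (ρ t) ^ (1/2 : ℝ) * F t)
    (by fun_prop) (by fun_prop)
  have e1 : ∀ t, ((fun t => ENNReal.ofReal (ρ t) ^ (1/2 : ℝ)) *
      (fun t => ENNReal.ofReal (ρ t) ^ (1/2 : ℝ) * F t)) t = ENNReal.ofReal (ρ t) * F t := by
    intro t
    simp only [Pi.mul_apply]
    rw [← mul_assoc, ← ENNReal.rpow_add_of_nonneg _ _ (by norm_num) (by norm_num)]
    norm_num
  have e2 : ∀ t, (ENNReal.ofReal (ρ t) ^ (1/2 : ℝ)) ^ (2:ℝ) = ENNReal.ofReal (ρ t) := by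
    intro t; rw [← ENNReal.rpow_mul]; norm_num
  simp only [e1, ENNReal.mul_rpow_of_nonneg _ _ (show (0:ℝ) ≤ 2 by norm_num), e2, hρ1,
    ENNReal.one_rpow, one_mul] at h
  have h2 := pow_le_pow_left' h 2
  refine h2.trans (le_of_eq ?_)
  rw [← ENNReal.rpow_natCast, ← ENNReal.rpow_mul]
  norm_num

lemma moll_strong {g : X → E} (hg : MemLp g 2 (volume : Measure X)) (hgm : StronglyMeasurable g)
    {ε : ℝ≥0∞} {δ : ℝ} 
    (H : ∀ t : X, ‖t‖ < δ → eLpNorm (fun x => g (x - t) - g x) 2 (volume : Measure X) ≤ ε)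
    (ρ : ContDiffBump (0 : X)) (hρ : ρ.rOut < δ) :
    eLpNorm (fun x => (ρ.normed volume ⋆[ContinuousLinearMap.lsmul ℝ ℝ, volume] g) x - g x) 2
      (volume : Measure X) ≤ ε := by
  set r := ρ.normed (volume : Measure X) with hr
  have hr0 : ∀ x, 0 ≤ r x := fun x => ρ.nonneg_normed x
  have hrc : Continuous r := ρ.continuous_normed
  have hr1 : ∫⁻ t, ENNReal.ofReal (r t) = 1 := by
    rw [← ofReal_integral_eq_lintegral_ofReal ρ.integrable_normed (Eventually.of_forall hr0),
      ρ.integral_normed, ENNReal.ofReal_one]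
  have hloc : LocallyIntegrable g (volume : Measure X) := hg.locallyIntegrable (by norm_num)
  have hex : ConvolutionExists r g (ContinuousLinearMap.lsmul ℝ ℝ) (volume : Measure X) :=
    ρ.hasCompactSupport_normed.convolutionExists_left _ hrc hloc
  have hpt : ∀ x, ‖(r ⋆[ContinuousLinearMap.lsmul ℝ ℝ, volume] g) x - g x‖ₑ ^ 2
      ≤ ∫⁻ t, ENNReal.ofReal (r t) * ‖g (x - t) - g x‖ₑ ^ 2 := by
    intro x
    have e : (r ⋆[ContinuousLinearMap.lsmul ℝ ℝ, volume] g) x - g x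
        = ∫ t, r t • (g (x - t) - g x) := by
      rw [convolution_def]
      have h1 : g x = ∫ t, r t • g x := by
        rw [integral_smul_const, ρ.integral_normed, one_smul]
      conv_lhs => rw [h1]
      rw [← integral_sub]
      · simp [smul_sub]
      · exact hex x
      · exact ρ.integrable_normed.smul_const _
    rw [e]
    have hm : Measurable fun t => ‖g (x - t) - g x‖ₑ := by
      have : StronglyMeasurable fun t => g (x - t) - g x :=
        (hgm.comp_measurable (by fun_prop)).sub stronglyMeasurable_const
      exact this.enorm
    refine le_trans (pow_le_pow_left' ?_ 2) (moll_aux hr0 hrc.measurable hr1 hm)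
    refine (enorm_integral_le_lintegral_enorm _).trans (le_of_eq ?_)
    refine lintegral_congr fun t => ?_
    rw [enorm_smul, Real.enorm_of_nonneg (hr0 t)]
  rw [← ENNReal.pow_le_pow_left_iff (n := 2) (by norm_num), eLpNorm_two_sq]
  have hm2 : Measurable (Function.uncurry fun x t : X => ENNReal.ofReal (r t) * ‖g (x - t) - g x‖ₑ ^ 2) := by
    have h1 : StronglyMeasurable fun p : X × X => g (p.1 - p.2) - g p.1 :=
      (hgm.comp_measurable (by fun_prop)).sub (hgm.comp_measurable (by fun_prop))
    have h2 : Measurable fun p : X × X => ENNReal.ofReal (r p.2) := by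
      have := hrc.measurable
      fun_prop
    exact h2.mul (h1.enorm.pow_const 2)
  calc _ ≤ ∫⁻ x, ∫⁻ t, ENNReal.ofReal (r t) * ‖g (x - t) - g x‖ₑ ^ 2 := lintegral_mono hpt
    _ = ∫⁻ t, ∫⁻ x, ENNReal.ofReal (r t) * ‖g (x - t) - g x‖ₑ ^ 2 :=
        lintegral_lintegral_swap hm2.aemeasurable
    _ ≤ ∫⁻ t, ENNReal.ofReal (r t) * ε ^ 2 := by
        refine lintegral_mono fun t => ?_
        rw [lintegral_const_mul']
        swap; · exact ENNReal.ofReal_ne_top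
        by_cases ht : r t = 0
        · simp [ht]
        · have : t ∈ Function.support r := ht
          rw [ρ.support_normed_eq] at this
          have h3 := H t (lt_trans (by simpa using this) hρ)
          rw [← eLpNorm_two_sq (volume : Measure X) (fun x => g (x - t) - g x)]
          gcongr
    _ = ε ^ 2 := by
        rw [lintegral_mul_const _ (by have := hrc.measurable; fun_prop), hr1, one_mul]

lemma moll {g : X → E} (hg : MemLp g 2 (volume : Measure X)) {ε : ℝ≥0∞} (hε : ε ≠ 0) :
    ∃ δ > 0, ∀ ρ : ContDiffBump (0 : X), ρ.rOut < δ →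
    eLpNorm (fun x => (ρ.normed volume ⋆[ContinuousLinearMap.lsmul ℝ ℝ, volume] g) x - g x) 2
      (volume : Measure X) ≤ ε := by
  set g' := hg.1.mk g with hg'
  have hae : g =ᵐ[volume] g' := hg.1.ae_eq_mk
  have hg2 : MemLp g' 2 (volume : Measure X) := hg.ae_eq hae
  obtain ⟨δ, hδ, H⟩ := translate_small hg2 hε
  refine ⟨δ, hδ, fun ρ hρ => ?_⟩
  have := moll_strong hg2 hg.1.stronglyMeasurable_mk H ρ hρ
  refine le_trans (le_of_eq (eLpNorm_congr_ae ?_)) this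
  have e : (ρ.normed volume ⋆[ContinuousLinearMap.lsmul ℝ ℝ, volume] g)
    = (ρ.normed volume ⋆[ContinuousLinearMap.lsmul ℝ ℝ, volume] g') := 
    convolution_congr _ (ae_eq_refl _) hae
  rw [e]
  filter_upwards [hae] with x hx
  rw [hx]
end Moll
end Part1

section Part2
open Complex MeasureTheory Set Filter Topology
open scoped ENNReal NNReal ContDiff Convolution

section Ops
variable {N : ℕ}
variable {E : Type*} [NormedAddCommGroup E] [NormedSpace ℝ E]
variable {F : Type*} [NormedAddCommGroup F] [NormedSpace ℝ F]

/-- Smooth compactly supported. -/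
def IsT (η : EuclideanSpace ℝ (Fin N) → F) : Prop := ContDiff ℝ ∞ η ∧ HasCompactSupport η

/-- weighted measure -/
noncomputable def wm (φ : EuclideanSpace ℝ (Fin N) → ℝ) : Measure (EuclideanSpace ℝ (Fin N)) :=
  volume.withDensity (fun x => ENNReal.ofReal (Real.exp (-φ x)))

/-- First order operator, classical sense. -/
noncomputable def opC (a : Fin N → E →L[ℝ] F) (B : EuclideanSpace ℝ (Fin N) → E →L[ℝ] F)
    (α : EuclideanSpace ℝ (Fin N) → E) (x : EuclideanSpace ℝ (Fin N)) : F :=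
  ∑ k, a k (pd k α x) + B x (α x)

/-- First order operator, weak sense. -/
def opW (a : Fin N → E →L[ℝ] F) (B : EuclideanSpace ℝ (Fin N) → E →L[ℝ] F)
    (α : EuclideanSpace ℝ (Fin N) → E) (β : EuclideanSpace ℝ (Fin N) → F) : Prop :=
  ∀ η : EuclideanSpace ℝ (Fin N) → ℝ, IsT η →
    ∫ x, η x • β x = ∫ x, (η x • B x (α x) - ∑ k, pd k η x • a k (α x))

lemma contDiff_pd {f : EuclideanSpace ℝ (Fin N) → F} (hf : ContDiff ℝ ∞ f) (k : Fin N) :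
    ContDiff ℝ ∞ (fun x => pd k f x) := by
  unfold pd
  exact (hf.fderiv_right (m := ∞) (by norm_cast)).clm_apply contDiff_const

lemma tsupport_pd_subset (f : EuclideanSpace ℝ (Fin N) → F) (k : Fin N) :
    tsupport (fun x => pd k f x) ⊆ tsupport f := by
  have := tsupport_fderiv_apply_subset ℝ (f := f) (EuclideanSpace.single k (1:ℝ))
  exact this

lemma isT_pd {f : EuclideanSpace ℝ (Fin N) → F} (hf : IsT f) (k : Fin N) :
    IsT (fun x => pd k f x) :=
  ⟨contDiff_pd hf.1 k, hf.2.fderiv_apply (𝕜 := ℝ) _⟩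

lemma IsT.continuous {f : EuclideanSpace ℝ (Fin N) → F} (hf : IsT f) : Continuous f :=
  hf.1.continuous

lemma IsT.smul_left {f : EuclideanSpace ℝ (Fin N) → ℝ} {g : EuclideanSpace ℝ (Fin N) → F}
    (hf : IsT f) (hg : ContDiff ℝ ∞ g) : IsT (fun x => f x • g x) :=
  ⟨hf.1.smul hg, hf.2.smul_right⟩

lemma pd_smul {f : EuclideanSpace ℝ (Fin N) → ℝ} {g : EuclideanSpace ℝ (Fin N) → F}
    (hf : ContDiff ℝ ∞ f) (hg : ContDiff ℝ ∞ g) (k : Fin N) (x) :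
    pd k (fun x => f x • g x) x = pd k f x • g x + f x • pd k g x := by
  unfold pd
  rw [fderiv_fun_smul (hf.differentiable (by simp) x) (hg.differentiable (by simp) x)]
  simp [add_comm]

lemma pd_clm {f : EuclideanSpace ℝ (Fin N) → E} (hf : ContDiff ℝ ∞ f) (L : E →L[ℝ] F)
    (k : Fin N) (x) : pd k (fun x => L (f x)) x = L (pd k f x) := by
  unfold pd
  have := (L.hasFDerivAt.comp x (hf.differentiable (by simp) x).hasFDerivAt).fderiv
  simp only [Function.comp_def] at this
  rw [this]; simp

lemma integral_pd_smul [CompleteSpace F] {f : EuclideanSpace ℝ (Fin N) → ℝ} {g : EuclideanSpace ℝ (Fin N) → F}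
    (hf : ContDiff ℝ ∞ f) (hg : ContDiff ℝ ∞ g) (h : HasCompactSupport f ∨ HasCompactSupport g) (k : Fin N) :
    ∫ x, f x • pd k g x = - ∫ x, pd k f x • g x := by
  unfold pd
  have h1 : HasCompactSupport f ∨ HasCompactSupport g := h
  apply integral_smul_fderiv_eq_neg_fderiv_smul_of_integrable
  · apply Continuous.integrable_of_hasCompactSupport
    · exact (contDiff_pd hf k).continuous.smul hg.continuous
    · rcases h with h | h
      · exact (h.fderiv_apply (𝕜 := ℝ) _).smul_right
      · exact h.smul_left
  · apply Continuous.integrable_of_hasCompactSupport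
    · exact hf.continuous.smul (contDiff_pd hg k).continuous
    · rcases h with h | h
      · exact h.smul_right
      · exact (h.fderiv_apply (𝕜 := ℝ) _).smul_left
  · apply Continuous.integrable_of_hasCompactSupport
    · exact hf.continuous.smul hg.continuous
    · rcases h with h | h
      · exact h.smul_right
      · exact h.smul_left
  · exact fun x _ => hf.differentiable (by simp) x
  · exact fun x _ => hg.differentiable (by simp) x

lemma opW_of_contDiff [CompleteSpace F] (a : Fin N → E →L[ℝ] F) {B : EuclideanSpace ℝ (Fin N) → E →L[ℝ] F}
    (hB : Continuous B) {α : EuclideanSpace ℝ (Fin N) → E} (hα : ContDiff ℝ ∞ α) :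
    opW a B α (opC a B α) := by
  intro η hη
  have hi : ∀ k, Integrable (fun x => η x • a k (pd k α x)) := fun k => by
    apply Continuous.integrable_of_hasCompactSupport
    · exact hη.continuous.smul ((a k).continuous.comp (contDiff_pd hα k).continuous)
    · exact hη.2.smul_right
  have hi' : ∀ k, Integrable (fun x => pd k η x • a k (α x)) := fun k => by
    apply Continuous.integrable_of_hasCompactSupport
    · exact (isT_pd hη k).continuous.smul ((a k).continuous.comp hα.continuous)
    · exact (isT_pd hη k).2.smul_right
  have hi0 : Integrable (fun x => η x • B x (α x)) := by
    apply Continuous.integrable_of_hasCompactSupport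
    · exact hη.continuous.smul (hB.clm_apply hα.continuous)
    · exact hη.2.smul_right
  have : ∀ x, η x • opC a B α x = ∑ k, η x • a k (pd k α x) + η x • B x (α x) := by
    intro x; rw [opC, smul_add, Finset.smul_sum]
  simp only [this]
  rw [integral_add (integrable_finsetSum _ fun k _ => hi k) hi0,
    integral_sub hi0 (integrable_finsetSum _ fun k _ => hi' k),
    integral_finsetSum _ (fun k _ => hi k), integral_finsetSum _ (fun k _ => hi' k), add_comm, sub_eq_add_neg,
    ← Finset.sum_neg_distrib]
  congr 1
  refine Finset.sum_congr rfl fun k _ => ?_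
  have h5 := integral_pd_smul hη.1 ((a k).contDiff.comp hα) (Or.inl hη.2) k
  simp only [Function.comp_def, pd_clm hα] at h5
  exact h5
end Ops
end Part2

section Part3
open Complex MeasureTheory Set Filter Topology
open scoped ENNReal NNReal ContDiff Convolution

section WM
variable {N : ℕ} {φ : EuclideanSpace ℝ (Fin N) → ℝ}
variable {E : Type*} [NormedAddCommGroup E] [NormedSpace ℝ E]
variable {F : Type*} [NormedAddCommGroup F] [NormedSpace ℝ F]

lemma wm_meas (hφ : Continuous φ) : Measurable fun x => ENNReal.ofReal (Real.exp (-φ x)) := by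
  have : Continuous fun x => Real.exp (-φ x) := by fun_prop
  exact this.measurable.ennreal_ofReal

lemma lintegral_wm (hφ : Continuous φ) (f : EuclideanSpace ℝ (Fin N) → ℝ≥0∞) :
    ∫⁻ x, f x ∂(wm φ) = ∫⁻ x, ENNReal.ofReal (Real.exp (-φ x)) * f x := by
  rw [wm, lintegral_withDensity_eq_lintegral_mul_non_measurable _ (wm_meas hφ)]
  · rfl
  · exact Eventually.of_forall fun x => ENNReal.ofReal_lt_top

lemma integral_wm (hφ : Continuous φ) (f : EuclideanSpace ℝ (Fin N) → F) :
    ∫ x, f x ∂(wm φ) = ∫ x, Real.exp (-φ x) • f x := by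
  rw [wm, integral_withDensity_eq_integral_toReal_smul (wm_meas hφ)
    (Eventually.of_forall fun x => ENNReal.ofReal_lt_top)]
  simp [ENNReal.toReal_ofReal (Real.exp_pos _).le]

lemma integrable_wm (hφ : Continuous φ) (f : EuclideanSpace ℝ (Fin N) → F) :
    Integrable f (wm φ) ↔ Integrable fun x => Real.exp (-φ x) • f x := by
  rw [wm, integrable_withDensity_iff_integrable_smul' (wm_meas hφ)
    (Eventually.of_forall fun x => ENNReal.ofReal_lt_top)]
  simp [ENNReal.toReal_ofReal (Real.exp_pos _).le]

lemma wm_ac : wm φ ≪ (volume : Measure (EuclideanSpace ℝ (Fin N))) :=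
  withDensity_absolutelyContinuous _ _

lemma ac_wm (hφ : Continuous φ) : (volume : Measure (EuclideanSpace ℝ (Fin N))) ≪ wm φ :=
  withDensity_absolutelyContinuous' (wm_meas hφ).aemeasurable
    (Eventually.of_forall fun x => by simp [Real.exp_pos])

lemma wm_locallyFinite (hφ : Continuous φ) : IsLocallyFiniteMeasure (wm φ) := by
  have : Continuous fun x => Real.exp (-φ x) := by fun_prop
  exact IsLocallyFiniteMeasure.withDensity_ofReal this

lemma wm_compare (hφ : Continuous φ) {K : Set (EuclideanSpace ℝ (Fin N))} (hK : IsCompact K) :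
    ∃ C : ℝ≥0∞, C ≠ (⊤ : ℝ≥0∞) ∧ C ≠ 0 ∧ ∀ h : EuclideanSpace ℝ (Fin N) → F, (∀ x ∉ K, h x = 0) →
      eLpNorm h 2 (wm φ) ≤ C * eLpNorm h 2 volume ∧ eLpNorm h 2 volume ≤ C * eLpNorm h 2 (wm φ) := by
  obtain ⟨M, hM⟩ := hK.exists_bound_of_continuousOn hφ.continuousOn
  set M' := max M 0
  have hM' : ∀ x ∈ K, |φ x| ≤ M' := fun x hx => (hM x hx).trans (le_max_left _ _)
  have hM0 : 0 ≤ M' := le_max_right _ _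
  refine ⟨ENNReal.ofReal (Real.exp M'), ENNReal.ofReal_ne_top, by simp [Real.exp_pos], fun h hh => ?_⟩
  have h1 : (1:ℝ) ≤ Real.exp M' := Real.one_le_exp hM0
  have h2 : Real.exp M' ≤ Real.exp M' ^ 2 := by nlinarith
  constructor
  · rw [← ENNReal.pow_le_pow_left_iff (n := 2) (by norm_num), mul_pow, eLpNorm_two_sq, eLpNorm_two_sq,
      lintegral_wm hφ, ← lintegral_const_mul' _ _ (by simp)]
    refine lintegral_mono fun x => ?_
    by_cases hx : x ∈ K
    · simp only
      gcongr
      rw [← ENNReal.ofReal_pow (Real.exp_pos _).le]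
      apply ENNReal.ofReal_le_ofReal
      refine le_trans (Real.exp_le_exp.2 ?_) h2
      linarith [(abs_le.1 (hM' x hx)).1]
    · simp [hh x hx]
  · rw [← ENNReal.pow_le_pow_left_iff (n := 2) (by norm_num), mul_pow, eLpNorm_two_sq, eLpNorm_two_sq,
      lintegral_wm hφ, ← lintegral_const_mul' _ _ (by simp)]
    refine lintegral_mono fun x => ?_
    by_cases hx : x ∈ K
    · simp only
      rw [← mul_assoc, ← ENNReal.ofReal_pow (Real.exp_pos _).le, ← ENNReal.ofReal_mul (by positivity)]
      refine le_trans (le_of_eq (one_mul _).symm) ?_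
      gcongr
      rw [← ENNReal.ofReal_one]
      apply ENNReal.ofReal_le_ofReal
      have h3 : Real.exp M' * Real.exp (-φ x) ≥ 1 := by
        rw [← Real.exp_add]; exact Real.one_le_exp (by linarith [(abs_le.1 (hM' x hx)).2])
      nlinarith [Real.exp_pos (-φ x)]
    · simp [hh x hx]

lemma memLp_vol_of_wm (hφ : Continuous φ) {K : Set (EuclideanSpace ℝ (Fin N))} (hK : IsCompact K)
    {h : EuclideanSpace ℝ (Fin N) → F} (hh : ∀ x ∉ K, h x = 0) (hm : MemLp h 2 (wm φ)) :
    MemLp h 2 volume := by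
  obtain ⟨C, hC, -, H⟩ := wm_compare (F := F) hφ hK
  exact ⟨hm.1.mono_ac (ac_wm hφ), lt_of_le_of_lt (H h hh).2 (ENNReal.mul_lt_top hC.lt_top hm.2)⟩

lemma memLp_wm_of_vol (hφ : Continuous φ) {K : Set (EuclideanSpace ℝ (Fin N))} (hK : IsCompact K)
    {h : EuclideanSpace ℝ (Fin N) → F} (hh : ∀ x ∉ K, h x = 0) (hm : MemLp h 2 volume) :
    MemLp h 2 (wm φ) := by
  obtain ⟨C, hC, -, H⟩ := wm_compare (F := F) hφ hK
  exact ⟨hm.1.mono_ac wm_ac, lt_of_le_of_lt (H h hh).1 (ENNReal.mul_lt_top hC.lt_top hm.2)⟩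

lemma locInt_of_wm (hφ : Continuous φ) {h : EuclideanSpace ℝ (Fin N) → F} (hm : MemLp h 2 (wm φ)) :
    LocallyIntegrable h volume := by
  rw [locallyIntegrable_iff]
  intro K hK
  have : MemLp (K.indicator h) 2 (volume : Measure (EuclideanSpace ℝ (Fin N))) :=
    memLp_vol_of_wm hφ hK (fun x hx => by simp [hx]) (hm.indicator hK.measurableSet)
  have h2 : MemLp h 2 (volume.restrict K) := by
    rwa [memLp_indicator_iff_restrict hK.measurableSet] at this
  have : IsFiniteMeasure ((volume : Measure (EuclideanSpace ℝ (Fin N))).restrict K) :=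
    ⟨by simpa using hK.measure_lt_top⟩
  exact h2.integrable (by norm_num)

lemma IsT.memLp (hφ : Continuous φ) {h : EuclideanSpace ℝ (Fin N) → F} (hh : Continuous h)
    (hc : HasCompactSupport h) : MemLp h 2 (wm φ) := by
  have := wm_locallyFinite hφ
  exact hh.memLp_of_hasCompactSupport hc

/-- dominated convergence with pointwise eventual vanishing -/
lemma eLpNorm_tendsto_zero {Y : Type*} [MeasurableSpace Y] {μ : Measure Y}
    {α : Y → E} {β : Y → F} (hα : MemLp α 2 μ) (hβ : MemLp β 2 μ) {G : Type*} [NormedAddCommGroup G]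
    (h : ℕ → Y → G) (hm : ∀ n, AEStronglyMeasurable (h n) μ) (C : ℝ)
    (hb : ∀ n x, ‖h n x‖ ≤ C * (‖α x‖ + ‖β x‖)) (h0 : ∀ x, ∀ᶠ n in atTop, h n x = 0) :
    Tendsto (fun n => eLpNorm (h n) 2 μ) atTop (𝓝 0) := by
  have hb' : MemLp (fun x => C * (‖α x‖ + ‖β x‖)) 2 μ := (hα.norm.add hβ.norm).const_mul C
  have key : Tendsto (fun n => ∫⁻ x, ‖h n x‖ₑ ^ 2 ∂μ) atTop (𝓝 (∫⁻ x, 0 ∂μ)) := by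
    refine tendsto_lintegral_of_dominated_convergence' (fun x => ‖C * (‖α x‖ + ‖β x‖)‖ₑ ^ 2)
      (fun n => (hm n).enorm.pow_const 2) (fun n => ?_) ?_ ?_
    · refine Eventually.of_forall fun x => ?_
      refine pow_le_pow_left' ?_ 2
      rw [enorm_le_iff_norm_le]
      exact (hb n x).trans (le_abs_self _)
    · rw [← eLpNorm_two_sq]
      exact (ENNReal.pow_lt_top hb'.2).ne
    · refine Eventually.of_forall fun x => ?_
      refine tendsto_const_nhds.congr' ?_
      filter_upwards [h0 x] with n hn
      simp [hn]
  simp only [lintegral_zero, ← eLpNorm_two_sq] at key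
  have h2 := (ENNReal.continuous_rpow_const (y := 1/2)).tendsto 0 |>.comp key
  simp only [Function.comp_def] at h2
  have h3 : ∀ n, (eLpNorm (h n) 2 μ ^ 2) ^ (1/2 : ℝ) = eLpNorm (h n) 2 μ := by
    intro n
    rw [← ENNReal.rpow_natCast, ← ENNReal.rpow_mul]; norm_num
  simp only [h3] at h2
  simpa using h2
end WM
end Part3

section Part4
open Complex MeasureTheory Set Filter Topology
open scoped ENNReal NNReal ContDiff Convolution

section Density
variable {N : ℕ} {φ : EuclideanSpace ℝ (Fin N) → ℝ}
variable {E : Type*} [NormedAddCommGroup E] [NormedSpace ℝ E]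
variable {F : Type*} [NormedAddCommGroup F] [NormedSpace ℝ F]

lemma ae_clm {μ : Measure (EuclideanSpace ℝ (Fin N))}
    {B : EuclideanSpace ℝ (Fin N) → E →L[ℝ] F} (hB : Continuous B) {α : EuclideanSpace ℝ (Fin N) → E}
    (hα : AEStronglyMeasurable α μ) : AEStronglyMeasurable (fun x => B x (α x)) μ :=
  (ContinuousLinearMap.id ℝ (E →L[ℝ] F)).aestronglyMeasurable_comp₂ hB.aestronglyMeasurable hα

lemma locInt_clm {B : EuclideanSpace ℝ (Fin N) → E →L[ℝ] F} (hB : Continuous B)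
    {α : EuclideanSpace ℝ (Fin N) → E} (hα : LocallyIntegrable α) :
    LocallyIntegrable (fun x => B x (α x)) := by
  rw [locallyIntegrable_iff]
  intro K hK
  obtain ⟨M, hM⟩ := hK.exists_bound_of_continuousOn hB.continuousOn
  have h1 := (locallyIntegrable_iff.1 hα K hK)
  refine Integrable.mono' (h1.norm.const_mul M) (ae_clm hB h1.1) ?_
  filter_upwards [ae_restrict_mem hK.measurableSet] with x hx
  exact (B x).le_of_opNorm_le (hM x hx) _

lemma opW_int1 {B : EuclideanSpace ℝ (Fin N) → E →L[ℝ] F} (hB : Continuous B)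
    {α : EuclideanSpace ℝ (Fin N) → E} (hα : LocallyIntegrable α)
    {η : EuclideanSpace ℝ (Fin N) → ℝ} (hη : IsT η) : Integrable (fun x => η x • B x (α x)) :=
  (locInt_clm hB hα).integrable_smul_left_of_hasCompactSupport hη.continuous hη.2

lemma opW_int2 (a : E →L[ℝ] F)
    {α : EuclideanSpace ℝ (Fin N) → E} (hα : LocallyIntegrable α)
    {η : EuclideanSpace ℝ (Fin N) → ℝ} (hη : IsT η) (k : Fin N) :
    Integrable (fun x => pd k η x • a (α x)) :=
  opW_int1 (continuous_const (y := a)) hα (isT_pd hη k)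

lemma opW_int3 (a : Fin N → E →L[ℝ] F) {B : EuclideanSpace ℝ (Fin N) → E →L[ℝ] F} (hB : Continuous B)
    {α : EuclideanSpace ℝ (Fin N) → E} (hα : LocallyIntegrable α)
    {η : EuclideanSpace ℝ (Fin N) → ℝ} (hη : IsT η) :
    Integrable (fun x => (η x • B x (α x) - ∑ k, pd k η x • a k (α x))) :=
  (opW_int1 hB hα hη).sub (integrable_finsetSum _ fun k _ => opW_int2 (a k) hα hη k)

lemma opW_cutoff (a : Fin N → E →L[ℝ] F) {B : EuclideanSpace ℝ (Fin N) → E →L[ℝ] F} (hB : Continuous B)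
    {α : EuclideanSpace ℝ (Fin N) → E} (hα : LocallyIntegrable α)
    {β : EuclideanSpace ℝ (Fin N) → F} (hβ : LocallyIntegrable β) (h : opW a B α β)
    {κ : EuclideanSpace ℝ (Fin N) → ℝ} (hκ : ContDiff ℝ ∞ κ) :
    opW a B (fun x => κ x • α x) (fun x => κ x • β x + ∑ k, pd k κ x • a k (α x)) := by
  intro η hη
  have hηκ : IsT (fun x => η x • κ x) := hη.smul_left hκ
  have h1 := h _ hηκ
  have i1 : Integrable (fun x => (η x • κ x) • β x) :=
    hβ.integrable_smul_left_of_hasCompactSupport hηκ.continuous hηκ.2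
  have i2 : Integrable (fun x => ∑ k, (η x • pd k κ x) • a k (α x)) := by
    refine integrable_finsetSum _ fun k _ => ?_
    exact opW_int1 (continuous_const (y := a k)) hα (hη.smul_left (contDiff_pd hκ k))
  have e1 : ∀ x, η x • (κ x • β x + ∑ k, pd k κ x • a k (α x)) =
      (η x • κ x) • β x + ∑ k, (η x • pd k κ x) • a k (α x) := by
    intro x; simp only [smul_add, Finset.smul_sum, smul_smul, smul_eq_mul]
  simp only [e1]
  rw [integral_add i1 i2, h1, ← integral_add (opW_int3 a hB hα hηκ) i2]
  congr 1
  ext x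
  simp only [pd_smul hη.1 hκ]
  simp only [map_smul, add_smul, smul_smul, Finset.sum_add_distrib, smul_eq_mul]
  simp only [mul_comm]
  abel

lemma conv_pd [CompleteSpace E] {ρ : EuclideanSpace ℝ (Fin N) → ℝ} (hρ : IsT ρ)
    {α : EuclideanSpace ℝ (Fin N) → E} (hα : LocallyIntegrable α) (k : Fin N) (x) :
    pd k (ρ ⋆[ContinuousLinearMap.lsmul ℝ ℝ, volume] α) x = ∫ t, pd k ρ (x - t) • α t := by
  unfold pd
  rw [(hρ.2.hasFDerivAt_convolution_left (ContinuousLinearMap.lsmul ℝ ℝ)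
    (hρ.1.of_le (by norm_cast)) hα x).fderiv]
  have h1 : ConvolutionExistsAt (fderiv ℝ ρ) α x
    ((ContinuousLinearMap.lsmul ℝ ℝ : ℝ →L[ℝ] E →L[ℝ] E).precompL (EuclideanSpace ℝ (Fin N))) volume :=
    (hρ.2.fderiv (𝕜 := ℝ)).convolutionExists_left _ (hρ.1.continuous_fderiv (by simp)) hα x
  rw [convolution_def, ContinuousLinearMap.integral_apply h1]
  simp only [ContinuousLinearMap.precompL_apply, ContinuousLinearMap.lsmul_apply]
  rw [← integral_sub_left_eq_self _ volume x]
  simp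

lemma conv_op [CompleteSpace E] [CompleteSpace F]
    (a : Fin N → E →L[ℝ] F) {B : EuclideanSpace ℝ (Fin N) → E →L[ℝ] F} (hB : Continuous B)
    {α : EuclideanSpace ℝ (Fin N) → E} (hα : LocallyIntegrable α)
    {β : EuclideanSpace ℝ (Fin N) → F} (h : opW a B α β)
    {ρ : EuclideanSpace ℝ (Fin N) → ℝ} (hρ : IsT ρ) (x) :
    ∑ k, a k (pd k (ρ ⋆[ContinuousLinearMap.lsmul ℝ ℝ, volume] α) x) +
      (ρ ⋆[ContinuousLinearMap.lsmul ℝ ℝ, volume] (fun x => B x (α x))) x =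
      (ρ ⋆[ContinuousLinearMap.lsmul ℝ ℝ, volume] β) x := by
  have tr : ∀ {η : EuclideanSpace ℝ (Fin N) → ℝ}, IsT η → IsT (fun t => η (x - t)) := by
    intro η hη
    refine ⟨hη.1.comp (by fun_prop), ?_⟩
    exact hη.2.comp_homeomorph (Homeomorph.subLeft x)
  have h1 := h _ (tr hρ)
  have e : ∀ k t, pd k (fun t => ρ (x - t)) t = - pd k ρ (x - t) := by
    intro k t
    unfold pd
    have : HasFDerivAt (fun t => ρ (x - t)) ((fderiv ℝ ρ (x-t)).comp (-ContinuousLinearMap.id ℝ _)) t :=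
      HasFDerivAt.comp t (hρ.1.differentiable (by simp) (x - t)).hasFDerivAt
        ((hasFDerivAt_id t).const_sub x)
    rw [this.fderiv]; simp
  simp only [e, neg_smul, Finset.sum_neg_distrib, sub_neg_eq_add] at h1
  rw [convolution_lsmul_swap, convolution_lsmul_swap, h1, integral_add, integral_finsetSum, add_comm]
  · congr 1
    refine Finset.sum_congr rfl fun k _ => ?_
    rw [conv_pd hρ hα, ← ContinuousLinearMap.integral_comp_comm]
    · simp
    · exact hα.integrable_smul_left_of_hasCompactSupport (tr (isT_pd hρ k)).continuous (tr (isT_pd hρ k)).2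
  · intro k _
    exact opW_int1 (continuous_const (y := a k)) hα (tr (isT_pd hρ k))
  · exact opW_int1 hB hα (tr hρ)
  · exact integrable_finsetSum _ fun k _ =>  opW_int1 (continuous_const (y := a k)) hα (tr (isT_pd hρ k))

end Density
end Part4

section Part5
open Complex MeasureTheory Set Filter Topology
open scoped ENNReal NNReal ContDiff Convolution

section Density
variable {N : ℕ} {φ : EuclideanSpace ℝ (Fin N) → ℝ}
variable {E : Type} [NormedAddCommGroup E] [NormedSpace ℝ E]
variable {F : Type} [NormedAddCommGroup F] [NormedSpace ℝ F]

lemma density_compact [CompleteSpace E] [CompleteSpace F] (hφ : Continuous φ)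
    (a : Fin N → E →L[ℝ] F) {B : EuclideanSpace ℝ (Fin N) → E →L[ℝ] F} (hB : Continuous B)
    {α : EuclideanSpace ℝ (Fin N) → E} (hα : MemLp α 2 (wm φ))
    {β : EuclideanSpace ℝ (Fin N) → F} (hβ : MemLp β 2 (wm φ)) (h : opW a B α β)
    {K : Set (EuclideanSpace ℝ (Fin N))} (hK : IsCompact K) (hαK : ∀ x ∉ K, α x = 0)
    (hβK : ∀ x ∉ K, β x = 0) {ε : ℝ≥0∞} (hε : ε ≠ 0) :
    ∃ α' : EuclideanSpace ℝ (Fin N) → E, IsT α' ∧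
      eLpNorm (fun x => α' x - α x) 2 (wm φ) ≤ ε ∧
      eLpNorm (fun x => opC a B α' x - β x) 2 (wm φ) ≤ ε := by
  set K1 := Metric.cthickening 1 K with hK1
  have hK1c : IsCompact K1 := hK.cthickening
  have hKK1 : K ⊆ K1 := Metric.self_subset_cthickening K
  obtain ⟨C1, hC1, hC10, H1⟩ := wm_compare (F := E) hφ hK1c
  obtain ⟨C2, hC2, hC20, H2⟩ := wm_compare (F := F) hφ hK1c
  obtain ⟨M, hM⟩ := hK1c.exists_bound_of_continuousOn hB.continuousOn
  set D : ℝ≥0∞ := C1 + C2 * (2 + ENNReal.ofReal M) with hD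
  have hDt : D ≠ ⊤ := by
    rw [hD]; finiteness
  have hε' : ε / D ≠ 0 := by
    simp [ENNReal.div_eq_zero_iff, hε, hDt]
  set ε' := ε / D with hε'd
  have hDε : D * ε' ≤ ε := ENNReal.mul_div_le
  have hαv : MemLp α 2 volume := memLp_vol_of_wm hφ hK hαK hα
  have hβv : MemLp β 2 volume := memLp_vol_of_wm hφ hK hβK hβ
  have hBv : MemLp (fun x => B x (α x)) 2 volume := by
    refine MemLp.of_le_mul (c := M) hαv (ae_clm hB hαv.1) (Eventually.of_forall fun x => ?_)
    by_cases hx : x ∈ K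
    · exact (B x).le_of_opNorm_le (hM x (hKK1 hx)) _
    · simp [hαK x hx]
  have hαl : LocallyIntegrable α volume := hαv.locallyIntegrable (by norm_num)
  obtain ⟨δ1, hδ1, G1⟩ := moll hαv hε'
  obtain ⟨δ2, hδ2, G2⟩ := moll hβv hε'
  obtain ⟨δ3, hδ3, G3⟩ := moll hBv hε'
  set δ := min 1 (min δ1 (min δ2 δ3)) with hδ
  have hδ0 : 0 < δ := by rw [hδ]; positivity
  let ρ : ContDiffBump (0 : EuclideanSpace ℝ (Fin N)) :=
    { rIn := δ/4, rOut := δ/2, rIn_pos := by positivity, rIn_lt_rOut := by linarith }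
  have hρδ : ρ.rOut < δ := by change δ/2 < δ; linarith
  have m1 : δ ≤ 1 := min_le_left _ _
  have m2 : δ ≤ δ1 := (min_le_right _ _).trans (min_le_left _ _)
  have m3 : δ ≤ δ2 := (min_le_right _ _).trans ((min_le_right _ _).trans (min_le_left _ _))
  have m4 : δ ≤ δ3 := (min_le_right _ _).trans ((min_le_right _ _).trans (min_le_right _ _))
  have g1 := G1 ρ (hρδ.trans_le m2)
  have g2 := G2 ρ (hρδ.trans_le m3)
  have g3 := G3 ρ (hρδ.trans_le m4)
  have hρT : IsT (ρ.normed volume) := ⟨ρ.contDiff_normed, ρ.hasCompactSupport_normed⟩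
  have van : ∀ {G : Type} [NormedAddCommGroup G] [NormedSpace ℝ G] 
      (g : EuclideanSpace ℝ (Fin N) → G), (∀ x ∉ K, g x = 0) → ∀ x ∉ K1,
      (ρ.normed volume ⋆[ContinuousLinearMap.lsmul ℝ ℝ, volume] g) x = 0 := by
    intro G _ _ g hg x hx
    rw [convolution_lsmul_swap]
    have : ∀ t, ρ.normed volume (x - t) • g t = 0 := by
      intro t
      by_cases ht : t ∈ K
      · have : ρ.normed volume (x - t) = 0 := by
          have := ρ.support_normed_eq (μ := (volume : Measure (EuclideanSpace ℝ (Fin N))))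
          rw [← Function.notMem_support, this, Metric.mem_ball, dist_zero_right, not_lt]
          by_contra hlt
          push Not at hlt
          refine hx (Metric.mem_cthickening_of_dist_le x t 1 K ht ?_)
          rw [dist_eq_norm]; linarith
        rw [this, zero_smul]
      · rw [hg t ht, smul_zero]
    simp [this]
  refine ⟨ρ.normed volume ⋆[ContinuousLinearMap.lsmul ℝ ℝ, volume] α, ⟨?_, ?_⟩, ?_, ?_⟩
  · exact hρT.2.contDiff_convolution_left _ hρT.1 hαl
  · exact HasCompactSupport.intro hK1c (van α hαK)
  · refine ((H1 _ fun x hx => ?_).1).trans ?_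
    · rw [van α hαK x hx, hαK x (fun h => hx (hKK1 h)), sub_zero]
    · refine le_trans ?_ hDε
      gcongr
      rw [hD]; exact le_self_add
  · have e : ∀ x, opC a B (ρ.normed volume ⋆[ContinuousLinearMap.lsmul ℝ ℝ, volume] α) x - β x =
        (((ρ.normed volume ⋆[ContinuousLinearMap.lsmul ℝ ℝ, volume] β) x - β x) -
        ((ρ.normed volume ⋆[ContinuousLinearMap.lsmul ℝ ℝ, volume] (fun x => B x (α x))) x - B x (α x))) +
        B x ((ρ.normed volume ⋆[ContinuousLinearMap.lsmul ℝ ℝ, volume] α) x - α x) := by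
      intro x
      rw [opC, ← conv_op a hB hαl h hρT x, map_sub]
      abel
    have hc : ∀ {G : Type} [NormedAddCommGroup G] [NormedSpace ℝ G] [CompleteSpace G] 
      {g : EuclideanSpace ℝ (Fin N) → G} , MemLp g 2 volume → 
      AEStronglyMeasurable (fun x => (ρ.normed volume ⋆[ContinuousLinearMap.lsmul ℝ ℝ, volume] g) x - g x) volume := by
      intro G _ _ _ g hg
      refine AEStronglyMeasurable.sub (Continuous.aestronglyMeasurable ?_) hg.1
      exact (hρT.2.contDiff_convolution_left _ hρT.1 (hg.locallyIntegrable (by norm_num))).continuous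
    refine ((H2 _ fun x hx => ?_).1).trans ?_
    · have hx' : x ∉ K := fun h => hx (hKK1 h)
      rw [e, van α hαK x hx, van β hβK x hx, van _ (fun x hx => by simp [hαK x hx]) x hx, hαK x hx', hβK x hx']
      simp
    · have t1 : eLpNorm (fun x => B x ((ρ.normed volume ⋆[ContinuousLinearMap.lsmul ℝ ℝ, volume] α) x - α x)) 2 volume
          ≤ ENNReal.ofReal M * ε' := by
        refine (eLpNorm_le_mul_eLpNorm_of_ae_le_mul (c := M)
          (g := fun x => (ρ.normed volume ⋆[ContinuousLinearMap.lsmul ℝ ℝ, volume] α) x - α x) (Eventually.of_forall fun x => ?_) 2).trans ?_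
        · by_cases hx : x ∈ K1
          · exact (B x).le_of_opNorm_le (hM x hx) _
          · simp [van α hαK x hx, hαK x (fun h => hx (hKK1 h))]
        · gcongr
      simp only [e]
      refine le_trans ?_ hDε
      have : D * ε' ≥ C2 * ((ε' + ε') + ENNReal.ofReal M * ε') := by
        rw [hD, add_mul]
        refine le_trans (le_of_eq ?_) le_add_self
        ring
      refine le_trans ?_ this
      gcongr
      refine (eLpNorm_add_le ((hc hβv).sub (hc hBv)) (ae_clm hB (hc hαv)) (by norm_num)).trans ?_
      gcongr
      refine (eLpNorm_sub_le (hc hβv) (hc hBv) (by norm_num)).trans ?_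
      gcongr

lemma density [CompleteSpace E] [CompleteSpace F] (hφ : Continuous φ)
    (a : Fin N → E →L[ℝ] F) {B : EuclideanSpace ℝ (Fin N) → E →L[ℝ] F} (hB : Continuous B)
    {α : EuclideanSpace ℝ (Fin N) → E} (hα : MemLp α 2 (wm φ))
    {β : EuclideanSpace ℝ (Fin N) → F} (hβ : MemLp β 2 (wm φ)) (h : opW a B α β)
    {ε : ℝ≥0∞} (hε : ε ≠ 0) :
    ∃ α' : EuclideanSpace ℝ (Fin N) → E, IsT α' ∧
      eLpNorm (fun x => α' x - α x) 2 (wm φ) ≤ ε ∧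
      eLpNorm (fun x => opC a B α' x - β x) 2 (wm φ) ≤ ε := by
  let b : ContDiffBump (0 : EuclideanSpace ℝ (Fin N)) :=
    { rIn := 1, rOut := 2, rIn_pos := one_pos, rIn_lt_rOut := by norm_num }
  let κ : ℕ → EuclideanSpace ℝ (Fin N) → ℝ := fun n x => b ((n + 1 : ℝ)⁻¹ • x)
  have hn : ∀ n : ℕ, (0:ℝ) < (n+1 : ℝ)⁻¹ := fun n => by positivity
  have hn1 : ∀ n : ℕ, (n+1 : ℝ)⁻¹ ≤ 1 := fun n => inv_le_one_of_one_le₀ (by linarith [n.cast_nonneg (α := ℝ)])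
  have hκs : ∀ n, ContDiff ℝ ∞ (κ n) := fun n => b.contDiff.comp (by fun_prop)
  have hκc : ∀ n, HasCompactSupport (κ n) := fun n =>
    b.hasCompactSupport.comp_homeomorph (Homeomorph.smulOfNeZero _ (hn n).ne')
  have hbd : ∀ n x, ‖κ n x‖ ≤ 1 := fun n x => by
    rw [Real.norm_eq_abs, abs_of_nonneg b.nonneg]; exact b.le_one
  obtain ⟨C0, hC0⟩ := (b.hasCompactSupport.fderiv (𝕜 := ℝ)).exists_bound_of_continuous
    (b.contDiff.continuous_fderiv (n := ∞) (by simp))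
  have hC00 : 0 ≤ C0 := (norm_nonneg _).trans (hC0 0)
  have hpd : ∀ n k x, ‖pd k (κ n) x‖ ≤ C0 := by
    intro n k x
    have : HasFDerivAt (κ n) ((fderiv ℝ b ((n + 1 : ℝ)⁻¹ • x)).comp ((n + 1 : ℝ)⁻¹ • ContinuousLinearMap.id ℝ _)) x :=
      HasFDerivAt.comp (g := (b : EuclideanSpace ℝ (Fin N) → ℝ)) x (b.contDiff.differentiable (n := ∞) (by simp) _).hasFDerivAt
        (((n + 1 : ℝ)⁻¹ • ContinuousLinearMap.id ℝ (EuclideanSpace ℝ (Fin N))).hasFDerivAt)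
    unfold pd
    rw [this.fderiv]
    simp only [ContinuousLinearMap.comp_apply, smul_apply, ContinuousLinearMap.id_apply, map_smul]
    rw [norm_smul, Real.norm_of_nonneg (hn n).le]
    have h1 : ‖(fderiv ℝ b ((n + 1 : ℝ)⁻¹ • x)) (EuclideanSpace.single k 1)‖ ≤ C0 * 1 := by
      refine (ContinuousLinearMap.le_of_opNorm_le _ (hC0 _) _).trans ?_
      simp
    calc _ ≤ 1 * (C0 * 1) := by gcongr; exact hn1 n
      _ = C0 := by ring
  have hev : ∀ x, ∀ᶠ n in atTop, κ n =ᶠ[𝓝 x] fun _ => (1:ℝ) := by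
    intro x
    have : Tendsto (fun n : ℕ => (n + 1 : ℝ)⁻¹ * ‖x‖) atTop (𝓝 (0 * ‖x‖)) :=
      (by simpa using tendsto_one_div_add_atTop_nhds_zero_nat (𝕜 := ℝ)
        : Tendsto (fun n : ℕ => (n + 1 : ℝ)⁻¹) atTop (𝓝 0)).mul_const _
    rw [zero_mul] at this
    filter_upwards [this.eventually_lt_const (zero_lt_one)] with n hn'
    have hc : Tendsto (fun y : EuclideanSpace ℝ (Fin N) => (n + 1 : ℝ)⁻¹ • y) (𝓝 x) (𝓝 ((n + 1 : ℝ)⁻¹ • x)) :=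
      (continuous_const_smul _).tendsto x
    refine hc.eventually (b.eventuallyEq_one_of_mem_ball ?_)
    rw [Metric.mem_ball, dist_zero_right, norm_smul, Real.norm_of_nonneg (hn n).le]
    exact hn'
  have hαl := locInt_of_wm hφ hα
  have hβl := locInt_of_wm hφ hβ
  let αn : ℕ → EuclideanSpace ℝ (Fin N) → E := fun n x => κ n x • α x
  let βn : ℕ → EuclideanSpace ℝ (Fin N) → F := fun n x => κ n x • β x + ∑ k, pd k (κ n) x • a k (α x)
  have hαnm : ∀ n, AEStronglyMeasurable (αn n) (wm φ) := fun n =>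
    (hκs n).continuous.aestronglyMeasurable.smul hα.1
  have hβnm : ∀ n, AEStronglyMeasurable (βn n) (wm φ) := fun n => by
    refine ((hκs n).continuous.aestronglyMeasurable.smul hβ.1).add ?_
    refine Finset.aestronglyMeasurable_fun_sum _ fun k _ => ?_
    exact (contDiff_pd (hκs n) k).continuous.aestronglyMeasurable.smul
      ((a k).continuous.comp_aestronglyMeasurable hα.1)
  set C : ℝ := 2 + ∑ k, C0 * ‖a k‖ with hC
  have hC2 : 2 ≤ C := by
    rw [hC]; have : 0 ≤ ∑ k, C0 * ‖a k‖ := Finset.sum_nonneg fun k _ => by positivity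
    linarith
  have t1 : Tendsto (fun n => eLpNorm (fun x => αn n x - α x) 2 (wm φ)) atTop (𝓝 0) := by
    refine eLpNorm_tendsto_zero hα hβ _ (fun n => (hαnm n).sub hα.1) C (fun n x => ?_) (fun x => ?_)
    · calc ‖αn n x - α x‖ ≤ ‖κ n x‖ * ‖α x‖ + ‖α x‖ := by
            refine (norm_sub_le _ _).trans ?_
            rw [norm_smul]
        _ ≤ 1 * ‖α x‖ + ‖α x‖ := by gcongr; exact hbd n x
        _ ≤ C * (‖α x‖ + ‖β x‖) := by nlinarith [norm_nonneg (α x), norm_nonneg (β x)]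
    · filter_upwards [hev x] with n hn
      simp [αn, hn.eq_of_nhds]
  have hsum : ∀ n x, ‖∑ k, pd k (κ n) x • a k (α x)‖ ≤ (∑ k, C0 * ‖a k‖) * ‖α x‖ := by
    intro n x
    refine (norm_sum_le _ _).trans ?_
    rw [Finset.sum_mul]
    refine Finset.sum_le_sum fun k _ => ?_
    rw [norm_smul, mul_assoc]
    gcongr
    · exact hpd n k x
    · exact (a k).le_opNorm _
  have t2 : Tendsto (fun n => eLpNorm (fun x => βn n x - β x) 2 (wm φ)) atTop (𝓝 0) := by
    refine eLpNorm_tendsto_zero hα hβ _ (fun n => (hβnm n).sub hβ.1) C (fun n x => ?_) (fun x => ?_)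
    · calc ‖βn n x - β x‖ ≤ (‖κ n x‖ * ‖β x‖ + (∑ k, C0 * ‖a k‖) * ‖α x‖) + ‖β x‖ := by
            refine (norm_sub_le _ _).trans ?_
            gcongr
            refine (norm_add_le _ _).trans ?_
            rw [norm_smul]
            gcongr
            exact hsum n x
        _ ≤ (1 * ‖β x‖ + (∑ k, C0 * ‖a k‖) * ‖α x‖) + ‖β x‖ := by gcongr; exact hbd n x
        _ ≤ C * (‖α x‖ + ‖β x‖) := by
          have : 0 ≤ ∑ k, C0 * ‖a k‖ := Finset.sum_nonneg fun k _ => by positivity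
          rw [hC]
          nlinarith [norm_nonneg (α x), norm_nonneg (β x), mul_nonneg this (norm_nonneg (β x))]
    · filter_upwards [hev x] with n hn
      have : ∀ k, pd k (κ n) x = 0 := by
        intro k; unfold pd; rw [hn.fderiv_eq]; simp
      simp [βn, hn.eq_of_nhds, this]
  have hε2 : 0 < ε / 2 := ENNReal.half_pos hε
  obtain ⟨n, h1, h2⟩ := ((t1.eventually_lt_const hε2).and (t2.eventually_lt_const hε2)).exists
  have hαn : MemLp (αn n) 2 (wm φ) := by
    refine hα.of_le_mul (c := 1) (hαnm n) (Eventually.of_forall fun x => ?_)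
    rw [norm_smul]; gcongr; exact hbd n x
  have hβn : MemLp (βn n) 2 (wm φ) := by
    have hd : MemLp (fun x => βn n x - β x) 2 (wm φ) :=
      ⟨(hβnm n).sub hβ.1, lt_of_lt_of_le h2 le_top⟩
    have := hd.add hβ
    refine this.ae_eq (Eventually.of_forall fun x => ?_)
    simp
  have z : ∀ x ∉ tsupport (κ n), κ n x = 0 := fun x hx => image_eq_zero_of_notMem_tsupport hx
  have z' : ∀ k, ∀ x ∉ tsupport (κ n), pd k (κ n) x = 0 := fun k x hx =>
    image_eq_zero_of_notMem_tsupport (fun h => hx (tsupport_pd_subset _ _ h))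
  obtain ⟨α', hT, g1, g2⟩ := density_compact hφ a hB hαn hβn (opW_cutoff a hB hαl hβl h (hκs n)) (hκc n)
    (fun x hx => by simp [αn, z x hx]) (fun x hx => by simp [βn, z x hx, z' _ x hx]) hε2.ne'
  have hopc : AEStronglyMeasurable (opC a B α') (wm φ) := by
    apply Continuous.aestronglyMeasurable
    unfold opC
    refine Continuous.add (continuous_finsetSum _ fun k _ => (a k).continuous.comp (contDiff_pd hT.1 k).continuous) ?_
    exact hB.clm_apply hT.continuous
  refine ⟨α', hT, ?_, ?_⟩
  · have : (fun x => α' x - α x) = (fun x => α' x - αn n x) + (fun x => αn n x - α x) := by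
      ext x; simp
    rw [this]
    refine (eLpNorm_add_le (hT.continuous.aestronglyMeasurable.sub (hαnm n)) ((hαnm n).sub hα.1) (by norm_num)).trans ?_
    rw [← ENNReal.add_halves ε]
    exact add_le_add g1 h1.le
  · have : (fun x => opC a B α' x - β x) = (fun x => opC a B α' x - βn n x) + (fun x => βn n x - β x) := by
      ext x; simp
    rw [this]
    refine (eLpNorm_add_le (hopc.sub (hβnm n)) ((hβnm n).sub hβ.1) (by norm_num)).trans ?_
    rw [← ENNReal.add_halves ε]
    exact add_le_add g2 h2.le

end Density
end Part5

section Part6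
open Complex MeasureTheory Set Filter Topology
open scoped ENNReal NNReal ContDiff Convolution

section Weak
variable {N : ℕ} {φ : EuclideanSpace ℝ (Fin N) → ℝ}
variable {E : Type} [NormedAddCommGroup E] [InnerProductSpace ℂ E] [NormedSpace ℝ E]
  [IsScalarTower ℝ ℂ E] [FiniteDimensional ℂ E]
variable {F : Type} [NormedAddCommGroup F] [InnerProductSpace ℂ F] [NormedSpace ℝ F]
  [IsScalarTower ℝ ℂ F] [FiniteDimensional ℂ F]

/-- restriction of scalars -/
noncomputable def rs (L : E →L[ℂ] F) : E →L[ℝ] F := L.restrictScalars ℝ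

@[simp] lemma rs_apply (L : E →L[ℂ] F) (x : E) : rs L x = L x := rfl

lemma continuous_rs : Continuous (rs : (E →L[ℂ] F) → (E →L[ℝ] F)) := by
  have := (ContinuousLinearMap.restrictScalarsIsometry ℂ E F ℝ ℝ).continuous
  exact this

/-- Hilbert space adjoint -/
noncomputable def adjo (L : E →L[ℂ] F) : F →L[ℂ] E :=
  haveI := FiniteDimensional.complete ℂ E
  haveI := FiniteDimensional.complete ℂ F
  ContinuousLinearMap.adjoint L

lemma adjo_left (L : E →L[ℂ] F) (x : F) (y : E) : inner ℂ (adjo L x) y = inner ℂ x (L y) := by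
  haveI := FiniteDimensional.complete ℂ E
  haveI := FiniteDimensional.complete ℂ F
  exact ContinuousLinearMap.adjoint_inner_left L y x

lemma adjo_adjo (L : E →L[ℂ] F) : adjo (adjo L) = L := by
  haveI := FiniteDimensional.complete ℂ E
  haveI := FiniteDimensional.complete ℂ F
  exact ContinuousLinearMap.adjoint_adjoint L

lemma continuous_adjo : Continuous (adjo : (E →L[ℂ] F) → (F →L[ℂ] E)) := by
  haveI := FiniteDimensional.complete ℂ E
  haveI := FiniteDimensional.complete ℂ F
  exact (ContinuousLinearMap.adjoint (𝕜 := ℂ) (E := E) (F := F)).continuous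

lemma real_smul_cx (r : ℝ) (x : E) : r • x = (r : ℂ) • x := by
  have := smul_assoc r (1:ℂ) x
  rw [one_smul] at this
  rw [← this]; simp

lemma real_inner_left (r : ℝ) (x y : E) : inner ℂ (r • x) y = (r : ℂ) * inner ℂ x y := by
  rw [real_smul_cx, inner_smul_left]; simp

lemma real_inner_right (r : ℝ) (x y : E) : inner ℂ x (r • y) = (r : ℂ) * inner ℂ x y := by
  rw [real_smul_cx, inner_smul_right]

variable (φ) in
/-- test section -/
noncomputable def tst (η : EuclideanSpace ℝ (Fin N) → ℝ) (e : F) (x : EuclideanSpace ℝ (Fin N)) : F :=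
  (Real.exp (φ x) * η x) • e

variable (φ) in
/-- adjoint operator applied to test section -/
noncomputable def adjt (a : Fin N → E →L[ℂ] F) (B : EuclideanSpace ℝ (Fin N) → E →L[ℂ] F)
    (η : EuclideanSpace ℝ (Fin N) → ℝ) (e : F) (x : EuclideanSpace ℝ (Fin N)) : E :=
  Real.exp (φ x) • (η x • adjo (B x) e - ∑ k, pd k η x • adjo (a k) e)

lemma opW_iff (hφ : Continuous φ) (a : Fin N → E →L[ℂ] F) {B : EuclideanSpace ℝ (Fin N) → E →L[ℂ] F}
    (hB : Continuous B) {α : EuclideanSpace ℝ (Fin N) → E} (hα : LocallyIntegrable α)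
    {β : EuclideanSpace ℝ (Fin N) → F} (hβ : LocallyIntegrable β) :
    opW (fun k => rs (a k)) (fun x => rs (B x)) α β ↔
    ∀ η, IsT η → ∀ e : F, ∫ x, inner ℂ (tst φ η e x) (β x) ∂(wm φ) =
      ∫ x, inner ℂ (adjt φ a B η e x) (α x) ∂(wm φ) := by
  haveI := FiniteDimensional.complete ℂ E
  haveI := FiniteDimensional.complete ℂ F
  have hB' : Continuous (fun x => rs (B x)) := continuous_rs.comp hB
  have h1 : ∀ η, IsT η → ∀ e : F, ∫ x, inner ℂ (tst φ η e x) (β x) ∂(wm φ) =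
      inner ℂ e (∫ x, η x • β x) := by
    intro η hη e
    rw [integral_wm hφ, ← integral_inner (hβ.integrable_smul_left_of_hasCompactSupport hη.continuous hη.2)]
    congr 1; ext x
    rw [tst, real_inner_left, real_inner_right, ← Complex.coe_smul, smul_eq_mul, ← mul_assoc, ← Complex.ofReal_mul,
      ← mul_assoc, ← Real.exp_add]
    simp
  have h2 : ∀ η, IsT η → ∀ e : F, ∫ x, inner ℂ (adjt φ a B η e x) (α x) ∂(wm φ) =
      inner ℂ e (∫ x, (η x • rs (B x) (α x) - ∑ k, pd k η x • rs (a k) (α x))) := by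
    intro η hη e
    rw [integral_wm hφ, ← integral_inner (opW_int3 _ hB' hα hη)]
    congr 1; ext x
    rw [adjt, real_inner_left,  ← Complex.coe_smul, smul_eq_mul, ← mul_assoc, ← Complex.ofReal_mul,
      ← Real.exp_add]
    simp only [neg_add_cancel, Real.exp_zero, Complex.ofReal_one, one_mul, inner_sub_left, inner_sub_right,
      real_inner_left, real_inner_right, adjo_left, rs_apply, sum_inner, inner_sum]
  constructor
  · intro h η hη e
    rw [h1 η hη, h2 η hη, h η hη]
  · intro h η hη
    refine ext_inner_left ℂ fun e => ?_
    rw [← h1 η hη, ← h2 η hη, h η hη]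

lemma tst_cont (hφ : Continuous φ) {η : EuclideanSpace ℝ (Fin N) → ℝ} (hη : IsT η) (e : F) :
    Continuous (tst φ η e) := by
  unfold tst
  have := hη.continuous
  fun_prop

lemma tst_comp {η : EuclideanSpace ℝ (Fin N) → ℝ} (hη : IsT η) (e : F) :
    HasCompactSupport (tst φ η e) := by
  unfold tst
  exact (hη.2.mul_left).smul_right

lemma tst_isT (hφ : ContDiff ℝ ∞ φ) {η : EuclideanSpace ℝ (Fin N) → ℝ} (hη : IsT η) (e : F) :
    IsT (tst φ η e) := by
  refine ⟨?_, tst_comp hη e⟩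
  unfold tst
  exact (hφ.exp.mul hη.1).smul contDiff_const

lemma adjt_cont (hφ : Continuous φ) (a : Fin N → E →L[ℂ] F) {B : EuclideanSpace ℝ (Fin N) → E →L[ℂ] F}
    (hB : Continuous B) {η : EuclideanSpace ℝ (Fin N) → ℝ} (hη : IsT η) (e : F) :
    Continuous (adjt φ a B η e) := by
  unfold adjt
  have := hη.continuous
  have h2 : Continuous fun x => adjo (B x) e := (continuous_adjo.comp hB).clm_apply continuous_const
  have h3 : ∀ k, Continuous fun x => pd k η x := fun k => (isT_pd hη k).continuous
  fun_prop

lemma adjt_comp (a : Fin N → E →L[ℂ] F) (B : EuclideanSpace ℝ (Fin N) → E →L[ℂ] F)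
    {η : EuclideanSpace ℝ (Fin N) → ℝ} (hη : IsT η) (e : F) :
    HasCompactSupport (adjt φ a B η e) := by
  refine HasCompactSupport.intro hη.2 fun x hx => ?_
  have h1 : η x = 0 := image_eq_zero_of_notMem_tsupport hx
  have h2 : ∀ k, pd k η x = 0 := fun k => 
    image_eq_zero_of_notMem_tsupport (fun h => hx (tsupport_pd_subset _ _ h))
  simp [adjt, h1, h2]

lemma pd_comm {G : Type} [NormedAddCommGroup G] [NormedSpace ℝ G] {f : EuclideanSpace ℝ (Fin N) → G}
    (hf : ContDiff ℝ ∞ f) (k l : Fin N) (x) :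
    pd k (fun y => pd l f y) x = pd l (fun y => pd k f y) x := by
  have hs : IsSymmSndFDerivAt ℝ f x := hf.contDiffAt.isSymmSndFDerivAt (by simp only [minSmoothness_of_isRCLikeNormedField]; exact WithTop.coe_le_coe.2 le_top)
  have h : ∀ i j : Fin N, pd i (fun y => pd j f y) x =
      fderiv ℝ (fderiv ℝ f) x (EuclideanSpace.single i 1) (EuclideanSpace.single j 1) := by
    intro i j
    unfold pd
    have hd : DifferentiableAt ℝ (fderiv ℝ f) x :=
      (hf.fderiv_right (m := ∞) (by norm_cast)).differentiable (by simp) x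
    rw [fderiv_clm_apply hd (by fun_prop)]
    simp
  rw [h, h]
  exact hs _ _

lemma opW_congr {a : Fin N → E →L[ℝ] F} {B : EuclideanSpace ℝ (Fin N) → E →L[ℝ] F}
    {α α' : EuclideanSpace ℝ (Fin N) → E} {β β' : EuclideanSpace ℝ (Fin N) → F}
    (h1 : α =ᵐ[volume] α') (h2 : β =ᵐ[volume] β') (h : opW a B α β) : opW a B α' β' := by
  intro η hη
  have := h η hη
  have e1 := integral_congr_ae (μ := volume) (f := fun x => η x • β x) (g := fun x => η x • β' x) (by filter_upwards [h2] with x hx; simp only [hx])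
  have e2 := integral_congr_ae (μ := volume) (f := fun x => (η x • B x (α x) - ∑ k, pd k η x • a k (α x))) (g := fun x => (η x • B x (α' x) - ∑ k, pd k η x • a k (α' x)))
    (by filter_upwards [h1] with x hx; simp only [hx])
  rw [← e1, ← e2]
  exact this

lemma normsq_toLp {Y : Type} [MeasurableSpace Y] {μ : Measure Y} {f : Y → E} (h : MemLp f 2 μ) :
    ‖h.toLp f‖ ^ 2 = ∫ x, ‖f x‖ ^ 2 ∂μ := by
  rw [Lp.norm_toLp, ← ENNReal.toReal_pow, eLpNorm_two_sq,
    integral_eq_lintegral_of_nonneg_ae (Eventually.of_forall fun x => by positivity) (by exact h.1.norm.pow 2)]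
  congr 2; ext x
  rw [ENNReal.ofReal_pow (norm_nonneg _), ofReal_norm]

end Weak

/-- Riesz type lemma. -/
lemma riesz_range {H M : Type*} [NormedAddCommGroup H] [InnerProductSpace ℂ H] [CompleteSpace H]
    [AddCommGroup M] [Module ℂ M] (L : M →ₗ[ℂ] H) (l : M →ₗ[ℂ] ℂ) (C : ℝ) (hC : 0 ≤ C)
    (h : ∀ α, ‖l α‖ ≤ C * ‖L α‖) : ∃ u : H, ‖u‖ ≤ C ∧ ∀ α, inner ℂ u (L α) = l α := by
  have hker : LinearMap.ker L.rangeRestrict ≤ LinearMap.ker l := by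
    intro x hx
    have : L x = 0 := by simpa using hx
    have h1 := h x
    rw [this, norm_zero, mul_zero] at h1
    simpa using h1
  let g0 : LinearMap.range L →ₗ[ℂ] ℂ :=
    ((LinearMap.ker L.rangeRestrict).liftQ l hker).comp
      (L.rangeRestrict.quotKerEquivOfSurjective L.surjective_rangeRestrict).symm.toLinearMap
  have hg0 : ∀ α, g0 (L.rangeRestrict α) = l α := by
    intro α
    simp only [g0, LinearMap.comp_apply, LinearEquiv.coe_coe]
    have : (L.rangeRestrict.quotKerEquivOfSurjective L.surjective_rangeRestrict).symm (L.rangeRestrict α) =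
        Submodule.Quotient.mk α := by
      rw [LinearEquiv.symm_apply_eq]; rfl
    rw [this]; rfl
  have hb : ∀ y, ‖g0 y‖ ≤ C * ‖y‖ := by
    intro y
    obtain ⟨α, rfl⟩ := L.surjective_rangeRestrict y
    rw [hg0]; exact h α
  let g1 : StrongDual ℂ (LinearMap.range L) := g0.mkContinuous C hb
  obtain ⟨g, hg, hgn⟩ := exists_extension_norm_eq (LinearMap.range L) g1
  refine ⟨(InnerProductSpace.toDual ℂ H).symm g, ?_, fun α => ?_⟩
  · rw [LinearIsometryEquiv.norm_map, hgn]
    exact g0.mkContinuous_norm_le hC hb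
  · rw [InnerProductSpace.toDual_symm_apply]
    have := hg (L.rangeRestrict α)
    rw [← hg0]
    exact this
end Part6

section Part7
open Complex MeasureTheory Set Filter Topology
open scoped ENNReal NNReal ContDiff Convolution

section G
variable {N : ℕ} {φ : EuclideanSpace ℝ (Fin N) → ℝ}
variable {E0 : Type} [NormedAddCommGroup E0] [InnerProductSpace ℂ E0] [NormedSpace ℝ E0]
  [IsScalarTower ℝ ℂ E0] [FiniteDimensional ℂ E0]
variable {E1 : Type} [NormedAddCommGroup E1] [InnerProductSpace ℂ E1] [NormedSpace ℝ E1]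
  [IsScalarTower ℝ ℂ E1] [FiniteDimensional ℂ E1]
variable {E2 : Type} [NormedAddCommGroup E2] [InnerProductSpace ℂ E2] [NormedSpace ℝ E2]
  [IsScalarTower ℝ ℂ E2] [FiniteDimensional ℂ E2]

/-- principal part of the adjoint -/
noncomputable def aT (σ : Fin N → E0 →L[ℂ] E1) (k : Fin N) : E1 →L[ℂ] E0 := -adjo (σ k)

/-- zero order part of the adjoint -/
noncomputable def BT (φ : EuclideanSpace ℝ (Fin N) → ℝ) (σ : Fin N → E0 →L[ℂ] E1)
    (x : EuclideanSpace ℝ (Fin N)) : E1 →L[ℂ] E0 := ∑ k, ((pd k φ x : ℝ) : ℂ) • adjo (σ k)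

lemma BT_cont (hφ : ContDiff ℝ ∞ φ) (σ : Fin N → E0 →L[ℂ] E1) : Continuous (BT φ σ) := by
  unfold BT
  refine continuous_finsetSum _ fun k _ => ?_
  exact (Complex.continuous_ofReal.comp (contDiff_pd hφ k).continuous).smul continuous_const

lemma opC_cont {a : Fin N → E1 →L[ℂ] E0} {B : EuclideanSpace ℝ (Fin N) → E1 →L[ℂ] E0} (hB : Continuous B)
    {α : EuclideanSpace ℝ (Fin N) → E1} (hα : IsT α) :
    Continuous (opC (fun k => rs (a k)) (fun x => rs (B x)) α) := by
  unfold opC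
  refine Continuous.add (continuous_finsetSum _ fun k _ =>
    (rs (a k)).continuous.comp (contDiff_pd hα.1 k).continuous) ?_
  exact (continuous_rs.comp hB).clm_apply hα.continuous

lemma opC_comp {a : Fin N → E1 →L[ℂ] E0} {B : EuclideanSpace ℝ (Fin N) → E1 →L[ℂ] E0} 
    {α : EuclideanSpace ℝ (Fin N) → E1} (hα : IsT α) :
    HasCompactSupport (opC (fun k => rs (a k)) (fun x => rs (B x)) α) := by
  refine HasCompactSupport.intro hα.2 fun x hx => ?_
  have h1 : α x = 0 := image_eq_zero_of_notMem_tsupport hx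
  have h2 : ∀ k, pd k α x = 0 := fun k => 
    image_eq_zero_of_notMem_tsupport (fun h => hx (tsupport_pd_subset _ _ h))
  simp [opC, h1, h2]

lemma opC_memLp (hφ : Continuous φ) {a : Fin N → E1 →L[ℂ] E0}
    {B : EuclideanSpace ℝ (Fin N) → E1 →L[ℂ] E0} (hB : Continuous B)
    {α : EuclideanSpace ℝ (Fin N) → E1} (hα : IsT α) :
    MemLp (opC (fun k => rs (a k)) (fun x => rs (B x)) α) 2 (wm φ) :=
  IsT.memLp hφ (opC_cont hB hα) (opC_comp hα)

lemma IsT.memLp' (hφ : Continuous φ) {α : EuclideanSpace ℝ (Fin N) → E1} (hα : IsT α) :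
    MemLp α 2 (wm φ) := IsT.memLp hφ hα.continuous hα.2

lemma ext_est (hφ : Continuous φ) {a : Fin N → E1 →L[ℂ] E0} {B : EuclideanSpace ℝ (Fin N) → E1 →L[ℂ] E0}
    (hB : Continuous B) {a' : Fin N → E1 →L[ℂ] E2} {B' : EuclideanSpace ℝ (Fin N) → E1 →L[ℂ] E2}
    (hB' : Continuous B') {μ κ : ℝ}
    (hest : ∀ α : EuclideanSpace ℝ (Fin N) → E1, IsT α → μ * ∫ x, ‖α x‖ ^ 2 ∂(wm φ) ≤
      ∫ x, ‖opC (fun k => rs (a k)) (fun x => rs (B x)) α x‖ ^ 2 ∂(wm φ) +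
      κ * ∫ x, ‖opC (fun k => rs (a' k)) (fun x => rs (B' x)) α x‖ ^ 2 ∂(wm φ))
    (x : Lp E1 2 (wm φ)) (β : Lp E0 2 (wm φ)) (γ : Lp E2 2 (wm φ))
    (h1 : opW (fun k => rs (a k)) (fun x => rs (B x)) x β)
    (h2 : opW (fun k => rs (a' k)) (fun x => rs (B' x)) x γ) :
    μ * ‖x‖ ^ 2 ≤ ‖β‖ ^ 2 + κ * ‖γ‖ ^ 2 := by
  have := FiniteDimensional.complete ℂ E0
  have := FiniteDimensional.complete ℂ E1
  have := FiniteDimensional.complete ℂ E2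
  have hBr : Continuous (fun x => rs (B x)) := continuous_rs.comp hB
  have hBr' : Continuous (fun x => rs (B' x)) := continuous_rs.comp hB'
  have hxl := locInt_of_wm hφ (Lp.memLp x)
  have hβl := locInt_of_wm hφ (Lp.memLp β)
  have hγl := locInt_of_wm hφ (Lp.memLp γ)
  have hBp : Continuous (fun x => (rs (B x)).prod (rs (B' x))) := by
    exact (ContinuousLinearMap.prodₗᵢ ℝ : ((E1 →L[ℝ] E0) × (E1 →L[ℝ] E2)) ≃ₗᵢ[ℝ] (E1 →L[ℝ] E0 × E2)).continuous.comp (hBr.prodMk hBr')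
  have hp : opW (fun k => (rs (a k)).prod (rs (a' k))) (fun x => (rs (B x)).prod (rs (B' x))) x
      (fun y => (β y, γ y)) := by
    intro η hη
    have i1 := hβl.integrable_smul_left_of_hasCompactSupport hη.continuous hη.2
    have i2 := hγl.integrable_smul_left_of_hasCompactSupport hη.continuous hη.2
    have e1 := integral_pair i1 i2
    have e2 := integral_pair (opW_int3 (fun k => rs (a k)) hBr hxl hη) (opW_int3 (fun k => rs (a' k)) hBr' hxl hη)
    rw [← h1 η hη, ← h2 η hη, ← e1] at e2
    refine Eq.trans ?_ (e2.symm.trans ?_)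
    · rfl
    refine integral_congr_ae (Eventually.of_forall fun y => ?_)
    refine Prod.ext ?_ ?_
    · simp [Prod.fst_sum]
    · simp [Prod.snd_sum]
  have hbp : MemLp (fun y => (β y, γ y)) 2 (wm φ) := MemLp.of_fst_snd ⟨Lp.memLp β, Lp.memLp γ⟩
  have hd := fun n : ℕ => density hφ _ hBp (Lp.memLp x) hbp hp (ε := ENNReal.ofReal ((n + 1 : ℝ)⁻¹))
    (by rw [Ne, ENNReal.ofReal_eq_zero, not_le]; positivity)
  choose α hT hα1 hα2 using hd
  have lim0 : Tendsto (fun n : ℕ => ENNReal.ofReal ((n + 1 : ℝ)⁻¹)) atTop (𝓝 0) := by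
    have : Tendsto (fun n : ℕ => ((n + 1 : ℝ)⁻¹)) atTop (𝓝 0) := by
      simpa using tendsto_one_div_add_atTop_nhds_zero_nat (𝕜 := ℝ)
    have h := (ENNReal.continuous_ofReal.tendsto 0).comp this
    rw [ENNReal.ofReal_zero] at h
    exact h
  have hm1 := fun n => IsT.memLp' hφ (hT n)
  have hm2 := fun n => opC_memLp hφ (a := a) hB (hT n)
  have hm3 := fun n => opC_memLp hφ (a := a') hB' (hT n)
  have t1 : Tendsto (fun n => (hm1 n).toLp (α n)) atTop (𝓝 x) := by
    rw [Lp.tendsto_Lp_iff_tendsto_eLpNorm']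
    refine tendsto_of_tendsto_of_tendsto_of_le_of_le tendsto_const_nhds lim0 (fun _ => zero_le) fun n => ?_
    refine le_trans (le_of_eq (eLpNorm_congr_ae ?_)) (hα1 n)
    filter_upwards [(hm1 n).coeFn_toLp] with y hy
    simp [hy]
  have t2 : Tendsto (fun n => (hm2 n).toLp _) atTop (𝓝 β) := by
    rw [Lp.tendsto_Lp_iff_tendsto_eLpNorm']
    refine tendsto_of_tendsto_of_tendsto_of_le_of_le tendsto_const_nhds lim0 (fun _ => zero_le) fun n => ?_
    refine le_trans (eLpNorm_mono_ae ?_) (hα2 n)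
    filter_upwards [(hm2 n).coeFn_toLp] with y hy
    simp only [Pi.sub_apply, hy]
    refine le_trans (le_of_eq ?_) (norm_fst_le _)
    simp [opC, Prod.fst_sum]
  have t3 : Tendsto (fun n => (hm3 n).toLp _) atTop (𝓝 γ) := by
    rw [Lp.tendsto_Lp_iff_tendsto_eLpNorm']
    refine tendsto_of_tendsto_of_tendsto_of_le_of_le tendsto_const_nhds lim0 (fun _ => zero_le) fun n => ?_
    refine le_trans (eLpNorm_mono_ae ?_) (hα2 n)
    filter_upwards [(hm3 n).coeFn_toLp] with y hy
    simp only [Pi.sub_apply, hy]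
    refine le_trans (le_of_eq ?_) (norm_snd_le _)
    simp [opC, Prod.snd_sum]
  refine le_of_tendsto_of_tendsto' ((t1.norm.pow 2).const_mul μ)
    ((t2.norm.pow 2).add ((t3.norm.pow 2).const_mul κ)) fun n => ?_
  rw [normsq_toLp, normsq_toLp, normsq_toLp]
  exact hest _ (hT n)

lemma pd_tst (hφ : ContDiff ℝ ∞ φ) {η : EuclideanSpace ℝ (Fin N) → ℝ} (hη : IsT η) (e : E0) (k : Fin N) (x) :
    pd k (tst φ η e) x = (Real.exp (φ x) * (pd k φ x * η x + pd k η x)) • e := by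
  have h1 : ContDiff ℝ ∞ (fun x => Real.exp (φ x) * η x) := hφ.exp.mul hη.1
  have := pd_smul (f := fun x => Real.exp (φ x) * η x) (g := fun _ => e) h1 contDiff_const k x
  have h2 : pd k (fun _ : EuclideanSpace ℝ (Fin N) => e) x = 0 := by simp [pd]
  rw [h2, smul_zero, add_zero] at this
  unfold tst
  rw [this]
  congr 1
  have h3 := pd_smul hφ.exp hη.1 k x
  simp only [smul_eq_mul] at h3
  rw [h3]
  have h4 : pd k (fun x => Real.exp (φ x)) x = Real.exp (φ x) * pd k φ x := by
    unfold pd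
    rw [((hφ.differentiable (by simp) x).hasFDerivAt.exp).fderiv]
    simp
  rw [h4]; ring

lemma adjt_T (hφ : ContDiff ℝ ∞ φ) (σ : Fin N → E0 →L[ℂ] E1) {η : EuclideanSpace ℝ (Fin N) → ℝ}
    (hη : IsT η) (e : E0) :
    adjt φ (aT σ) (BT φ σ) η e = opC (fun k => rs (σ k)) (fun _ => rs 0) (tst φ η e) := by
  ext1 x
  refine ext_inner_right ℂ fun y => ?_
  simp only [adjt, opC, pd_tst hφ hη, rs_apply, ContinuousLinearMap.zero_apply, add_zero]
  have h1 : ∀ k, (σ k) ((Real.exp (φ x) * (pd k φ x * η x + pd k η x)) • e) =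
     (Real.exp (φ x) * (pd k φ x * η x + pd k η x)) • (σ k e) := fun k => (rs (σ k)).map_smul _ _
  simp only [h1, aT, BT, sum_inner, real_inner_left, inner_sub_left, adjo_left, inner_neg_right,
    ContinuousLinearMap.sum_apply, ContinuousLinearMap.neg_apply, ContinuousLinearMap.smul_apply,
    inner_sum, inner_smul_right, mul_sub, Finset.mul_sum, mul_neg, Finset.sum_neg_distrib, sub_neg_eq_add,
    ← Finset.sum_add_distrib]
  refine Finset.sum_congr rfl fun k _ => ?_
  have : inner ℂ e (adjo (σ k) y) = inner ℂ (σ k e) y := by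
    rw [← adjo_left, adjo_adjo]
  rw [this]
  push_cast; ring

lemma adjt_Ts (hφ : ContDiff ℝ ∞ φ) (σ : Fin N → E0 →L[ℂ] E1) {η : EuclideanSpace ℝ (Fin N) → ℝ}
    (hη : IsT η) (e : E1) :
    adjt φ σ (fun _ => 0) η e = opC (fun k => rs (aT σ k)) (fun x => rs (BT φ σ x)) (tst φ η e) := by
  ext1 x
  refine ext_inner_right ℂ fun y => ?_
  simp only [adjt, opC, pd_tst hφ hη, rs_apply, tst]
  have h1 : ∀ k (r : ℝ), (aT σ k) (r • e) = r • (aT σ k e) := fun k r => (rs (aT σ k)).map_smul _ _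
  have h2 : ∀ (r : ℝ), (BT φ σ x) (r • e) = r • (BT φ σ x e) := fun r => (rs (BT φ σ x)).map_smul _ _
  simp only [h1, h2, aT, BT, sum_inner, real_inner_left, inner_sub_left, adjo_left, inner_neg_left, inner_add_left,
    ContinuousLinearMap.sum_apply, ContinuousLinearMap.neg_apply, ContinuousLinearMap.smul_apply,
    ContinuousLinearMap.zero_apply, inner_zero_right, mul_zero, zero_sub,
    inner_smul_left, Finset.mul_sum, Complex.conj_ofReal, ← Finset.sum_neg_distrib,
    ← Finset.sum_add_distrib]
  refine Finset.sum_congr rfl fun k _ => ?_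
  push_cast; ring
end G
end Part7

section Part8
open Complex MeasureTheory Set Filter Topology
open scoped ENNReal NNReal ContDiff Convolution

section G
variable {N : ℕ} {φ : EuclideanSpace ℝ (Fin N) → ℝ}
variable {E0 : Type} [NormedAddCommGroup E0] [InnerProductSpace ℂ E0] [NormedSpace ℝ E0]
  [IsScalarTower ℝ ℂ E0] [FiniteDimensional ℂ E0]
variable {E1 : Type} [NormedAddCommGroup E1] [InnerProductSpace ℂ E1] [NormedSpace ℝ E1]
  [IsScalarTower ℝ ℂ E1] [FiniteDimensional ℂ E1]
variable {E2 : Type} [NormedAddCommGroup E2] [InnerProductSpace ℂ E2] [NormedSpace ℝ E2]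
  [IsScalarTower ℝ ℂ E2] [FiniteDimensional ℂ E2]

lemma inner_toLp_left {f : EuclideanSpace ℝ (Fin N) → E0} (h : MemLp f 2 (wm φ)) (g : Lp E0 2 (wm φ)) :
    inner ℂ (h.toLp f) g = ∫ x, inner ℂ (f x) (g x) ∂(wm φ) := by
  rw [L2.inner_def]
  refine integral_congr_ae ?_
  filter_upwards [h.coeFn_toLp] with x hx
  rw [hx]

lemma tst_memLp (hφ : Continuous φ) {η : EuclideanSpace ℝ (Fin N) → ℝ} (hη : IsT η) (e : E0) :
    MemLp (tst φ η e) 2 (wm φ) := IsT.memLp hφ (tst_cont hφ hη e) (tst_comp hη e)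

lemma adjt_memLp (hφ : Continuous φ) (a : Fin N → E1 →L[ℂ] E0) {B : EuclideanSpace ℝ (Fin N) → E1 →L[ℂ] E0}
    (hB : Continuous B) {η : EuclideanSpace ℝ (Fin N) → ℝ} (hη : IsT η) (e : E0) :
    MemLp (adjt φ a B η e) 2 (wm φ) := IsT.memLp hφ (adjt_cont hφ a hB hη e) (adjt_comp a B hη e)

lemma opW_iff' (hφ : Continuous φ) (a : Fin N → E1 →L[ℂ] E0) {B : EuclideanSpace ℝ (Fin N) → E1 →L[ℂ] E0}
    (hB : Continuous B) (α : Lp E1 2 (wm φ)) (β : Lp E0 2 (wm φ)) :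
    opW (fun k => rs (a k)) (fun x => rs (B x)) α β ↔
    ∀ η, (hη : IsT η) → ∀ e : E0, inner ℂ ((tst_memLp hφ hη e).toLp _) β =
      inner ℂ ((adjt_memLp hφ a hB hη e).toLp _) α := by
  rw [opW_iff hφ a hB (locInt_of_wm hφ (Lp.memLp α)) (locInt_of_wm hφ (Lp.memLp β))]
  simp only [inner_toLp_left]

lemma opW_toLp (hφ : Continuous φ) (a : Fin N → E1 →L[ℂ] E0) {B : EuclideanSpace ℝ (Fin N) → E1 →L[ℂ] E0}
    (hB : Continuous B) {α : EuclideanSpace ℝ (Fin N) → E1} (hα : IsT α) :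
    opW (fun k => rs (a k)) (fun x => rs (B x)) ((IsT.memLp' hφ hα).toLp α)
      ((opC_memLp hφ (a := a) hB hα).toLp _) := by
  have := FiniteDimensional.complete ℂ E0
  refine opW_congr ?_ ?_ (opW_of_contDiff (fun k => rs (a k)) (continuous_rs.comp hB) hα.1)
  · exact (ac_wm hφ).ae_eq (MemLp.coeFn_toLp _).symm
  · exact (ac_wm hφ).ae_eq (MemLp.coeFn_toLp _).symm

lemma S_T_zero {σ : Fin N → E0 →L[ℂ] E1} {τ : Fin N → E1 →L[ℂ] E2} {τ0 : E1 →L[ℂ] E2}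
    (hστ : ∀ k l x, τ k (σ l x) + τ l (σ k x) = 0) (hτ0 : ∀ l x, τ0 (σ l x) = 0)
    {ψ : EuclideanSpace ℝ (Fin N) → E0} (hψ : IsT ψ) (x) :
    opC (fun k => rs (τ k)) (fun _ => rs τ0) (opC (fun k => rs (σ k)) (fun _ => rs 0) ψ) x = 0 := by
  have h0 : opC (fun k => rs (σ k)) (fun _ => rs 0) ψ = fun x => ∑ l, σ l (pd l ψ x) := by
    ext y; simp [opC]
  have h1 : ∀ k, pd k (fun x => ∑ l, σ l (pd l ψ x)) x = ∑ l, σ l (pd k (fun y => pd l ψ y) x) := by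
    intro k
    have e : ∀ l, pd k (fun x => σ l (pd l ψ x)) x = σ l (pd k (fun y => pd l ψ y) x) := fun l =>
      pd_clm (contDiff_pd hψ.1 l) (rs (σ l)) k x
    simp only [← e]
    unfold pd
    rw [fderiv_fun_sum]
    · simp
    · intro l _
      exact ((rs (σ l)).contDiff.comp (contDiff_pd hψ.1 l)).differentiable (n := ∞) (by simp) x
  rw [h0, opC]
  simp only [h1, rs_apply, map_sum, hτ0, Finset.sum_const_zero, add_zero]
  set A := ∑ k, ∑ l, τ k (σ l (pd k (fun y => pd l ψ y) x)) with hA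
  have h2 : A = - A := by
    conv_lhs => rw [hA, Finset.sum_comm]
    rw [hA, ← Finset.sum_neg_distrib]
    refine Finset.sum_congr rfl fun k _ => ?_
    rw [← Finset.sum_neg_distrib]
    refine Finset.sum_congr rfl fun l _ => ?_
    rw [pd_comm hψ.1 l k]
    exact eq_neg_of_add_eq_zero_left (hστ l k _)
  have h3 : (2:ℂ) • A = 0 := by
    rw [two_smul]; nth_rewrite 1 [h2]; simp
  simpa using h3

/-- linear space of tests -/
def testSub (N : ℕ) (E1 : Type) [NormedAddCommGroup E1] [InnerProductSpace ℂ E1] [NormedSpace ℝ E1]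
    [IsScalarTower ℝ ℂ E1] : Submodule ℂ (EuclideanSpace ℝ (Fin N) → E1) where
  carrier := {α | IsT α}
  zero_mem' := ⟨contDiff_const, HasCompactSupport.zero⟩
  add_mem' := fun h1 h2 => ⟨h1.1.add h2.1, h1.2.add h2.2⟩
  smul_mem' := fun c α h => by
    refine ⟨?_, h.2.smul_left⟩
    have : ContDiff ℝ ∞ (fun x => rs (c • ContinuousLinearMap.id ℂ E1) (α x)) :=
      (rs (c • ContinuousLinearMap.id ℂ E1)).contDiff.comp h.1
    exact this

lemma opC_add {a : Fin N → E1 →L[ℂ] E0} {B : EuclideanSpace ℝ (Fin N) → E1 →L[ℂ] E0}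
    {α β : EuclideanSpace ℝ (Fin N) → E1} (hα : IsT α) (hβ : IsT β) (x) :
    opC (fun k => rs (a k)) (fun x => rs (B x)) (α + β) x =
      opC (fun k => rs (a k)) (fun x => rs (B x)) α x + opC (fun k => rs (a k)) (fun x => rs (B x)) β x := by
  have : ∀ k, pd k (α + β) x = pd k α x + pd k β x := fun k => by
    unfold pd
    rw [fderiv_add (hα.1.differentiable (by simp) x) (hβ.1.differentiable (by simp) x)]; simp
  simp only [opC, this, map_add, Finset.sum_add_distrib, Pi.add_apply]
  abel

lemma opC_smul {a : Fin N → E1 →L[ℂ] E0} {B : EuclideanSpace ℝ (Fin N) → E1 →L[ℂ] E0}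
    {α : EuclideanSpace ℝ (Fin N) → E1} (hα : IsT α) (c : ℂ) (x) :
    opC (fun k => rs (a k)) (fun x => rs (B x)) (c • α) x =
      c • opC (fun k => rs (a k)) (fun x => rs (B x)) α x := by
  have : ∀ k, pd k (c • α) x = c • pd k α x := fun k => by
    have := pd_clm hα.1 (rs (c • ContinuousLinearMap.id ℂ E1)) k x
    exact this
  simp only [opC, this, Pi.smul_apply, rs_apply, map_smul, Finset.smul_sum, smul_add]

theorem thmG (hφ : ContDiff ℝ ∞ φ) (σ : Fin N → E0 →L[ℂ] E1) (τ : Fin N → E1 →L[ℂ] E2) (τ0 : E1 →L[ℂ] E2)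
    (hστ : ∀ k l x, τ k (σ l x) + τ l (σ k x) = 0) (hτ0 : ∀ l x, τ0 (σ l x) = 0)
    {μ κ : ℝ} (hμ : 0 < μ)
    (hest : ∀ α : EuclideanSpace ℝ (Fin N) → E1, IsT α → μ * ∫ x, ‖α x‖ ^ 2 ∂(wm φ) ≤
      ∫ x, ‖opC (fun k => rs (aT σ k)) (fun x => rs (BT φ σ x)) α x‖ ^ 2 ∂(wm φ) +
      κ * ∫ x, ‖opC (fun k => rs (τ k)) (fun _ => rs τ0) α x‖ ^ 2 ∂(wm φ))
    (g : Lp E1 2 (wm φ)) (γ : Lp E2 2 (wm φ))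
    (hg : opW (fun k => rs (τ k)) (fun _ => rs τ0) g γ) :
    ∃ (g' : Lp E1 2 (wm φ)) (v : Lp E0 2 (wm φ)), opW (fun k => rs (σ k)) (fun _ => rs 0) v g' ∧
      μ * ‖v‖ ^ 2 ≤ ‖g'‖ ^ 2 ∧ ‖g'‖ ≤ ‖g‖ ∧ μ * ‖g - g'‖ ^ 2 ≤ κ * ‖γ‖ ^ 2 := by
  have hφc := hφ.continuous
  have cE0 := FiniteDimensional.complete ℂ E0
  have cE1 := FiniteDimensional.complete ℂ E1
  have hc0 : Continuous fun _ : EuclideanSpace ℝ (Fin N) => τ0 := continuous_const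
  have hcz : Continuous fun _ : EuclideanSpace ℝ (Fin N) => (0 : E0 →L[ℂ] E1) := continuous_const
  have hBT := BT_cont hφ σ
  let W : Set (Lp E1 2 (wm φ)) := {w | ∃ η, ∃ hη : IsT η, ∃ e : E2, w = (adjt_memLp hφc τ hc0 hη e).toLp _}
  let K : Submodule ℂ (Lp E1 2 (wm φ)) := (Submodule.span ℂ W)ᗮ
  have hKiff : ∀ α : Lp E1 2 (wm φ), α ∈ K ↔ opW (fun k => rs (τ k)) (fun _ => rs τ0) α (0 : Lp E2 2 (wm φ)) := by
    intro α
    rw [opW_iff' hφc τ hc0]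
    constructor
    · intro h η hη e
      rw [inner_zero_right]
      exact ((Submodule.mem_orthogonal _ _).1 h _ (Submodule.subset_span ⟨η, hη, e, rfl⟩)).symm
    · intro h
      rw [Submodule.mem_orthogonal]
      intro u hu
      induction hu using Submodule.span_induction with
      | mem x hx =>
        obtain ⟨η, hη, e, rfl⟩ := hx
        rw [← h η hη e, inner_zero_right]
      | zero => simp
      | add x y _ _ h1 h2 => rw [inner_add_left, h1, h2, add_zero]
      | smul c x _ h1 => rw [inner_smul_left, h1, mul_zero]
  have hperp : ∀ x : Lp E1 2 (wm φ), x ∈ Kᗮ →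
      opW (fun k => rs (aT σ k)) (fun x => rs (BT φ σ x)) x (0 : Lp E0 2 (wm φ)) := by
    intro x hx
    rw [opW_iff' hφc _ hBT]
    intro η hη e
    rw [inner_zero_right]
    refine ((Submodule.mem_orthogonal _ _).1 hx _ ?_).symm
    rw [hKiff]
    have hT := tst_isT (F := E0) hφ hη e
    have hm : IsT (opC (fun k => rs (σ k)) (fun _ => rs 0) (tst φ η e)) := by
      refine ⟨?_, opC_comp hT⟩
      have h0 : opC (fun k => rs (σ k)) (fun _ => rs 0) (tst φ η e) = fun x => ∑ l, rs (σ l) (pd l (tst φ η e) x) := by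
        ext y; simp [opC]
      rw [h0]
      exact ContDiff.sum fun k _ => (rs (σ k)).contDiff.comp (contDiff_pd hT.1 k)
    have := opW_toLp hφc τ hc0 hm
    refine opW_congr ?_ ?_ this
    · refine (ac_wm hφc).ae_eq ?_
      refine (MemLp.coeFn_toLp _).trans ?_
      rw [← adjt_T hφ σ hη e]
      exact (MemLp.coeFn_toLp _).symm
    · refine (ac_wm hφc).ae_eq ?_
      refine (MemLp.coeFn_toLp _).trans ?_
      filter_upwards [Lp.coeFn_zero E2 2 (wm φ)] with y hy
      rw [hy, S_T_zero hστ hτ0 hT]; rfl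
  have hbase := ext_est hφc hBT hc0 hest
  let P := K.starProjection
  have hPK : ∀ x, P x ∈ K := fun x => K.starProjection_apply_mem x
  have hPp : ∀ x, x - P x ∈ Kᗮ := fun x => K.sub_starProjection_mem_orthogonal x
  have hPn : ∀ x, ‖P x‖ ≤ ‖x‖ := fun x => K.norm_starProjection_apply_le x
  have hMem : ∀ α : testSub N E1, IsT α.1 := fun α => α.2
  let J : testSub N E1 →ₗ[ℂ] Lp E1 2 (wm φ) :=
    { toFun := fun α => (IsT.memLp' hφc (hMem α)).toLp _
      map_add' := fun α β => rfl
      map_smul' := fun c α => rfl }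
  let L : testSub N E1 →ₗ[ℂ] Lp E0 2 (wm φ) :=
    { toFun := fun α => (opC_memLp hφc (a := aT σ) hBT (hMem α)).toLp _
      map_add' := fun α β => by
        rw [← MemLp.toLp_add]
        refine MemLp.toLp_congr _ _ (Eventually.of_forall fun x => ?_)
        exact opC_add (hMem α) (hMem β) x
      map_smul' := fun c α => by
        rw [RingHom.id_apply, ← MemLp.toLp_const_smul]
        refine MemLp.toLp_congr _ _ (Eventually.of_forall fun x => ?_)
        exact opC_smul (hMem α) c x }
  have hLP : ∀ α, μ * ‖P (J α)‖ ^ 2 ≤ ‖L α‖ ^ 2 := by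
    intro α
    have h1 := opW_toLp hφc (aT σ) hBT (hMem α)
    have h2 := hperp _ (hPp (J α))
    have h3 : opW (fun k => rs (aT σ k)) (fun x => rs (BT φ σ x)) (P (J α)) (L α) := by
      rw [opW_iff' hφc _ hBT] at h1 h2 ⊢
      intro η hη e
      have h1' := h1 η hη e
      have h2' := h2 η hη e
      rw [inner_zero_right, inner_sub_right] at h2'
      refine h1'.trans ?_
      exact sub_eq_zero.1 h2'.symm
    have := hbase _ _ _ h3 ((hKiff _).1 (hPK (J α)))
    simpa using this
  have hl : ∀ α, ‖inner ℂ (P g) (J α)‖ ≤ (‖P g‖ / √μ) * ‖L α‖ := by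
    intro α
    have h1 : inner ℂ (P g) (J α) = inner ℂ (P g) (P (J α)) := by
      rw [← sub_eq_zero, ← inner_sub_right]
      exact (Submodule.mem_orthogonal _ _).1 (hPp (J α)) _ (hPK g)
    rw [h1]
    refine (norm_inner_le_norm _ _).trans ?_
    rw [div_mul_eq_mul_div, mul_div_assoc]
    gcongr
    rw [le_div_iff₀ (Real.sqrt_pos.2 hμ)]
    refine abs_le_of_sq_le_sq' ?_ (norm_nonneg _) |>.2
    rw [mul_pow, Real.sq_sqrt hμ.le]
    linarith [hLP α]
  obtain ⟨v, hv, hv2⟩ := riesz_range L ((innerSL ℂ (P g)).toLinearMap.comp J) (‖P g‖ / √μ) (by positivity) hl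
  refine ⟨P g, v, ?_, ?_, hPn g, ?_⟩
  · rw [opW_iff' hφc σ hcz]
    intro η hη e
    have h1 := hv2 ⟨tst φ η e, tst_isT hφ hη e⟩
    have h2 : inner ℂ v (L ⟨tst φ η e, tst_isT hφ hη e⟩) = inner ℂ (P g) ((tst_memLp hφc hη e).toLp _) := h1
    rw [← inner_conj_symm, ← h2, inner_conj_symm]
    have h3 : L ⟨tst φ η e, tst_isT hφ hη e⟩ = (adjt_memLp hφc σ hcz hη e).toLp _ := by
      refine MemLp.toLp_congr (opC_memLp hφc (a := aT σ) hBT (tst_isT hφ hη e)) _ (Eventually.of_forall fun x => ?_)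
      rw [adjt_Ts hφ σ hη e]
    rw [h3]
  · have : ‖v‖ ^ 2 ≤ (‖P g‖ / √μ) ^ 2 := by gcongr
    rw [div_pow, Real.sq_sqrt hμ.le, le_div_iff₀ hμ] at this
    linarith
  · have h1 := hperp _ (hPp g)
    have h2 := (hKiff _).1 (hPK g)
    have h3 : opW (fun k => rs (τ k)) (fun _ => rs τ0) (g - P g : Lp E1 2 (wm φ)) γ := by
      rw [opW_iff' hφc _ hc0] at hg h2 ⊢
      intro η hη e
      have h2' := h2 η hη e
      rw [inner_zero_right] at h2'
      rw [inner_sub_right, ← h2', sub_zero]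
      exact hg η hη e
    have := hbase _ _ _ h1 h3
    simpa using this
end G
end Part8

section Part9
open Complex MeasureTheory Set Filter Topology
open scoped ENNReal NNReal ContDiff Convolution ComplexConjugate

section Key
variable {N : ℕ} {φ : EuclideanSpace ℝ (Fin N) → ℝ}

lemma IsT.mul {f g : EuclideanSpace ℝ (Fin N) → ℂ} (hf : IsT f) (hg : ContDiff ℝ ∞ g) :
    IsT (fun x => f x * g x) := ⟨hf.1.mul hg, hf.2.mul_right⟩

lemma IsT.int_wm (hφ : Continuous φ) {G : Type} [NormedAddCommGroup G] [NormedSpace ℝ G]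
    {f : EuclideanSpace ℝ (Fin N) → G} (hf : Continuous f) (hc : HasCompactSupport f) :
    Integrable f (wm φ) := by
  rw [integrable_wm hφ]
  refine Continuous.integrable_of_hasCompactSupport (by fun_prop) (HasCompactSupport.intro hc fun x hx => ?_)
  rw [image_eq_zero_of_notMem_tsupport hx, smul_zero]

lemma pd_mul {f g : EuclideanSpace ℝ (Fin N) → ℂ}
    (hf : ContDiff ℝ ∞ f) (hg : ContDiff ℝ ∞ g) (k : Fin N) (x) :
    pd k (fun x => f x * g x) x = pd k f x * g x + f x * pd k g x := by
  unfold pd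
  rw [fderiv_fun_mul (hf.differentiable (by simp) x) (hg.differentiable (by simp) x)]
  simp [add_comm, mul_comm]

lemma pd_add {f g : EuclideanSpace ℝ (Fin N) → ℂ}
    (hf : ContDiff ℝ ∞ f) (hg : ContDiff ℝ ∞ g) (k : Fin N) (x) :
    pd k (fun x => f x + g x) x = pd k f x + pd k g x := by
  unfold pd
  rw [fderiv_fun_add (hf.differentiable (by simp) x) (hg.differentiable (by simp) x)]
  simp

lemma integral_pd_zero {f : EuclideanSpace ℝ (Fin N) → ℂ} (hf : IsT f) (k : Fin N) :
    ∫ x, pd k f x = 0 := by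
  have := integral_pd_smul (f := fun _ => (1:ℝ)) contDiff_const hf.1 (Or.inr hf.2) k
  simpa [pd] using this

/-- real adjoint derivative -/
noncomputable def dr (φ : EuclideanSpace ℝ (Fin N) → ℝ) (k : Fin N) (f : EuclideanSpace ℝ (Fin N) → ℂ)
    (x : EuclideanSpace ℝ (Fin N)) : ℂ := - pd k f x + ((pd k φ x : ℝ) : ℂ) * f x

lemma pd_ofReal (hφ : ContDiff ℝ ∞ φ) (k : Fin N) (x) : pd k (fun y => (φ y : ℂ)) x = ((pd k φ x : ℝ) : ℂ) :=
  pd_clm hφ Complex.ofRealCLM k x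

lemma dr_isT (hφ : ContDiff ℝ ∞ φ) (k : Fin N) {f : EuclideanSpace ℝ (Fin N) → ℂ} (hf : IsT f) :
    IsT (fun x => dr φ k f x) := by
  unfold dr
  refine ⟨(contDiff_pd hf.1 k).neg.add ((Complex.ofRealCLM.contDiff.comp (contDiff_pd hφ k)).mul hf.1), ?_⟩
  exact (isT_pd hf k).2.neg.add hf.2.mul_left

lemma pd_exp_neg (hφ : ContDiff ℝ ∞ φ) (k : Fin N) (x) :
    pd k (fun x => Real.exp (-φ x)) x = - pd k φ x * Real.exp (-φ x) := by
  unfold pd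
  have hd : DifferentiableAt ℝ φ x := hφ.differentiable (by simp) x
  have : HasFDerivAt (fun x => Real.exp (-φ x)) (Real.exp (-φ x) • (-fderiv ℝ φ x)) x :=
    (hd.hasFDerivAt.fun_neg).exp
  rw [this.fderiv]
  simp only [ContinuousLinearMap.smul_apply, ContinuousLinearMap.neg_apply, smul_eq_mul]
  ring

lemma ibp_wm (hφ : ContDiff ℝ ∞ φ) {f g : EuclideanSpace ℝ (Fin N) → ℂ} (hf : IsT f) (hg : IsT g) (k : Fin N) :
    ∫ x, pd k f x * g x ∂(wm φ) = ∫ x, f x * dr φ k g x ∂(wm φ) := by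
  have he : ContDiff ℝ ∞ (fun x => Real.exp (-φ x)) := hφ.neg.exp
  have hfg := hf.mul hg.1
  have hc1 : ContDiff ℝ ∞ (fun x => Real.exp (-φ x) • (f x * g x)) := he.smul hfg.1
  have hc2 : HasCompactSupport (fun x => Real.exp (-φ x) • (f x * g x)) := by
    refine HasCompactSupport.intro hfg.2 fun x hx => ?_
    have := image_eq_zero_of_notMem_tsupport hx
    simp only [this, smul_zero]
  have h0 := integral_pd_zero (f := fun x => Real.exp (-φ x) • (f x * g x)) ⟨hc1, hc2⟩ k
  have i1 : Integrable (fun x => pd k f x * g x) (wm φ) :=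
    IsT.int_wm hφ.continuous ((isT_pd hf k).mul hg.1).continuous ((isT_pd hf k).mul hg.1).2
  have hd := dr_isT hφ k hg
  have i2 : Integrable (fun x => f x * dr φ k g x) (wm φ) :=
    IsT.int_wm hφ.continuous (hf.mul hd.1).continuous (hf.mul hd.1).2
  have e : ∫ x, (pd k f x * g x - f x * dr φ k g x) ∂(wm φ) = 0 := by
    rw [integral_wm hφ.continuous]
    refine Eq.trans (integral_congr_ae (Eventually.of_forall fun x => ?_)) h0
    simp only [pd_smul he hfg.1, pd_exp_neg hφ, pd_mul hf.1 hg.1, dr]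
    simp only [Complex.real_smul]
    push_cast; ring
  rw [integral_sub i1 i2] at e
  exact sub_eq_zero.1 e

lemma key_pd (hφ : ContDiff ℝ ∞ φ) {f g : EuclideanSpace ℝ (Fin N) → ℂ} (hf : IsT f) (hg : IsT g) (k l : Fin N) :
    ∫ x, pd k f x * pd l g x ∂(wm φ) = ∫ x, dr φ l f x * dr φ k g x ∂(wm φ)
      - ∫ x, ((pd l (fun y => pd k φ y) x : ℝ) : ℂ) * f x * g x ∂(wm φ) := by
  rw [ibp_wm hφ hf (isT_pd hg l)]
  have h1 : ∀ x, dr φ k (fun y => pd l g y) x = pd l (fun y => dr φ k g y) x -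
      ((pd l (fun y => pd k φ y) x : ℝ) : ℂ) * g x := by
    intro x
    unfold dr
    have c1 : ContDiff ℝ ∞ (fun x => - pd k g x) := (contDiff_pd hg.1 k).neg
    have c2 : ContDiff ℝ ∞ (fun x => ((pd k φ x : ℝ) : ℂ)) := Complex.ofRealCLM.contDiff.comp (contDiff_pd hφ k)
    rw [pd_add c1 (c2.mul hg.1), pd_mul c2 hg.1, pd_ofReal (contDiff_pd hφ k), pd_comm hg.1 k l]
    have : pd l (fun x => - pd k g x) x = - pd l (fun x => pd k g x) x := by
      simp [pd]
    rw [this]; ring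
  have h2 := ibp_wm hφ (dr_isT hφ k hg) hf l
  simp only [h1, mul_sub]
  have c2 : ContDiff ℝ ∞ (fun x => ((pd l (fun y => pd k φ y) x : ℝ) : ℂ)) :=
    Complex.ofRealCLM.contDiff.comp (contDiff_pd (contDiff_pd hφ k) l)
  rw [integral_sub]
  · congr 1
    · simp only [mul_comm (f _), mul_comm (dr φ l f _)]
      exact h2
    · congr 1; ext x; ring
  · have := hf.mul (isT_pd (dr_isT hφ k hg) l).1
    exact IsT.int_wm hφ.continuous this.continuous this.2
  · have := hf.mul (c2.mul hg.1)
    exact IsT.int_wm hφ.continuous this.continuous this.2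

end Key
end Part9

section Part10
open Complex MeasureTheory Set Filter Topology
open scoped ENNReal NNReal ContDiff Convolution ComplexConjugate

section Alg
variable {P K : Type} [Fintype P] [Fintype K]

lemma alg1 (m A : P → K → ℂ) :
    ∑ p, ∑ q, ∑ k, ∑ l, m p k * conj (m q l) * (A q k * conj (A p l)) =
    ∑ p, ∑ q, (∑ k, m p k * A q k) * conj (∑ l, m q l * A p l) := by
  refine Finset.sum_congr rfl fun p _ => Finset.sum_congr rfl fun q _ => ?_
  rw [map_sum, Finset.sum_mul_sum]
  refine Finset.sum_congr rfl fun k _ => Finset.sum_congr rfl fun l _ => ?_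
  rw [map_mul]; ring

lemma alg2 (m C : P → K → ℂ) :
    ∑ p, ∑ q, ∑ k, ∑ l, m p k * conj (m q l) * (C q l * conj (C p k)) =
    (∑ q, ∑ l, conj (m q l) * C q l) * conj (∑ p, ∑ k, conj (m p k) * C p k) := by
  simp only [map_sum, map_mul, Complex.conj_conj]
  rw [mul_comm, Finset.sum_mul_sum]
  refine Finset.sum_congr rfl fun p _ => Finset.sum_congr rfl fun q _ => ?_
  rw [Finset.sum_mul_sum]
  refine Finset.sum_congr rfl fun k _ => Finset.sum_congr rfl fun l _ => ?_
  ring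

lemma alg3 (m : P → K → ℂ) (v : P → ℂ) (h : K → K → ℂ) :
    ∑ p, ∑ q, ∑ k, ∑ l, m p k * conj (m q l) * (h l k * v q * conj (v p)) =
    ∑ l, ∑ k, h l k * ((∑ q, conj (m q l) * v q) * conj (∑ p, conj (m p k) * v p)) := by
  simp only [map_sum, map_mul, Complex.conj_conj]
  have h1 : ∀ l k, h l k * ((∑ q, conj (m q l) * v q) * ∑ p, m p k * conj (v p)) =
      ∑ p, ∑ q, m p k * conj (m q l) * (h l k * v q * conj (v p)) := by
    intro l k
    rw [mul_comm (∑ q, conj (m q l) * v q), Finset.sum_mul_sum, Finset.mul_sum]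
    refine Finset.sum_congr rfl fun p _ => ?_
    rw [Finset.mul_sum]
    refine Finset.sum_congr rfl fun q _ => ?_
    ring
  simp only [h1]
  calc _ = ∑ p, ∑ q, ∑ l, ∑ k, m p k * conj (m q l) * (h l k * v q * conj (v p)) := by
        refine Finset.sum_congr rfl fun p _ => Finset.sum_congr rfl fun q _ => ?_
        rw [Finset.sum_comm]
    _ = ∑ p, ∑ l, ∑ q, ∑ k, m p k * conj (m q l) * (h l k * v q * conj (v p)) := by
        refine Finset.sum_congr rfl fun p _ => ?_
        rw [Finset.sum_comm]
    _ = ∑ l, ∑ p, ∑ q, ∑ k, m p k * conj (m q l) * (h l k * v q * conj (v p)) := by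
        rw [Finset.sum_comm]
    _ = ∑ l, ∑ p, ∑ k, ∑ q, m p k * conj (m q l) * (h l k * v q * conj (v p)) := by
        refine Finset.sum_congr rfl fun l _ => Finset.sum_congr rfl fun p _ => ?_
        rw [Finset.sum_comm]
    _ = _ := by
        refine Finset.sum_congr rfl fun l _ => ?_
        rw [Finset.sum_comm]

lemma alg4 [DecidableEq P] (m : P → K → ℂ) (hm : ∀ p q, ∑ k, m p k * conj (m q k) = if p = q then 1 / 2 else 0)
    (v : P → ℂ) : ∑ k, ‖∑ q, conj (m q k) * v q‖ ^ 2 = 1 / 2 * ∑ p, ‖v p‖ ^ 2 := by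
  have : ((∑ k, ‖∑ q, conj (m q k) * v q‖ ^ 2 : ℝ) : ℂ) = ((1 / 2 * ∑ p, ‖v p‖ ^ 2 : ℝ) : ℂ) := by
    push_cast
    simp only [← Complex.mul_conj', map_sum, map_mul, Complex.conj_conj, Finset.sum_mul_sum]
    rw [Finset.sum_comm, Finset.mul_sum]
    refine Finset.sum_congr rfl fun q _ => ?_
    rw [Finset.sum_comm]
    have : ∀ p, ∑ k, conj (m q k) * v q * (m p k * conj (v p)) =
        (v q * conj (v p)) * (if p = q then 1 / 2 else 0) := by
      intro p
      rw [← hm, Finset.mul_sum]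
      refine Finset.sum_congr rfl fun k _ => ?_
      ring
    simp only [this]
    simp
    ring
  exact_mod_cast this

lemma alg5 {c : ℝ} (h : K → K → ℝ) (hH : ∀ ξ : K → ℝ, ∑ j, ∑ k, h j k * ξ j * ξ k ≥ c * ∑ j, ξ j ^ 2)
    (ζ : K → ℂ) : c * ∑ k, ‖ζ k‖ ^ 2 ≤ (∑ l, ∑ k, (h l k : ℂ) * (ζ l * conj (ζ k))).re := by
  have h1 := hH (fun k => (ζ k).re)
  have h2 := hH (fun k => (ζ k).im)
  have e : (∑ l, ∑ k, (h l k : ℂ) * (ζ l * conj (ζ k))).re =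
     (∑ l, ∑ k, h l k * (ζ l).re * (ζ k).re) + ∑ l, ∑ k, h l k * (ζ l).im * (ζ k).im := by
    simp only [Complex.re_sum, ← Finset.sum_add_distrib]
    refine Finset.sum_congr rfl fun p _ => Finset.sum_congr rfl fun q _ => ?_
    simp; ring
  have e2 : ∑ k, ‖ζ k‖ ^ 2 = ∑ k, (ζ k).re ^ 2 + ∑ k, (ζ k).im ^ 2 := by
    rw [← Finset.sum_add_distrib]
    refine Finset.sum_congr rfl fun p _ => ?_
    rw [Complex.sq_norm, Complex.normSq_apply]; ring
  rw [e, e2, mul_add]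
  exact add_le_add h1 h2
end Alg

section Key
variable {N : ℕ} {φ : EuclideanSpace ℝ (Fin N) → ℝ} {P : Type} [Fintype P]

/-- constant coefficient vector field -/
noncomputable def Dm (m : P → Fin N → ℂ) (p : P) (f : EuclideanSpace ℝ (Fin N) → ℂ)
    (x : EuclideanSpace ℝ (Fin N)) : ℂ := ∑ k, m p k * pd k f x

/-- its weighted adjoint -/
noncomputable def dm (φ : EuclideanSpace ℝ (Fin N) → ℝ) (m : P → Fin N → ℂ) (p : P)
    (f : EuclideanSpace ℝ (Fin N) → ℂ)
    (x : EuclideanSpace ℝ (Fin N)) : ℂ := ∑ k, conj (m p k) * dr φ k f x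

lemma IsT.conj {f : EuclideanSpace ℝ (Fin N) → ℂ} (hf : IsT f) : IsT (fun x => conj (f x)) :=
  ⟨Complex.conjCLE.contDiff.comp hf.1, hf.2.comp_left (map_zero _)⟩

lemma pd_conj {f : EuclideanSpace ℝ (Fin N) → ℂ} (hf : IsT f) (k : Fin N) (x) :
    pd k (fun x => conj (f x)) x = conj (pd k f x) :=
  pd_clm hf.1 (Complex.conjCLE : ℂ →L[ℝ] ℂ) k x

lemma dr_conj {f : EuclideanSpace ℝ (Fin N) → ℂ} (hf : IsT f) (k : Fin N) (x) :
    dr φ k (fun x => conj (f x)) x = conj (dr φ k f x) := by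
  simp [dr, pd_conj hf]

lemma IsT.add {f g : EuclideanSpace ℝ (Fin N) → ℂ} (hf : IsT f) (hg : IsT g) :
    IsT (fun x => f x + g x) := ⟨hf.1.add hg.1, hf.2.add hg.2⟩

lemma IsT.sub {f g : EuclideanSpace ℝ (Fin N) → ℂ} (hf : IsT f) (hg : IsT g) :
    IsT (fun x => f x - g x) := ⟨hf.1.sub hg.1, hf.2.sub hg.2⟩

lemma IsT.cmul {f : EuclideanSpace ℝ (Fin N) → ℂ} (c : ℂ) (hf : IsT f) :
    IsT (fun x => c * f x) := ⟨contDiff_const.mul hf.1, hf.2.mul_left⟩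

lemma IsT.sum {ι : Type} {s : Finset ι} {f : ι → EuclideanSpace ℝ (Fin N) → ℂ} (hf : ∀ i, IsT (f i)) :
    IsT (fun x => ∑ i ∈ s, f i x) := by
  classical
  induction s using Finset.induction_on with
  | empty => simp only [Finset.sum_empty]; exact ⟨contDiff_const, HasCompactSupport.zero⟩
  | insert i s hi ih => simp only [Finset.sum_insert hi]; exact (hf i).add ih

lemma Dm_isT (m : P → Fin N → ℂ) (p : P) {f : EuclideanSpace ℝ (Fin N) → ℂ} (hf : IsT f) :
    IsT (fun x => Dm m p f x) := IsT.sum fun k => (isT_pd hf k).cmul _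

lemma dm_isT (hφ : ContDiff ℝ ∞ φ) (m : P → Fin N → ℂ) (p : P) {f : EuclideanSpace ℝ (Fin N) → ℂ} (hf : IsT f) :
    IsT (fun x => dm φ m p f x) := IsT.sum fun k => (dr_isT hφ k hf).cmul _

lemma IsT.int (hφ : Continuous φ) {f : EuclideanSpace ℝ (Fin N) → ℂ} (hf : IsT f) : Integrable f (wm φ) :=
  IsT.int_wm hφ hf.continuous hf.2

lemma IsT.int_sq (hφ : Continuous φ) {f : EuclideanSpace ℝ (Fin N) → ℂ} (hf : IsT f) :
    Integrable (fun x => ‖f x‖ ^ 2) (wm φ) :=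
  IsT.int_wm hφ (by have := hf.continuous; fun_prop) (hf.2.comp_left (g := fun z : ℂ => ‖z‖ ^ 2) (by simp))

theorem keyest [DecidableEq P] (hφ : ContDiff ℝ ∞ φ) {c : ℝ}
    (hH : ∀ x, ∀ ξ : Fin N → ℝ, ∑ j, ∑ k, pd j (fun y => pd k φ y) x * ξ j * ξ k ≥ c * ∑ j, ξ j ^ 2)
    (m : P → Fin N → ℂ) (hm : ∀ p q, ∑ k, m p k * conj (m q k) = if p = q then 1 / 2 else 0)
    (a : P → EuclideanSpace ℝ (Fin N) → ℂ) (ha : ∀ p, IsT (a p)) :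
    c / 2 * ∫ x, ∑ p, ‖a p x‖ ^ 2 ∂(wm φ) +
      ∫ x, (∑ p, ∑ q, Dm m p (a q) x * conj (Dm m q (a p) x)).re ∂(wm φ) ≤
    ∫ x, ‖∑ q, dm φ m q (a q) x‖ ^ 2 ∂(wm φ) := by
  have hφc := hφ.continuous
  have c2 : ∀ l k, ContDiff ℝ ∞ (fun x => ((pd l (fun y => pd k φ y) x : ℝ) : ℂ)) := fun l k =>
    Complex.ofRealCLM.contDiff.comp (contDiff_pd (contDiff_pd hφ k) l)
  let G : P → P → Fin N → Fin N → EuclideanSpace ℝ (Fin N) → ℂ := fun p q k l x =>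
    m p k * conj (m q l) * (pd k (a q) x * conj (pd l (a p) x) - dr φ l (a q) x * conj (dr φ k (a p) x)
      + ((pd l (fun y => pd k φ y) x : ℝ) : ℂ) * a q x * conj (a p x))
  have T1 : ∀ p q k l, IsT (fun x => pd k (a q) x * conj (pd l (a p) x)) := fun p q k l =>
    (isT_pd (ha q) k).mul (isT_pd (ha p) l).conj.1
  have T2 : ∀ p q k l, IsT (fun x => dr φ l (a q) x * conj (dr φ k (a p) x)) := fun p q k l =>
    (dr_isT hφ l (ha q)).mul (dr_isT hφ k (ha p)).conj.1
  have T3 : ∀ p q k l, IsT (fun x => ((pd l (fun y => pd k φ y) x : ℝ) : ℂ) * a q x * conj (a p x)) := fun p q k l =>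
    ⟨((c2 l k).mul (ha q).1).mul (ha p).conj.1, ((ha p).conj.2).mul_left⟩
  have TG : ∀ p q k l, IsT (G p q k l) := fun p q k l =>
    ((((T1 p q k l).sub (T2 p q k l)).add (T3 p q k l)).cmul _)
  have G0 : ∀ p q k l, ∫ x, G p q k l x ∂(wm φ) = 0 := by
    intro p q k l
    have h1 := key_pd hφ (ha q) (ha p).conj k l
    simp only [pd_conj (ha p), dr_conj (ha p)] at h1
    simp only [G]
    rw [integral_const_mul, integral_add (((T1 p q k l).sub (T2 p q k l)).int hφc) ((T3 p q k l).int hφc),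
      integral_sub ((T1 p q k l).int hφc) ((T2 p q k l).int hφc), h1]
    ring
  have TS : IsT (fun x => ∑ p, ∑ q, ∑ k, ∑ l, G p q k l x) :=
    IsT.sum fun p => IsT.sum fun q => IsT.sum fun k => IsT.sum fun l => TG p q k l
  have S0 : ∫ x, ∑ p, ∑ q, ∑ k, ∑ l, G p q k l x ∂(wm φ) = 0 := by
    rw [integral_finsetSum _ fun p _ => (IsT.sum fun q => IsT.sum fun k => IsT.sum fun l => TG p q k l).int hφc]
    refine Finset.sum_eq_zero fun p _ => ?_
    rw [integral_finsetSum _ fun q _ => (IsT.sum fun k => IsT.sum fun l => TG p q k l).int hφc]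
    refine Finset.sum_eq_zero fun q _ => ?_
    rw [integral_finsetSum _ fun k _ => (IsT.sum fun l => TG p q k l).int hφc]
    refine Finset.sum_eq_zero fun k _ => ?_
    rw [integral_finsetSum _ fun l _ => (TG p q k l).int hφc]
    exact Finset.sum_eq_zero fun l _ => G0 p q k l
  have TD : IsT (fun x => ∑ p, ∑ q, Dm m p (a q) x * conj (Dm m q (a p) x)) :=
    IsT.sum fun p => IsT.sum fun q => (Dm_isT m p (ha q)).mul (Dm_isT m q (ha p)).conj.1
  have Td : IsT (fun x => ∑ q, dm φ m q (a q) x) := IsT.sum fun q => dm_isT hφ m q (ha q)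
  have pt : ∀ x, c / 2 * ∑ p, ‖a p x‖ ^ 2 + (∑ p, ∑ q, Dm m p (a q) x * conj (Dm m q (a p) x)).re
      - ‖∑ q, dm φ m q (a q) x‖ ^ 2 ≤ (∑ p, ∑ q, ∑ k, ∑ l, G p q k l x).re := by
    intro x
    simp only [G, mul_add, mul_sub, Finset.sum_add_distrib, Finset.sum_sub_distrib]
    rw [alg1 m (fun q k => pd k (a q) x), alg2 m (fun q k => dr φ k (a q) x),
      alg3 m (fun q => a q x) (fun l k => ((pd l (fun y => pd k φ y) x : ℝ) : ℂ))]
    have h5 := alg5 (fun l k => pd l (fun y => pd k φ y) x) (hH x) (fun l => ∑ q, conj (m q l) * a q x)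
    rw [alg4 m hm (fun q => a q x)] at h5
    simp only [Dm, dm]
    rw [Complex.mul_conj', Complex.add_re, Complex.sub_re, ← Complex.ofReal_pow, Complex.ofReal_re]
    linarith
  have iA : Integrable (fun x => ∑ p, ‖a p x‖ ^ 2) (wm φ) := integrable_finsetSum _ fun p _ => (ha p).int_sq hφc
  have iD : Integrable (fun x => (∑ p, ∑ q, Dm m p (a q) x * conj (Dm m q (a p) x)).re) (wm φ) := (TD.int hφc).re
  have id' := Td.int_sq hφc
  have iS : Integrable (fun x => (∑ p, ∑ q, ∑ k, ∑ l, G p q k l x).re) (wm φ) := (TS.int hφc).re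
  have hi := integral_mono ((iA.const_mul (c/2)).add iD |>.sub id') iS pt
  have h0 : ∫ x, (∑ p, ∑ q, ∑ k, ∑ l, G p q k l x).re ∂(wm φ) = 0 := by
    have := integral_re (𝕜 := ℂ) (TS.int hφc)
    rw [S0] at this
    exact this
  rw [h0] at hi
  rw [integral_sub' ((iA.const_mul (c/2)).add iD) id', integral_add' (iA.const_mul (c/2)) iD,
    integral_const_mul] at hi
  linarith
end Key
end Part10

section Part11
open Complex MeasureTheory Set Filter Topology
open scoped ENNReal NNReal ContDiff Convolution ComplexConjugate

section Mk
variable {ι0 ι1 : Type} [Fintype ι0] [Fintype ι1]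

/-- build a continuous linear map from components -/
noncomputable def mkC (f : EuclideanSpace ℂ ι0 → ι1 → ℂ) (h1 : ∀ v w i, f (v + w) i = f v i + f w i)
    (h2 : ∀ (c : ℂ) v i, f (c • v) i = c * f v i) : EuclideanSpace ℂ ι0 →L[ℂ] EuclideanSpace ℂ ι1 :=
  LinearMap.toContinuousLinearMap
    { toFun := fun v => WithLp.toLp 2 (f v)
      map_add' := fun v w => by ext i; exact h1 v w i
      map_smul' := fun c v => by ext i; exact h2 c v i }

lemma mkC_apply (f : EuclideanSpace ℂ ι0 → ι1 → ℂ) (h1 h2 v i) : mkC f h1 h2 v i = f v i := rfl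

variable {N : ℕ} {P : Type} [Fintype P]

/-- degree zero symbol -/
noncomputable def s1 (m : P → Fin N → ℂ) (k : Fin N) : EuclideanSpace ℂ Unit →L[ℂ] EuclideanSpace ℂ P :=
  mkC (fun v p => m p k * v ()) (fun v w p => by simp only [PiLp.add_apply]; ring)
    (fun c v p => by simp only [PiLp.smul_apply, smul_eq_mul]; ring)

/-- degree one symbol -/
noncomputable def s2 (m : P → Fin N → ℂ) (k : Fin N) : EuclideanSpace ℂ P →L[ℂ] EuclideanSpace ℂ (P × P) :=
  mkC (fun v i => m i.1 k * v i.2 - m i.2 k * v i.1) (fun v w p => by simp only [PiLp.add_apply]; ring)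
    (fun c v p => by simp only [PiLp.smul_apply, smul_eq_mul]; ring)

/-- degree two symbol, components -/
def t3f (m : P → Fin N → ℂ) (k : Fin N) (v : EuclideanSpace ℂ (P × P)) : (P × P × P) ⊕ (P × P) → ℂ
  | Sum.inl i => m i.1 k * (v (i.2.1, i.2.2) - v (i.2.2, i.2.1)) + m i.2.1 k * (v (i.2.2, i.1) - v (i.1, i.2.2))
      + m i.2.2 k * (v (i.1, i.2.1) - v (i.2.1, i.1))
  | Sum.inr _ => 0

/-- zero order symbol, components -/
def z3f (v : EuclideanSpace ℂ (P × P)) : (P × P × P) ⊕ (P × P) → ℂ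
  | Sum.inl _ => 0
  | Sum.inr i => v (i.1, i.2) + v (i.2, i.1)

/-- degree two symbol -/
noncomputable def t3 (m : P → Fin N → ℂ) (k : Fin N) :
    EuclideanSpace ℂ (P × P) →L[ℂ] EuclideanSpace ℂ ((P × P × P) ⊕ (P × P)) :=
  mkC (t3f m k) (fun v w p => by cases p <;> simp only [t3f, PiLp.add_apply] <;> ring)
    (fun c v p => by cases p <;> simp only [t3f, PiLp.smul_apply, smul_eq_mul] <;> ring)

/-- zero order symbol -/
noncomputable def z3 : EuclideanSpace ℂ (P × P) →L[ℂ] EuclideanSpace ℂ ((P × P × P) ⊕ (P × P)) :=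
  mkC z3f (fun v w p => by cases p <;> simp only [z3f, PiLp.add_apply] <;> ring)
    (fun c v p => by cases p <;> simp only [z3f, PiLp.smul_apply, smul_eq_mul] <;> ring)

lemma s1_apply (m : P → Fin N → ℂ) (k v p) : s1 m k v p = m p k * v () := rfl
lemma s2_apply (m : P → Fin N → ℂ) (k v) (p q : P) : s2 m k v (p, q) = m p k * v q - m q k * v p := rfl
lemma t3_inl (m : P → Fin N → ℂ) (k v) (p q r : P) : t3 m k v (Sum.inl (p, q, r)) =
  m p k * (v (q, r) - v (r, q)) + m q k * (v (r, p) - v (p, r)) + m r k * (v (p, q) - v (q, p)) := rfl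
lemma t3_inr (m : P → Fin N → ℂ) (k v) (i : P × P) : t3 m k v (Sum.inr i) = 0 := rfl
lemma z3_inl (v) (i : P × P × P) : z3 v (Sum.inl i) = 0 := rfl
lemma z3_inr (v) (p q : P) : z3 v (Sum.inr (p, q)) = v (p, q) + v (q, p) := rfl

lemma s2_s1 (m : P → Fin N → ℂ) (k l v) : s2 m k (s1 m l v) + s2 m l (s1 m k v) = 0 := by
  ext ⟨p, q⟩
  simp only [PiLp.add_apply, s2_apply, s1_apply, PiLp.zero_apply]; ring

lemma t3_s2 (m : P → Fin N → ℂ) (k l v) : t3 m k (s2 m l v) + t3 m l (s2 m k v) = 0 := by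
  ext i
  rcases i with ⟨p, q, r⟩ | ⟨p, q⟩
  · simp only [PiLp.add_apply, s2_apply, t3_inl, PiLp.zero_apply]; ring
  · simp only [PiLp.add_apply, t3_inr, PiLp.zero_apply]; ring

lemma z3_s2 (m : P → Fin N → ℂ) (l v) : z3 (s2 m l v) = 0 := by
  ext i
  rcases i with ⟨p, q, r⟩ | ⟨p, q⟩
  · simp only [z3_inl, PiLp.zero_apply]
  · simp only [z3_inr, s2_apply, PiLp.zero_apply]; ring

lemma adjo_s1 (m : P → Fin N → ℂ) (k) (α : EuclideanSpace ℂ P) (u : Unit) :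
    adjo (s1 m k) α u = ∑ p, conj (m p k) * α p := by
  let g : EuclideanSpace ℂ Unit := WithLp.toLp 2 (fun _ => ∑ p, conj (m p k) * α p)
  have : adjo (s1 m k) α = g := by
    refine ext_inner_right ℂ fun v => ?_
    rw [adjo_left]
    simp only [PiLp.inner_apply, RCLike.inner_apply, s1_apply, g, map_sum, map_mul, Complex.conj_conj,
      Finset.univ_unique, Finset.sum_singleton, Finset.mul_sum]
    refine Finset.sum_congr rfl fun p _ => ?_
    ring
  rw [this]

lemma adjo_s2 (m : P → Fin N → ℂ) (k) (α : EuclideanSpace ℂ (P × P)) (r : P) :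
    adjo (s2 m k) α r = ∑ p, conj (m p k) * (α (p, r) - α (r, p)) := by
  let g : EuclideanSpace ℂ P := WithLp.toLp 2 (fun r => ∑ p, conj (m p k) * (α (p, r) - α (r, p)))
  have : adjo (s2 m k) α = g := by
    refine ext_inner_right ℂ fun v => ?_
    rw [adjo_left]
    simp only [PiLp.inner_apply, RCLike.inner_apply, Fintype.sum_prod_type, s2_apply, g, map_sum, map_mul, map_sub,
      Complex.conj_conj, Finset.mul_sum, sub_mul, mul_sub, Finset.sum_sub_distrib]
    congr 1
    · rw [Finset.sum_comm]
      refine Finset.sum_congr rfl fun p _ => Finset.sum_congr rfl fun q _ => ?_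
      ring
    · refine Finset.sum_congr rfl fun p _ => Finset.sum_congr rfl fun q _ => ?_
      ring
  rw [this]

lemma pd_apply {α : EuclideanSpace ℝ (Fin N) → EuclideanSpace ℂ P} (hα : IsT α) (k : Fin N) (x) (p : P) :
    (pd k α x) p = pd k (fun y => α y p) x :=
  (pd_clm hα.1 (rs (EuclideanSpace.proj p : EuclideanSpace ℂ P →L[ℂ] ℂ)) k x).symm

lemma comp_isT {α : EuclideanSpace ℝ (Fin N) → EuclideanSpace ℂ P} (hα : IsT α) (p : P) :
    IsT (fun y => α y p) :=
  ⟨(rs (EuclideanSpace.proj p : EuclideanSpace ℂ P →L[ℂ] ℂ)).contDiff.comp hα.1,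
    hα.2.comp_left (g := fun v : EuclideanSpace ℂ P => v p) rfl⟩

variable {φ : EuclideanSpace ℝ (Fin N) → ℝ}

lemma opC_s1 (m : P → Fin N → ℂ) {α : EuclideanSpace ℝ (Fin N) → EuclideanSpace ℂ P} (hα : IsT α) (x) (u : Unit) :
    opC (fun k => rs (aT (s1 m) k)) (fun x => rs (BT φ (s1 m) x)) α x u = ∑ p, dm φ m p (fun y => α y p) x := by
  simp only [opC, rs_apply, aT, BT, PiLp.add_apply, ContinuousLinearMap.sum_apply, ContinuousLinearMap.neg_apply,
    ContinuousLinearMap.smul_apply, WithLp.ofLp_sum, Finset.sum_apply, PiLp.neg_apply, PiLp.smul_apply, adjo_s1,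
    pd_apply hα, smul_eq_mul, dm, dr]
  rw [← Finset.sum_add_distrib, Finset.sum_comm]
  refine Finset.sum_congr rfl fun k _ => ?_
  rw [Finset.mul_sum, ← Finset.sum_neg_distrib, ← Finset.sum_add_distrib]
  refine Finset.sum_congr rfl fun p _ => ?_
  ring

lemma pd_sub {f g : EuclideanSpace ℝ (Fin N) → ℂ}
    (hf : ContDiff ℝ ∞ f) (hg : ContDiff ℝ ∞ g) (k : Fin N) (x) :
    pd k (fun x => f x - g x) x = pd k f x - pd k g x := by
  unfold pd
  rw [fderiv_fun_sub (hf.differentiable (by simp) x) (hg.differentiable (by simp) x)]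
  simp

lemma opC_s2T (m : P → Fin N → ℂ) {α : EuclideanSpace ℝ (Fin N) → EuclideanSpace ℂ (P × P)} (hα : IsT α) (x) (r : P) :
    opC (fun k => rs (aT (s2 m) k)) (fun x => rs (BT φ (s2 m) x)) α x r =
      ∑ p, dm φ m p (fun y => α y (p, r) - α y (r, p)) x := by
  simp only [opC, rs_apply, aT, BT, PiLp.add_apply, ContinuousLinearMap.sum_apply, ContinuousLinearMap.neg_apply,
    ContinuousLinearMap.smul_apply, WithLp.ofLp_sum, Finset.sum_apply, PiLp.neg_apply, PiLp.smul_apply, adjo_s2,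
    pd_apply hα, smul_eq_mul, dm, dr, pd_sub (comp_isT hα _).1 (comp_isT hα _).1]
  rw [← Finset.sum_add_distrib, Finset.sum_comm]
  refine Finset.sum_congr rfl fun k _ => ?_
  rw [Finset.mul_sum, ← Finset.sum_neg_distrib, ← Finset.sum_add_distrib]
  refine Finset.sum_congr rfl fun p _ => ?_
  ring

lemma opC_s2 (m : P → Fin N → ℂ) {α : EuclideanSpace ℝ (Fin N) → EuclideanSpace ℂ P} (hα : IsT α) (x) (p q : P) :
    opC (fun k => rs (s2 m k)) (fun _ => rs 0) α x (p, q) =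
      Dm m p (fun y => α y q) x - Dm m q (fun y => α y p) x := by
  simp only [opC, rs_apply, PiLp.add_apply, WithLp.ofLp_sum, Finset.sum_apply, s2_apply, pd_apply hα, Dm,
    ContinuousLinearMap.zero_apply, PiLp.zero_apply, add_zero, Finset.sum_sub_distrib]

lemma opC_t3_inl (m : P → Fin N → ℂ) {α : EuclideanSpace ℝ (Fin N) → EuclideanSpace ℂ (P × P)} (hα : IsT α)
    (x) (p q r : P) :
    opC (fun k => rs (t3 m k)) (fun _ => rs z3) α x (Sum.inl (p, q, r)) =
      Dm m p (fun y => α y (q, r) - α y (r, q)) x + Dm m q (fun y => α y (r, p) - α y (p, r)) x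
      + Dm m r (fun y => α y (p, q) - α y (q, p)) x := by
  simp only [opC, rs_apply, PiLp.add_apply, WithLp.ofLp_sum, Finset.sum_apply, t3_inl, pd_apply hα, Dm, z3_inl,
    add_zero, Finset.sum_add_distrib, pd_sub (comp_isT hα _).1 (comp_isT hα _).1]

lemma opC_t3_inr (m : P → Fin N → ℂ) {α : EuclideanSpace ℝ (Fin N) → EuclideanSpace ℂ (P × P)} 
    (x) (p q : P) :
    opC (fun k => rs (t3 m k)) (fun _ => rs z3) α x (Sum.inr (p, q)) = α x (p, q) + α x (q, p) := by
  simp only [opC, rs_apply, PiLp.add_apply, WithLp.ofLp_sum, Finset.sum_apply, t3_inr, z3_inr,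
    Finset.sum_const_zero, zero_add]
end Mk
end Part11

section Part12
open Complex MeasureTheory Set Filter Topology
open scoped ENNReal NNReal ContDiff Convolution ComplexConjugate

section Alg
variable {P : Type} [Fintype P]

lemma entry6 (u w : ℂ) : -(1/2) * ‖u - w‖ ^ 2 ≤ (u * conj w).re := by
  simp only [Complex.sq_norm, Complex.normSq_apply, Complex.mul_re, Complex.conj_re, Complex.conj_im, Complex.sub_re,
    Complex.sub_im]
  nlinarith [sq_nonneg u.re, sq_nonneg u.im, sq_nonneg w.re, sq_nonneg w.im]

lemma entry7 (u v w : ℂ) : 2 * ((u * conj v).re + (v * conj w).re + (w * conj u).re) ≤ ‖u + v + w‖ ^ 2 := by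
  simp only [Complex.sq_norm, Complex.normSq_apply, Complex.mul_re, Complex.conj_re, Complex.conj_im, Complex.add_re,
    Complex.add_im]
  nlinarith [sq_nonneg u.re, sq_nonneg u.im, sq_nonneg w.re, sq_nonneg w.im, sq_nonneg v.re, sq_nonneg v.im]

lemma alg6 (A : P → P → ℂ) :
    -(1/2) * ∑ p, ∑ q, ‖A p q - A q p‖ ^ 2 ≤ (∑ p, ∑ q, A p q * conj (A q p)).re := by
  simp only [Complex.re_sum, Finset.mul_sum]
  exact Finset.sum_le_sum fun p _ => Finset.sum_le_sum fun q _ => entry6 _ _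

lemma cyc (f : P → P → P → ℝ) : ∑ p, ∑ q, ∑ r, f q r p = ∑ p, ∑ q, ∑ r, f p q r := by
  rw [Finset.sum_comm]
  refine Finset.sum_congr rfl fun q _ => ?_
  rw [Finset.sum_comm]

lemma alg7 (A : P → P → P → ℂ) (hA : ∀ p q r, A p q r = - A p r q) :
    -(1/6) * ∑ p, ∑ q, ∑ r, ‖A p q r + A q r p + A r p q‖ ^ 2 ≤
      ∑ r, (∑ p, ∑ q, A p q r * conj (A q p r)).re := by
  have h1 : ∑ p, ∑ q, ∑ r, 2 * ((A p q r * conj (A q r p)).re + (A q r p * conj (A r p q)).re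
      + (A r p q * conj (A p q r)).re) ≤ ∑ p, ∑ q, ∑ r, ‖A p q r + A q r p + A r p q‖ ^ 2 :=
    Finset.sum_le_sum fun p _ => Finset.sum_le_sum fun q _ => Finset.sum_le_sum fun r _ => entry7 _ _ _
  simp only [← Finset.mul_sum, Finset.sum_add_distrib] at h1
  have c1 := cyc (fun p q r => (A p q r * conj (A q r p)).re)
  have c2 := cyc (fun p q r => (A q r p * conj (A r p q)).re)
  have e : ∑ r, (∑ p, ∑ q, A p q r * conj (A q p r)).re = - ∑ p, ∑ q, ∑ r, (A p q r * conj (A q r p)).re := by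
    simp only [Complex.re_sum]
    rw [Finset.sum_comm, ← Finset.sum_neg_distrib]
    refine Finset.sum_congr rfl fun p _ => ?_
    rw [Finset.sum_comm, ← Finset.sum_neg_distrib]
    refine Finset.sum_congr rfl fun q _ => ?_
    rw [← Finset.sum_neg_distrib]
    refine Finset.sum_congr rfl fun r _ => ?_
    rw [hA q p r]; simp
  rw [e]
  linarith

lemma alg8 (v : P → P → ℂ) : ∑ r, ∑ p, ‖v p r - v r p‖ ^ 2 + ∑ p, ∑ q, ‖v p q + v q p‖ ^ 2 =
    4 * ∑ p, ∑ q, ‖v p q‖ ^ 2 := by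
  have h : ∀ u w : ℂ, ‖u - w‖ ^ 2 + ‖w + u‖ ^ 2 = 2 * ‖u‖ ^ 2 + 2 * ‖w‖ ^ 2 := by
    intro u w
    simp only [Complex.sq_norm, Complex.normSq_apply, Complex.add_re, Complex.add_im, Complex.sub_re, Complex.sub_im]
    ring
  simp only [← Finset.sum_add_distrib, h, ← Finset.mul_sum]
  simp only [Finset.sum_add_distrib, ← Finset.mul_sum]
  have : ∑ p, ∑ q, ‖v p q‖ ^ 2 = ∑ p, ∑ q, ‖v q p‖ ^ 2 := Finset.sum_comm
  rw [← this]; ring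
end Alg

section Est
variable {N : ℕ} {φ : EuclideanSpace ℝ (Fin N) → ℝ} {P : Type} [Fintype P] [DecidableEq P]

lemma isT_int_sq {G : Type} [NormedAddCommGroup G] [NormedSpace ℝ G] (hφ : Continuous φ)
    {f : EuclideanSpace ℝ (Fin N) → G} (hf : Continuous f) (hc : HasCompactSupport f) :
    Integrable (fun x => ‖f x‖ ^ 2) (wm φ) :=
  IsT.int_wm hφ (by fun_prop) (hc.comp_left (g := fun z : G => ‖z‖ ^ 2) (by simp))

lemma est1 (hφ : ContDiff ℝ ∞ φ) {c : ℝ}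
    (hH : ∀ x, ∀ ξ : Fin N → ℝ, ∑ j, ∑ k, pd j (fun y => pd k φ y) x * ξ j * ξ k ≥ c * ∑ j, ξ j ^ 2)
    (m : P → Fin N → ℂ) (hm : ∀ p q, ∑ k, m p k * conj (m q k) = if p = q then 1 / 2 else 0)
    (α : EuclideanSpace ℝ (Fin N) → EuclideanSpace ℂ P) (hα : IsT α) :
    c / 2 * ∫ x, ‖α x‖ ^ 2 ∂(wm φ) ≤
      ∫ x, ‖opC (fun k => rs (aT (s1 m) k)) (fun x => rs (BT φ (s1 m) x)) α x‖ ^ 2 ∂(wm φ) +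
      1 / 2 * ∫ x, ‖opC (fun k => rs (s2 m k)) (fun _ => rs 0) α x‖ ^ 2 ∂(wm φ) := by
  have hφc := hφ.continuous
  have hk := keyest hφ hH m hm (fun p y => α y p) (fun p => comp_isT hα p)
  have e1 : ∀ x, ‖α x‖ ^ 2 = ∑ p, ‖α x p‖ ^ 2 := fun x => EuclideanSpace.norm_sq_eq _
  have e2 : ∀ x, ‖opC (fun k => rs (aT (s1 m) k)) (fun x => rs (BT φ (s1 m) x)) α x‖ ^ 2 =
      ‖∑ p, dm φ m p (fun y => α y p) x‖ ^ 2 := fun x => by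
    rw [EuclideanSpace.norm_sq_eq]
    simp only [opC_s1 m hα, Finset.univ_unique, Finset.sum_singleton]
  have e3 : ∀ x, ‖opC (fun k => rs (s2 m k)) (fun _ => rs 0) α x‖ ^ 2 =
      ∑ p, ∑ q, ‖Dm m p (fun y => α y q) x - Dm m q (fun y => α y p) x‖ ^ 2 := fun x => by
    rw [EuclideanSpace.norm_sq_eq, Fintype.sum_prod_type]
    simp only [opC_s2 m hα]
  have TD : IsT (fun x => ∑ p, ∑ q, Dm m p (fun y => α y q) x * conj (Dm m q (fun y => α y p) x)) :=
    IsT.sum fun p => IsT.sum fun q => (Dm_isT m p (comp_isT hα q)).mul (Dm_isT m q (comp_isT hα p)).conj.1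
  have i3 := isT_int_sq hφc (opC_cont (a := s2 m) (B := fun _ => 0) continuous_const hα)
    (opC_comp (a := s2 m) (B := fun _ => 0) hα)
  have hmono := integral_mono (i3.const_mul (-(1/2))) (TD.int hφc).re (fun x => by
    simp only [e3]
    exact alg6 (fun p q => Dm m p (fun y => α y q) x))
  rw [integral_const_mul] at hmono
  simp only [e1, e2] at *
  have : ∫ x, RCLike.re (∑ p, ∑ q, Dm m p (fun y => α y q) x * conj (Dm m q (fun y => α y p) x)) ∂(wm φ) =
    ∫ x, (∑ p, ∑ q, Dm m p (fun y => α y q) x * conj (Dm m q (fun y => α y p) x)).re ∂(wm φ) := rfl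
  rw [this] at hmono
  linarith

set_option maxHeartbeats 800000 in
lemma est2 (hφ : ContDiff ℝ ∞ φ) {c : ℝ} (hc : 0 < c)
    (hH : ∀ x, ∀ ξ : Fin N → ℝ, ∑ j, ∑ k, pd j (fun y => pd k φ y) x * ξ j * ξ k ≥ c * ∑ j, ξ j ^ 2)
    (m : P → Fin N → ℂ) (hm : ∀ p q, ∑ k, m p k * conj (m q k) = if p = q then 1 / 2 else 0)
    (α : EuclideanSpace ℝ (Fin N) → EuclideanSpace ℂ (P × P)) (hα : IsT α) :
    2 * c * ∫ x, ‖α x‖ ^ 2 ∂(wm φ) ≤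
      ∫ x, ‖opC (fun k => rs (aT (s2 m) k)) (fun x => rs (BT φ (s2 m) x)) α x‖ ^ 2 ∂(wm φ) +
      (1 + c) * ∫ x, ‖opC (fun k => rs (t3 m k)) (fun _ => rs z3) α x‖ ^ 2 ∂(wm φ) := by
  have hφc := hφ.continuous
  let b : P → P → EuclideanSpace ℝ (Fin N) → ℂ := fun p r y => α y (p, r) - α y (r, p)
  have hb : ∀ p r, IsT (b p r) := fun p r => (comp_isT hα _).sub (comp_isT hα _)
  have hk := fun r => keyest hφ hH m hm (fun p => b p r) (fun p => hb p r)
  have TD : ∀ r, IsT (fun x => ∑ p, ∑ q, Dm m p (b q r) x * conj (Dm m q (b p r) x)) := fun r =>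
    IsT.sum fun p => IsT.sum fun q => (Dm_isT m p (hb q r)).mul (Dm_isT m q (hb p r)).conj.1
  have iB : ∀ r, Integrable (fun x => ∑ p, ‖b p r x‖ ^ 2) (wm φ) := fun r =>
    integrable_finsetSum _ fun p _ => (hb p r).int_sq hφc
  have iX : ∀ r, Integrable (fun x => (∑ p, ∑ q, Dm m p (b q r) x * conj (Dm m q (b p r) x)).re) (wm φ) :=
    fun r => ((TD r).int hφc).re
  have Td : ∀ r, IsT (fun x => ∑ q, dm φ m q (b q r) x) := fun r => IsT.sum fun q => dm_isT hφ m q (hb q r)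
  have hs := Finset.sum_le_sum fun r (_ : r ∈ Finset.univ) => hk r
  rw [Finset.sum_add_distrib, ← Finset.mul_sum, ← integral_finsetSum _ (fun r _ => iB r),
    ← integral_finsetSum _ (fun r _ => iX r), ← integral_finsetSum _ (fun r _ => (Td r).int_sq hφc)] at hs
  have e2 : ∀ x, ‖opC (fun k => rs (aT (s2 m) k)) (fun x => rs (BT φ (s2 m) x)) α x‖ ^ 2 =
      ∑ r, ‖∑ q, dm φ m q (b q r) x‖ ^ 2 := fun x => by
    rw [EuclideanSpace.norm_sq_eq]
    simp only [opC_s2T m hα, b]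
  simp only [e2]
  refine le_trans ?_ (add_le_add hs le_rfl)
  have i3 := isT_int_sq hφc (opC_cont (a := t3 m) (B := fun _ => z3) continuous_const hα)
    (opC_comp (a := t3 m) (B := fun _ => z3) hα)
  have iα := isT_int_sq hφc hα.continuous hα.2
  have iB' := (integrable_finsetSum Finset.univ fun r _ => iB r).const_mul (c / 2)
  have iX' := integrable_finsetSum Finset.univ fun r _ => iX r
  have iBX : Integrable (fun x => c / 2 * ∑ i, ∑ p, ‖b p i x‖ ^ 2 +
      ∑ i, (∑ p, ∑ q, Dm m p (b q i) x * conj (Dm m q (b p i) x)).re) (wm φ) := iB'.add iX'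
  rw [← integral_const_mul, ← integral_const_mul, ← integral_const_mul, ← integral_add iB' iX',
    ← integral_add iBX (i3.const_mul (1+c))]
  refine integral_mono (iα.const_mul _) (iBX.add (i3.const_mul (1+c))) fun x => ?_
  have e3 : ‖opC (fun k => rs (t3 m k)) (fun _ => rs z3) α x‖ ^ 2 =
      ∑ p, ∑ q, ∑ r, ‖Dm m p (b q r) x + Dm m q (b r p) x + Dm m r (b p q) x‖ ^ 2 +
      ∑ p, ∑ q, ‖α x (p, q) + α x (q, p)‖ ^ 2 := by
    rw [EuclideanSpace.norm_sq_eq, Fintype.sum_sum_type]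
    simp only [Fintype.sum_prod_type, opC_t3_inl m hα, opC_t3_inr m, b]
  have e1 : ‖α x‖ ^ 2 = ∑ p, ∑ q, ‖α x (p, q)‖ ^ 2 := by
    rw [EuclideanSpace.norm_sq_eq, Fintype.sum_prod_type]
  have h8 := alg8 (fun p q => α x (p, q))
  have h7 := alg7 (fun p q r => Dm m p (b q r) x) (fun p q r => by
    have hn : b q r = fun y => - b r q y := by ext y; simp [b]
    have : ∀ k, pd k (b q r) x = - pd k (b r q) x := fun k => by rw [hn]; simp [pd]
    simp [Dm, this])
  have p1 : 0 ≤ ∑ p, ∑ q, ∑ r, ‖Dm m p (b q r) x + Dm m q (b r p) x + Dm m r (b p q) x‖ ^ 2 :=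
    Finset.sum_nonneg fun _ _ => Finset.sum_nonneg fun _ _ => Finset.sum_nonneg fun _ _ => sq_nonneg _
  have p2 : 0 ≤ ∑ p, ∑ q, ‖α x (p, q) + α x (q, p)‖ ^ 2 :=
    Finset.sum_nonneg fun _ _ => Finset.sum_nonneg fun _ _ => sq_nonneg _
  simp only [e3, e1]
  simp only at h8 h7
  have h9 : ∑ r, ∑ p, ‖b p r x‖ ^ 2 = 4 * ∑ p, ∑ q, ‖α x (p, q)‖ ^ 2 - ∑ p, ∑ q, ‖α x (p, q) + α x (q, p)‖ ^ 2 := by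
    rw [← h8]; simp only [b]; ring
  rw [h9]
  nlinarith [mul_nonneg hc.le p1, mul_nonneg hc.le p2]

theorem solve1 (hφ : ContDiff ℝ ∞ φ) {c : ℝ} (hc : 0 < c)
    (hH : ∀ x, ∀ ξ : Fin N → ℝ, ∑ j, ∑ k, pd j (fun y => pd k φ y) x * ξ j * ξ k ≥ c * ∑ j, ξ j ^ 2)
    (m : P → Fin N → ℂ) (hm : ∀ p q, ∑ k, m p k * conj (m q k) = if p = q then 1 / 2 else 0)
    (g : Lp (EuclideanSpace ℂ P) 2 (wm φ)) (γ : Lp (EuclideanSpace ℂ (P × P)) 2 (wm φ))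
    (hg : opW (fun k => rs (s2 m k)) (fun _ => rs 0) g γ) :
    ∃ (g' : Lp (EuclideanSpace ℂ P) 2 (wm φ)) (v : Lp (EuclideanSpace ℂ Unit) 2 (wm φ)),
      opW (fun k => rs (s1 m k)) (fun _ => rs 0) v g' ∧
      c / 2 * ‖v‖ ^ 2 ≤ ‖g'‖ ^ 2 ∧ ‖g'‖ ≤ ‖g‖ ∧ c / 2 * ‖g - g'‖ ^ 2 ≤ 1 / 2 * ‖γ‖ ^ 2 :=
  thmG hφ (s1 m) (s2 m) 0 (s2_s1 m) (fun _ _ => rfl) (by positivity) (est1 hφ hH m hm) g γ hg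

theorem solve2 (hφ : ContDiff ℝ ∞ φ) {c : ℝ} (hc : 0 < c)
    (hH : ∀ x, ∀ ξ : Fin N → ℝ, ∑ j, ∑ k, pd j (fun y => pd k φ y) x * ξ j * ξ k ≥ c * ∑ j, ξ j ^ 2)
    (m : P → Fin N → ℂ) (hm : ∀ p q, ∑ k, m p k * conj (m q k) = if p = q then 1 / 2 else 0)
    (g : Lp (EuclideanSpace ℂ (P × P)) 2 (wm φ)) (γ : Lp (EuclideanSpace ℂ ((P × P × P) ⊕ (P × P))) 2 (wm φ))
    (hg : opW (fun k => rs (t3 m k)) (fun _ => rs z3) g γ) :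
    ∃ (g' : Lp (EuclideanSpace ℂ (P × P)) 2 (wm φ)) (v : Lp (EuclideanSpace ℂ P) 2 (wm φ)),
      opW (fun k => rs (s2 m k)) (fun _ => rs 0) v g' ∧
      2 * c * ‖v‖ ^ 2 ≤ ‖g'‖ ^ 2 ∧ ‖g'‖ ≤ ‖g‖ ∧ 2 * c * ‖g - g'‖ ^ 2 ≤ (1 + c) * ‖γ‖ ^ 2 :=
  thmG hφ (s2 m) (t3 m) z3 (t3_s2 m) (z3_s2 m) (by positivity) (est2 hφ hc hH m hm) g γ hg
end Est
end Part12

section Part13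
open Complex MeasureTheory Set Filter Topology
open scoped ENNReal NNReal ContDiff Convolution ComplexConjugate

section Weights
variable {N : ℕ}

/-- real Hessian form -/
noncomputable def Hs (ψ : EuclideanSpace ℝ (Fin N) → ℝ) (x : EuclideanSpace ℝ (Fin N)) (ξ : Fin N → ℝ) : ℝ :=
  ∑ j, ∑ k, pd j (fun y => pd k ψ y) x * ξ j * ξ k

lemma pdr_add {f g : EuclideanSpace ℝ (Fin N) → ℝ}
    (hf : ContDiff ℝ ∞ f) (hg : ContDiff ℝ ∞ g) (k : Fin N) (x) :
    pd k (fun x => f x + g x) x = pd k f x + pd k g x := by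
  unfold pd
  rw [fderiv_fun_add (hf.differentiable (by simp) x) (hg.differentiable (by simp) x)]
  rfl

lemma pdr_mul {f g : EuclideanSpace ℝ (Fin N) → ℝ}
    (hf : ContDiff ℝ ∞ f) (hg : ContDiff ℝ ∞ g) (k : Fin N) (x) :
    pd k (fun x => f x * g x) x = pd k f x * g x + f x * pd k g x := pd_smul hf hg k x

lemma pdr_exp {f : EuclideanSpace ℝ (Fin N) → ℝ}
    (hf : ContDiff ℝ ∞ f) (k : Fin N) (x) :
    pd k (fun x => Real.exp (f x)) x = Real.exp (f x) * pd k f x := by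
  unfold pd
  have := (hf.differentiable (by simp) x).hasFDerivAt.exp
  rw [this.fderiv]; rfl

lemma Hs_add {f g : EuclideanSpace ℝ (Fin N) → ℝ}
    (hf : ContDiff ℝ ∞ f) (hg : ContDiff ℝ ∞ g) (x ξ) :
    Hs (fun x => f x + g x) x ξ = Hs f x ξ + Hs g x ξ := by
  unfold Hs
  simp only [pdr_add hf hg]
  simp only [fun k => pdr_add (contDiff_pd hf k) (contDiff_pd hg k), add_mul, Finset.sum_add_distrib]

lemma Hs_exp {f : EuclideanSpace ℝ (Fin N) → ℝ} (hf : ContDiff ℝ ∞ f) (x ξ) :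
    Hs (fun x => Real.exp (f x)) x ξ = Real.exp (f x) * ((∑ k, pd k f x * ξ k) ^ 2 + Hs f x ξ) := by
  unfold Hs
  simp only [pdr_exp hf]
  simp only [fun k => pdr_mul hf.exp (contDiff_pd hf k), pdr_exp hf]
  rw [sq, Finset.sum_mul_sum, ← Finset.sum_add_distrib, Finset.mul_sum]
  refine Finset.sum_congr rfl fun j _ => ?_
  rw [← Finset.sum_add_distrib, Finset.mul_sum]
  refine Finset.sum_congr rfl fun k _ => ?_
  ring

lemma Hs_const_mul {f : EuclideanSpace ℝ (Fin N) → ℝ} (hf : ContDiff ℝ ∞ f) (a : ℝ) (x ξ) :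
    Hs (fun x => a * f x) x ξ = a * Hs f x ξ := by
  unfold Hs
  have h : ∀ {f : EuclideanSpace ℝ (Fin N) → ℝ}, ContDiff ℝ ∞ f → ∀ k x, pd k (fun x => a * f x) x = a * pd k f x := by
    intro f hf k x
    rw [pdr_mul contDiff_const hf]
    simp [pd]
  simp only [h hf]
  simp only [fun k => h (contDiff_pd hf k), Finset.mul_sum]
  refine Finset.sum_congr rfl fun j _ => Finset.sum_congr rfl fun k _ => by ring

lemma Hs_affine (ℓ : EuclideanSpace ℝ (Fin N) →L[ℝ] ℝ) (a : ℝ) (x ξ) :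
    Hs (fun x => ℓ x + a) x ξ = 0 := by
  unfold Hs
  have : ∀ k y, pd k (fun x => ℓ x + a) y = ℓ (EuclideanSpace.single k 1) := by
    intro k y
    unfold pd
    rw [fderiv_add_const, ℓ.fderiv]
  simp only [this]
  simp [pd]

lemma pd_coord (j k : Fin N) (x : EuclideanSpace ℝ (Fin N)) :
    pd j (fun x : EuclideanSpace ℝ (Fin N) => x k) x = if k = j then 1 else 0 := by
  unfold pd
  have : (fun x : EuclideanSpace ℝ (Fin N) => x k) = EuclideanSpace.proj (𝕜 := ℝ) k := rfl
  rw [this, ContinuousLinearMap.fderiv]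
  simp [EuclideanSpace.single_apply]

lemma cd_coord (k : Fin N) : ContDiff ℝ ∞ (fun x : EuclideanSpace ℝ (Fin N) => x k) :=
  (EuclideanSpace.proj (𝕜 := ℝ) k).contDiff

lemma Hs_sum {ι : Type} (s : Finset ι) {f : ι → EuclideanSpace ℝ (Fin N) → ℝ} (hf : ∀ i, ContDiff ℝ ∞ (f i)) (x ξ) :
    Hs (fun x => ∑ i ∈ s, f i x) x ξ = ∑ i ∈ s, Hs (f i) x ξ := by
  classical
  induction s using Finset.induction_on with
  | empty => simp [Hs, pd]
  | insert i s hi ih =>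
    simp only [Finset.sum_insert hi]
    rw [Hs_add (hf i) (ContDiff.sum fun i _ => hf i), ih]

lemma Hs_normsq (x : EuclideanSpace ℝ (Fin N)) (ξ) :
    Hs (fun x => ‖x‖ ^ 2) x ξ = 2 * ∑ j, ξ j ^ 2 := by
  have : (fun x : EuclideanSpace ℝ (Fin N) => ‖x‖ ^ 2) = fun x => ∑ i, x i * x i := by
    ext x; rw [EuclideanSpace.real_norm_sq_eq]; simp [sq]
  rw [this, Hs_sum _ (fun i => (cd_coord i).mul (cd_coord i)), Finset.mul_sum]
  refine Finset.sum_congr rfl fun i _ => ?_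
  unfold Hs
  simp only [pdr_mul (cd_coord i) (cd_coord i), pd_coord]
  have : ∀ j k : Fin N, ∀ x : EuclideanSpace ℝ (Fin N), pd j (fun y : EuclideanSpace ℝ (Fin N) =>
      (if i = k then 1 else 0) * y i + y i * (if i = k then 1 else 0)) x =
      if i = k then (if i = j then 2 else 0) else 0 := by
    intro j k x
    split_ifs with h1 h2
    · rw [pdr_add (contDiff_const.mul (cd_coord i)) ((cd_coord i).mul contDiff_const),
        pdr_mul contDiff_const (cd_coord i), pdr_mul (cd_coord i) contDiff_const, pd_coord]
      simp [pd, h2]; norm_num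
    · rw [pdr_add (contDiff_const.mul (cd_coord i)) ((cd_coord i).mul contDiff_const),
        pdr_mul contDiff_const (cd_coord i), pdr_mul (cd_coord i) contDiff_const, pd_coord]
      simp [pd, h2]
    · simp [pd]
  simp only [this]
  simp [Finset.sum_ite_eq, ite_mul]
  ring

lemma pd_congr {F : Type} [NormedAddCommGroup F] [NormedSpace ℝ F]
    {f g : EuclideanSpace ℝ (Fin N) → F} {x} (h : f =ᶠ[𝓝 x] g) (k : Fin N) :
    pd k f x = pd k g x := by
  unfold pd; rw [h.fderiv_eq]

lemma Hs_congr {f g : EuclideanSpace ℝ (Fin N) → ℝ} {x} (h : f =ᶠ[𝓝 x] g) (ξ) :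
    Hs f x ξ = Hs g x ξ := by
  unfold Hs
  refine Finset.sum_congr rfl fun j _ => Finset.sum_congr rfl fun k _ => ?_
  rw [pd_congr (h.eventually_nhds.mono fun y hy => pd_congr hy k) j]

lemma Hs_bound {f : EuclideanSpace ℝ (Fin N) → ℝ} (hf : IsT f) :
    ∃ C, 0 ≤ C ∧ ∀ x ξ, - C * ∑ j, ξ j ^ 2 ≤ Hs f x ξ := by
  have : ∀ j k : Fin N, ∃ C, ∀ x, ‖pd j (fun y => pd k f y) x‖ ≤ C := fun j k =>
    (isT_pd (isT_pd hf k) j).continuous.bounded_above_of_compact_support (isT_pd (isT_pd hf k) j).2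
  choose C hC using this
  have hC0 : ∀ j k, 0 ≤ C j k := fun j k => (norm_nonneg _).trans (hC j k 0)
  refine ⟨∑ j, ∑ k, C j k, Finset.sum_nonneg fun _ _ => Finset.sum_nonneg fun _ _ => hC0 _ _, fun x ξ => ?_⟩
  unfold Hs
  rw [← Finset.sum_neg_distrib, Finset.sum_mul]
  refine Finset.sum_le_sum fun j _ => ?_
  rw [← Finset.sum_neg_distrib, Finset.sum_mul]
  refine Finset.sum_le_sum fun k _ => ?_
  have h1 : ∀ i, ξ i ^ 2 ≤ ∑ j, ξ j ^ 2 := fun i =>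
    Finset.single_le_sum (f := fun j => ξ j ^ 2) (fun _ _ => sq_nonneg _) (Finset.mem_univ i)
  have h2 : |ξ j * ξ k| ≤ ∑ j, ξ j ^ 2 := by
    rw [abs_le]; constructor <;> nlinarith [h1 j, h1 k, sq_nonneg (ξ j + ξ k), sq_nonneg (ξ j - ξ k)]
  have h3 : |pd j (fun y => pd k f y) x * (ξ j * ξ k)| ≤ C j k * ∑ j, ξ j ^ 2 := by
    rw [abs_mul]; exact mul_le_mul (hC j k x) h2 (abs_nonneg _) (hC0 _ _)
  have := (abs_le.1 h3).1
  linarith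

lemma exists_cutoff {V Ω : Set (EuclideanSpace ℝ (Fin N))} (hV : IsCompact V) (hΩ : IsOpen Ω) (h : V ⊆ Ω) :
    ∃ χ : EuclideanSpace ℝ (Fin N) → ℝ, IsT χ ∧ tsupport χ ⊆ Ω ∧ (∀ x, 0 ≤ χ x ∧ χ x ≤ 1) ∧
      ∀ x ∈ V, χ =ᶠ[𝓝 x] fun _ => 1 := by
  obtain ⟨L, hL, hVL, hLΩ⟩ := exists_compact_between hV hΩ h
  obtain ⟨f, h1, h0, hf⟩ := exists_contMDiffMap_one_nhds_of_subset_interior (n := (⊤ : ℕ∞))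
    (modelWithCornersSelf ℝ (EuclideanSpace ℝ (Fin N))) hV.isClosed hVL
  have hs : tsupport f ⊆ L := closure_minimal (fun x hx => by
    by_contra hn; exact hx (h0 x hn)) hL.isClosed
  refine ⟨f, ⟨contMDiff_iff_contDiff.1 f.contMDiff, HasCompactSupport.intro hL fun x hx => h0 x hx⟩, hs.trans hLΩ, fun x => hf x, fun x hx => ?_⟩
  exact h1.filter_mono (nhds_le_nhdsSet hx)

set_option maxHeartbeats 1000000 in
lemma W1 {K Ω : Set (EuclideanSpace ℝ (Fin N))} (hK : IsCompact K) (hΩ : IsOpen Ω) (hc : Convex ℝ Ω)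
    (hKΩ : K ⊆ Ω) : ∃ (V : Set (EuclideanSpace ℝ (Fin N))) (g : EuclideanSpace ℝ (Fin N) → ℝ) (σ : ℝ),
      IsCompact V ∧ K ⊆ V ∧ V ⊆ Ω ∧ ContDiff ℝ ∞ g ∧ 0 < σ ∧ (∀ x ξ, σ * ∑ j, ξ j ^ 2 ≤ Hs g x ξ) ∧
      (∀ x ∈ K, g x ≤ 1 / 2) ∧ ∀ x, x ∉ V → 1 ≤ g x := by
  classical
  obtain ⟨r, hr⟩ := hK.isBounded.exists_norm_le
  set r' := max r 0
  have hr' : ∀ x ∈ K, ‖x‖ ≤ r' := fun x hx => (hr x hx).trans (le_max_left _ _)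
  have hr0 : 0 ≤ r' := le_max_right _ _
  set η : ℝ := 1 / (4 * (r' + 1) ^ 2) with hη
  have hη0 : 0 < η := by positivity
  have hηe : η * (4 * (r' + 1) ^ 2) = 1 := by rw [hη]; field_simp
  set R := 2 * (r' + 1)
  set B := Metric.closedBall (0 : EuclideanSpace ℝ (Fin N)) R
  have hB : IsCompact B := isCompact_closedBall _ _
  -- functionals
  have hfun : ∀ y : EuclideanSpace ℝ (Fin N), ∃ (ℓ : EuclideanSpace ℝ (Fin N) →L[ℝ] ℝ) (a : ℝ),
      y ∉ Ω → ℓ y + a = 0 ∧ ∀ x ∈ K, ℓ x + a ≤ -1 := by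
    intro y
    by_cases hy : y ∈ Ω
    · exact ⟨0, 0, fun h => absurd hy h⟩
    obtain ⟨f, hf⟩ := geometric_hahn_banach_open_point hc hΩ hy
    have : ∃ δ : ℝ, 0 < δ ∧ ∀ x ∈ K, f x ≤ f y - δ := by
      rcases K.eq_empty_or_nonempty with h | h
      · exact ⟨1, one_pos, by simp [h]⟩
      obtain ⟨x0, hx0, hm⟩ := hK.exists_isMaxOn h f.continuous.continuousOn
      exact ⟨f y - f x0, sub_pos.2 (hf x0 (hKΩ hx0)), fun x hx => by
        have := hm hx; simp only [mem_setOf_eq] at this; linarith⟩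
    obtain ⟨δ, hδ, hd⟩ := this
    refine ⟨δ⁻¹ • f, - (δ⁻¹ * f y), fun _ => ⟨by simp, fun x hx => ?_⟩⟩
    have := mul_le_mul_of_nonneg_left (hd x hx) (inv_pos.2 hδ).le
    rw [mul_sub, inv_mul_cancel₀ hδ.ne'] at this
    simp only [ContinuousLinearMap.smul_apply, smul_eq_mul]; linarith
  choose ℓ a hℓ using hfun
  have hcomp : IsCompact (B \ Ω) := hB.diff hΩ
  have hop : ∀ y, IsOpen {x | -(1/2) < ℓ y x + a y} := fun y =>
    isOpen_lt continuous_const ((ℓ y).continuous.add continuous_const)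
  obtain ⟨t, ht⟩ := hcomp.elim_nhds_subcover' (fun y _ => {x | -(1/2) < ℓ y x + a y}) (fun y hy =>
    (hop y).mem_nhds (by simp only [mem_setOf_eq]; rw [(hℓ y hy.2).1]; norm_num))
  set V := B \ ⋃ y ∈ t, {x | -(1/2) < ℓ y x + a y} with hV
  have hT : (0:ℝ) < 4 * ((t.card : ℝ) + 1) := mul_pos four_pos (Nat.cast_add_one_pos _)
  set M := 2 * Real.log (4 * (t.card + 1)) with hM
  have hM0 : 0 ≤ M := mul_nonneg zero_le_two (Real.log_nonneg (by have : (0:ℝ) ≤ t.card := Nat.cast_nonneg _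
                                                                  linarith))
  let g : EuclideanSpace ℝ (Fin N) → ℝ := fun x => η * ‖x‖ ^ 2 + ∑ y ∈ t, Real.exp (M * (ℓ y x + (a y + 1/2)))
  have c1 : ContDiff ℝ ∞ (fun x : EuclideanSpace ℝ (Fin N) => ‖x‖ ^ 2) := contDiff_norm_sq ℝ
  have c2 : ∀ y, ContDiff ℝ ∞ (fun x => ℓ y x + (a y + 1/2)) := fun y => (ℓ y).contDiff.add contDiff_const
  have c3 : ∀ y, ContDiff ℝ ∞ (fun x => M * (ℓ y x + (a y + 1/2))) := fun y => contDiff_const.mul (c2 y)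
  refine ⟨V, g, 2 * η, hB.diff (isOpen_biUnion fun y _ => hop y), fun x hx => ⟨?_, ?_⟩, fun x hx => ?_, ?_, by positivity, fun x ξ => ?_, fun x hx => ?_, fun x hx => ?_⟩
  · simp only [B, mem_closedBall_zero_iff]; have := hr' x hx; simp only [R]; linarith
  · simp only [mem_iUnion, mem_setOf_eq, not_exists, not_lt]
    intro y hy; have := (hℓ y y.2.2).2 x hx; linarith
  · by_contra hn
    obtain ⟨h1, h2⟩ := hx
    exact h2 (ht ⟨h1, hn⟩)
  · exact (contDiff_const.mul c1).add (ContDiff.sum fun y _ => (c3 y).exp)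
  · have : Hs g x ξ = η * (2 * ∑ j, ξ j ^ 2) + ∑ y ∈ t, Real.exp (M * (ℓ y x + (a y + 1/2))) *
        ((∑ k, pd k (fun x => M * (ℓ y x + (a y + 1/2))) x * ξ k) ^ 2 + 0) := by
      have cA : ContDiff ℝ ∞ (fun x : EuclideanSpace ℝ (Fin N) => η * ‖x‖ ^ 2) := contDiff_const.mul c1
      have cS : ContDiff ℝ ∞ (fun x => ∑ y ∈ t, Real.exp (M * (ℓ y x + (a y + 1/2)))) :=
        ContDiff.sum fun y _ => (c3 y).exp
      rw [show Hs g x ξ = _ from Hs_add cA cS x ξ, Hs_const_mul c1, Hs_normsq,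
        Hs_sum t (f := fun y x => Real.exp (M * (ℓ y x + (a y + 1/2)))) (fun y => (c3 y).exp)]
      congr 1
      refine Finset.sum_congr rfl fun y _ => ?_
      rw [Hs_exp (c3 y), Hs_const_mul (c2 y), Hs_affine, mul_zero]
    rw [this]
    have : 0 ≤ ∑ y ∈ t, Real.exp (M * (ℓ y x + (a y + 1/2))) *
        ((∑ k, pd k (fun x => M * (ℓ y x + (a y + 1/2))) x * ξ k) ^ 2 + 0) :=
      Finset.sum_nonneg fun _ _ => by positivity
    linarith
  · have h1 : η * ‖x‖ ^ 2 ≤ 1 / 4 := by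
      have : ‖x‖ ^ 2 ≤ (r' + 1) ^ 2 := pow_le_pow_left₀ (norm_nonneg _) (by linarith [hr' x hx]) 2
      nlinarith
    have h2 : ∑ y ∈ t, Real.exp (M * (ℓ y x + (a y + 1/2))) ≤ ∑ y ∈ t, 1 / (4 * ((t.card : ℝ) + 1)) := by
      refine Finset.sum_le_sum fun y hy => ?_
      have h3 := (hℓ y y.2.2).2 x hx
      have h4 : M * (ℓ y x + (a y + 1/2)) ≤ - Real.log (4 * (t.card + 1)) := by
        have : M * (ℓ y x + (a y + 1/2)) ≤ M * (-(1/2)) := mul_le_mul_of_nonneg_left (by linarith) hM0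
        rw [hM] at this ⊢; linarith
      refine (Real.exp_le_exp.2 h4).trans ?_
      rw [Real.exp_neg, Real.exp_log hT, one_div]
    have h5 : ∑ y ∈ t, 1 / (4 * ((t.card : ℝ) + 1)) ≤ 1 / 4 := by
      rw [Finset.sum_const, nsmul_eq_mul, mul_one_div, div_le_div_iff₀ hT (by norm_num)]
      linarith
    simp only [g]; linarith
  · have hp : ∀ y ∈ t, 0 ≤ Real.exp (M * (ℓ y x + (a y + 1/2))) := fun _ _ => (Real.exp_pos _).le
    by_cases hx' : x ∈ B
    · have : x ∈ ⋃ y ∈ t, {x | -(1/2) < ℓ y x + a y} := by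
        by_contra hn; exact hx ⟨hx', hn⟩
      simp only [mem_iUnion, mem_setOf_eq] at this
      obtain ⟨y, hy, h⟩ := this
      have h1 := Finset.single_le_sum hp hy
      have h2 : 1 ≤ Real.exp (M * (ℓ y x + (a y + 1/2))) := Real.one_le_exp (mul_nonneg hM0 (by linarith))
      have h3 : 0 ≤ η * ‖x‖ ^ 2 := by positivity
      simp only [g]; linarith
    · simp only [B, mem_closedBall_zero_iff, not_le, R] at hx'
      have h1 : (2 * (r' + 1)) ^ 2 ≤ ‖x‖ ^ 2 := pow_le_pow_left₀ (by positivity) hx'.le 2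
      have h2 := mul_le_mul_of_nonneg_left h1 hη0.le
      have h3 := Finset.sum_nonneg hp
      simp only [g]; nlinarith

theorem lemmaW {K Ω U : Set (EuclideanSpace ℝ (Fin N))} (hK : IsCompact K) (hΩ : IsOpen Ω) (hcv : Convex ℝ Ω)
    (hKΩ : K ⊆ Ω) (hU : IsOpen U) (hΩU : Ω ⊆ U) {φ : EuclideanSpace ℝ (Fin N) → ℝ} (hφ : ContDiffOn ℝ ∞ φ U)
    (hφ0 : ∀ x ∈ Ω, 0 ≤ φ x) {c : ℝ} (hc : 0 < c)
    (hH : ∀ x ∈ Ω, ∀ ξ : Fin N → ℝ, Hs φ x ξ ≥ c * ∑ j, ξ j ^ 2) :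
    ∃ χ : EuclideanSpace ℝ (Fin N) → ℝ, IsT χ ∧ tsupport χ ⊆ Ω ∧ (∀ x, 0 ≤ χ x ∧ χ x ≤ 1) ∧
      (∀ x ∈ K, χ x = 1) ∧ ∀ ε : ℝ, 0 < ε → ∃ Φ : EuclideanSpace ℝ (Fin N) → ℝ, ContDiff ℝ ∞ Φ ∧
      (∀ x ξ, Hs Φ x ξ ≥ c * ∑ j, ξ j ^ 2) ∧ (∀ x ∈ tsupport χ, φ x ≤ Φ x) ∧ (∀ x ∈ K, Φ x ≤ φ x + 1 / 2) ∧
      ∀ x k, pd k χ x ≠ 0 → Real.exp (-Φ x) ≤ ε := by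
  obtain ⟨V, g, σ, hV, hKV, hVΩ, hg, hσ, hgH, hgK, hgV⟩ := W1 hK hΩ hcv hKΩ
  obtain ⟨χ, hχ, hχΩ, hχ01, hχ1⟩ := exists_cutoff hV hΩ hVΩ
  obtain ⟨θ, hθ, hθΩ, hθ01, hθ1⟩ := exists_cutoff (V := tsupport χ) hχ.2 hΩ hχΩ
  have hVs : V ⊆ tsupport χ := fun x hx => subset_tsupport _ (by
    have := (hχ1 x hx).self_of_nhds; simp [Function.mem_support, this])
  have hψ : IsT (fun x => θ x * φ x) := by
    refine ⟨contDiff_iff_contDiffAt.2 fun x => ?_, hθ.2.mul_right⟩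
    by_cases hx : x ∈ U
    · exact hθ.1.contDiffAt.mul (hφ.contDiffAt (hU.mem_nhds hx))
    · have : x ∉ tsupport θ := fun h => hx (hΩU (hθΩ h))
      rw [notMem_tsupport_iff_eventuallyEq] at this
      refine (contDiffAt_const (c := (0:ℝ))).congr_of_eventuallyEq ?_
      filter_upwards [this] with y hy
      simp [hy]
  obtain ⟨C, hC0, hC⟩ := Hs_bound hψ
  refine ⟨χ, hχ, hχΩ, hχ01, fun x hx => (hχ1 x (hKV hx)).self_of_nhds, fun ε hε => ?_⟩
  obtain ⟨L, hL4, hLC, hLε⟩ : ∃ L : ℝ, 4 ≤ L ∧ C + c ≤ L * σ ∧ Real.exp (-(L / 4)) ≤ ε := by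
    refine ⟨max 4 (max ((C + c) / σ) (4 * -Real.log ε)), le_max_left _ _, ?_, ?_⟩
    · rw [← div_le_iff₀ hσ]; exact (le_max_left _ _).trans (le_max_right _ _)
    · rw [← Real.le_log_iff_exp_le hε]
      have : 4 * -Real.log ε ≤ max 4 (max ((C + c) / σ) (4 * -Real.log ε)) :=
        (le_max_right _ _).trans (le_max_right _ _)
      linarith
  have cg : ContDiff ℝ ∞ (fun x => g x + (-(3/4))) := hg.add contDiff_const
  have cL : ContDiff ℝ ∞ (fun x => L * (g x + (-(3/4)))) := contDiff_const.mul cg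
  have hL0 : 0 ≤ L := by linarith
  have hHg : ∀ x ξ, Hs (fun x => g x + (-(3/4))) x ξ = Hs g x ξ := by
    intro x ξ
    rw [Hs_add hg contDiff_const]
    simp [Hs, pd]
  have hHh : ∀ x ξ, Real.exp (L * (g x + (-(3/4)))) * (L * (σ * ∑ j, ξ j ^ 2)) ≤
      Hs (fun x => Real.exp (L * (g x + (-(3/4))))) x ξ := by
    intro x ξ
    rw [Hs_exp cL, Hs_const_mul cg, hHg]
    refine mul_le_mul_of_nonneg_left ?_ (Real.exp_pos _).le
    have := mul_le_mul_of_nonneg_left (hgH x ξ) hL0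
    nlinarith [sq_nonneg (∑ k, pd k (fun x => L * (g x + (-(3/4)))) x * ξ k)]
  have hbig : ∀ x, x ∉ V → L / 4 ≤ L * (g x + (-(3/4))) := fun x hx => by nlinarith [hgV x hx]
  refine ⟨fun x => θ x * φ x + Real.exp (L * (g x + (-(3/4)))), hψ.1.add cL.exp, fun x ξ => ?_, fun x hx => ?_,
    fun x hx => ?_, fun x k hx => ?_⟩
  · rw [Hs_add hψ.1 cL.exp]
    have hS : 0 ≤ ∑ j, ξ j ^ 2 := Finset.sum_nonneg fun _ _ => sq_nonneg _
    by_cases hx : x ∈ tsupport χ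
    · have h1 : Hs (fun x => θ x * φ x) x ξ = Hs φ x ξ := Hs_congr (by
        filter_upwards [hθ1 x hx] with y hy
        rw [hy, one_mul]) ξ
      rw [h1]
      have h2 := hH x (hχΩ hx) ξ
      have h3 : 0 ≤ Real.exp (L * (g x + (-(3/4)))) * (L * (σ * ∑ j, ξ j ^ 2)) := by positivity
      linarith [hHh x ξ]
    · have hxV : x ∉ V := fun h => hx (hVs h)
      have h1 : 1 ≤ Real.exp (L * (g x + (-(3/4)))) := Real.one_le_exp (by linarith [hbig x hxV])
      have h2 : L * σ * ∑ j, ξ j ^ 2 ≤ Real.exp (L * (g x + (-(3/4)))) * (L * (σ * ∑ j, ξ j ^ 2)) := by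
        rw [← mul_assoc L]; exact le_mul_of_one_le_left (by positivity) h1
      have h3 := mul_le_mul_of_nonneg_right hLC hS
      linarith [hHh x ξ, hC x ξ]
  · have : θ x = 1 := (hθ1 x hx).self_of_nhds
    simp only [this]; linarith [Real.exp_pos (L * (g x + (-(3/4))))]
  · have : θ x = 1 := (hθ1 x (hVs (hKV hx))).self_of_nhds
    simp only [this]
    have h1 : Real.exp (L * (g x + (-(3/4)))) ≤ Real.exp (-1) := Real.exp_le_exp.2 (by nlinarith [hgK x hx])
    have h2 : Real.exp (-1) ≤ 1 / 2 := by
      rw [Real.exp_neg, one_div]; exact inv_anti₀ two_pos (by linarith [Real.add_one_le_exp (1:ℝ)])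
    linarith
  · have hxV : x ∉ V := fun h => hx (by rw [pd_congr (hχ1 x h) k]; simp [pd])
    have hxs : x ∈ tsupport χ := tsupport_pd_subset χ k (subset_tsupport _ hx)
    have : θ x = 1 := (hθ1 x hxs).self_of_nhds
    simp only [this]
    refine le_trans (Real.exp_le_exp.2 ?_) hLε
    have h1 := hbig x hxV
    have h2 := Real.add_one_le_exp (L * (g x + (-(3/4))))
    have h3 := hφ0 x (hχΩ hxs)
    linarith
end Weights
end Part13

section Part14
open Complex MeasureTheory Set Filter Topology
open scoped ENNReal NNReal ContDiff Convolution ComplexConjugate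

section WeakC
variable {N : ℕ} {φ : EuclideanSpace ℝ (Fin N) → ℝ}
variable {E0 : Type} [NormedAddCommGroup E0] [InnerProductSpace ℂ E0] [NormedSpace ℝ E0]
  [IsScalarTower ℝ ℂ E0] [FiniteDimensional ℂ E0]
variable {E1 : Type} [NormedAddCommGroup E1] [InnerProductSpace ℂ E1] [NormedSpace ℝ E1]
  [IsScalarTower ℝ ℂ E1] [FiniteDimensional ℂ E1]
variable {E0' : Type} [NormedAddCommGroup E0'] [InnerProductSpace ℂ E0'] [NormedSpace ℝ E0']
  [IsScalarTower ℝ ℂ E0'] [FiniteDimensional ℂ E0']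
variable {E1' : Type} [NormedAddCommGroup E1'] [InnerProductSpace ℂ E1'] [NormedSpace ℝ E1']
  [IsScalarTower ℝ ℂ E1'] [FiniteDimensional ℂ E1']

lemma opW_push {σ : Fin N → E0 →L[ℂ] E1} {σ' : Fin N → E0' →L[ℂ] E1'} (A : E0 →L[ℂ] E0') (A' : E1 →L[ℂ] E1')
    (hA : ∀ k x, σ' k (A x) = A' (σ k x)) {v : EuclideanSpace ℝ (Fin N) → E0} {g : EuclideanSpace ℝ (Fin N) → E1}
    (hv : LocallyIntegrable v) (hg : LocallyIntegrable g)
    (h : opW (fun k => rs (σ k)) (fun _ => rs 0) v g) :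
    opW (fun k => rs (σ' k)) (fun _ => rs 0) (fun x => A (v x)) (fun x => A' (g x)) := by
  have c0 := FiniteDimensional.complete ℂ E0
  have c1 := FiniteDimensional.complete ℂ E1
  have c1' := FiniteDimensional.complete ℂ E1'
  intro η hη
  have h1 := congrArg (rs A') (h η hη)
  have i1 : Integrable (fun x => η x • g x) := hg.integrable_smul_left_of_hasCompactSupport hη.continuous hη.2
  rw [← ContinuousLinearMap.integral_comp_comm _ i1,
    ← ContinuousLinearMap.integral_comp_comm _ (opW_int3 (fun k => rs (σ k)) (B := fun _ => rs 0) continuous_const hv hη)] at h1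
  simp only [map_smul, map_sub, map_sum] at h1
  simp only [rs_apply, hA, ContinuousLinearMap.zero_apply, map_zero] at h1 ⊢
  exact h1

/-- complex test functions -/
lemma weakC {σ : Fin N → E0 →L[ℂ] E1} (Λ : E1 →L[ℂ] ℂ)
    {v : EuclideanSpace ℝ (Fin N) → E0} {g : EuclideanSpace ℝ (Fin N) → E1}
    (hv : LocallyIntegrable v) (hg : LocallyIntegrable g)
    (h : opW (fun k => rs (σ k)) (fun _ => rs 0) v g) {χ : EuclideanSpace ℝ (Fin N) → ℂ} (hχ : IsT χ) :
    ∫ x, χ x * Λ (g x) = - ∫ x, ∑ k, pd k χ x * Λ (σ k (v x)) := by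
  have c0 := FiniteDimensional.complete ℂ E0
  have c1 := FiniteDimensional.complete ℂ E1
  have key : ∀ η : EuclideanSpace ℝ (Fin N) → ℝ, IsT η →
      Integrable (fun x => (η x : ℂ) * Λ (g x)) ∧
      (∀ k, Integrable fun x => ((pd k η x : ℝ) : ℂ) * Λ (σ k (v x))) ∧
      ∫ x, (η x : ℂ) * Λ (g x) = - ∫ x, ∑ k, ((pd k η x : ℝ) : ℂ) * Λ (σ k (v x)) := by
    intro η hη
    have hg' := locInt_clm (B := fun _ => rs Λ) continuous_const hg
    have hv' : ∀ k, LocallyIntegrable (fun x => Λ (σ k (v x))) := fun k =>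
      locInt_clm (B := fun _ => rs (Λ.comp (σ k))) continuous_const hv
    refine ⟨?_, fun k => ?_, ?_⟩
    · exact hg'.integrable_smul_left_of_hasCompactSupport hη.continuous hη.2
    · exact (hv' k).integrable_smul_left_of_hasCompactSupport (isT_pd hη k).continuous (isT_pd hη k).2
    · have h1 := congrArg (rs Λ) (h η hη)
      have i1 : Integrable (fun x => η x • g x) := hg.integrable_smul_left_of_hasCompactSupport hη.continuous hη.2
      rw [← ContinuousLinearMap.integral_comp_comm _ i1,
        ← ContinuousLinearMap.integral_comp_comm _ (opW_int3 (fun k => rs (σ k)) (B := fun _ => rs 0) continuous_const hv hη)] at h1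
      simp only [map_smul, map_sub, map_sum] at h1
      simp only [rs_apply, ContinuousLinearMap.zero_apply, map_zero, Complex.real_smul, mul_zero, zero_sub] at h1
      rw [h1, integral_neg]
  have hre : IsT (fun x => (χ x).re) := ⟨Complex.reCLM.contDiff.comp hχ.1, hχ.2.comp_left rfl⟩
  have him : IsT (fun x => (χ x).im) := ⟨Complex.imCLM.contDiff.comp hχ.1, hχ.2.comp_left rfl⟩
  obtain ⟨a1, a2, a3⟩ := key _ hre
  obtain ⟨b1, b2, b3⟩ := key _ him
  have pre : ∀ k x, pd k (fun x => (χ x).re) x = (pd k χ x).re := fun k x => pd_clm hχ.1 Complex.reCLM k x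
  have pim : ∀ k x, pd k (fun x => (χ x).im) x = (pd k χ x).im := fun k x => pd_clm hχ.1 Complex.imCLM k x
  have e1 : ∀ x, χ x * Λ (g x) = ((χ x).re : ℂ) * Λ (g x) + Complex.I * (((χ x).im : ℂ) * Λ (g x)) := by
    intro x; conv_lhs => rw [← Complex.re_add_im (χ x)]
    ring
  have e2 : ∀ x, ∑ k, pd k χ x * Λ (σ k (v x)) = ∑ k, ((pd k (fun x => (χ x).re) x : ℝ) : ℂ) * Λ (σ k (v x)) +
      Complex.I * ∑ k, ((pd k (fun x => (χ x).im) x : ℝ) : ℂ) * Λ (σ k (v x)) := by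
    intro x
    rw [Finset.mul_sum, ← Finset.sum_add_distrib]
    refine Finset.sum_congr rfl fun k _ => ?_
    rw [pre, pim]
    conv_lhs => rw [← Complex.re_add_im (pd k χ x)]
    ring
  simp only [e1, e2]
  rw [integral_add a1 (b1.const_mul _), integral_const_mul, a3, b3,
    integral_add (integrable_finsetSum _ fun k _ => a2 k) ((integrable_finsetSum _ fun k _ => b2 k).const_mul _),
    integral_const_mul]
  ring

/-- Cauchy-Schwarz -/
lemma cs_wm (hφ : Continuous φ) {h τ : EuclideanSpace ℝ (Fin N) → ℂ} (hh : MemLp h 2 (wm φ)) (hτ : Continuous τ)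
    (hc : HasCompactSupport τ) : ‖∫ x, h x * τ x‖ ≤ √(∫ x, ‖h x‖ ^ 2 ∂(wm φ)) * √(∫ x, ‖τ x‖ ^ 2 * Real.exp (φ x)) := by
  let κ : EuclideanSpace ℝ (Fin N) → ℂ := fun x => conj ((Real.exp (φ x) : ℂ) * τ x)
  have hκc : Continuous κ := by
    refine Complex.continuous_conj.comp (Continuous.mul ?_ hτ)
    exact Complex.continuous_ofReal.comp (Real.continuous_exp.comp hφ)
  have hκs : HasCompactSupport κ := HasCompactSupport.intro hc fun x hx => by
    simp [κ, image_eq_zero_of_notMem_tsupport hx]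
  have hκ : MemLp κ 2 (wm φ) := IsT.memLp hφ hκc hκs
  have e1 : inner ℂ (hκ.toLp κ) (hh.toLp h) = ∫ x, h x * τ x := by
    rw [inner_toLp_left]
    have : ∫ x, inner ℂ (κ x) ((hh.toLp h) x) ∂(wm φ) = ∫ x, inner ℂ (κ x) (h x) ∂(wm φ) := by
      refine integral_congr_ae ?_
      filter_upwards [hh.coeFn_toLp] with x hx
      rw [hx]
    rw [this, integral_wm hφ]
    congr 1
    ext x
    simp only [κ, RCLike.inner_apply, Complex.conj_conj, Complex.real_smul]
    have : (Real.exp (-φ x) : ℂ) * (Real.exp (φ x) : ℂ) = 1 := by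
      rw [← Complex.ofReal_mul, ← Real.exp_add]; simp
    linear_combination h x * τ x * this
  rw [← e1]
  refine (norm_inner_le_norm _ _).trans (le_of_eq ?_)
  rw [mul_comm, ← Real.sqrt_sq (norm_nonneg (hh.toLp h)), ← Real.sqrt_sq (norm_nonneg (hκ.toLp κ)), normsq_toLp, normsq_toLp]
  congr 2
  rw [integral_wm hφ]
  congr 1
  ext x
  have : Real.exp (-φ x) * Real.exp (φ x) = 1 := by rw [← Real.exp_add]; simp
  simp only [κ, RCLike.norm_conj, norm_mul, Complex.norm_real, Real.norm_eq_abs, Real.abs_exp, smul_eq_mul]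
  linear_combination ‖τ x‖ ^ 2 * Real.exp (φ x) * this

lemma normsq_Lp (v : Lp E0 2 (wm φ)) : ‖v‖ ^ 2 = ∫ x, ‖v x‖ ^ 2 ∂(wm φ) := by
  rw [← normsq_toLp (Lp.memLp v), Lp.toLp_coeFn]

lemma int_Lp (v : Lp E0 2 (wm φ)) : Integrable (fun x => ‖v x‖ ^ 2) (wm φ) :=
  (Lp.memLp v).integrable_norm_pow two_ne_zero
end WeakC

section Comp
variable {N : ℕ} {P : Type} [Fintype P] [DecidableEq P]

lemma weak_s1 (m : P → Fin N → ℂ) {v : EuclideanSpace ℝ (Fin N) → EuclideanSpace ℂ Unit}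
    {g : EuclideanSpace ℝ (Fin N) → EuclideanSpace ℂ P}
    (hv : LocallyIntegrable v) (hg : LocallyIntegrable g)
    (h : opW (fun k => rs (s1 m k)) (fun _ => rs 0) v g) {χ : EuclideanSpace ℝ (Fin N) → ℂ} (hχ : IsT χ) (p : P) :
    ∫ x, χ x * g x p = - ∫ x, Dm m p χ x * v x () := by
  have := weakC (EuclideanSpace.proj (𝕜 := ℂ) p) hv hg h hχ
  refine this.trans ?_
  congr 2
  ext x
  have e : ∀ k, (EuclideanSpace.proj (𝕜 := ℂ) p) (s1 m k (v x)) = m p k * v x () := fun _ => rfl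
  simp only [e, Dm, Finset.sum_mul]
  refine Finset.sum_congr rfl fun k _ => by ring

lemma weak_s2 (m : P → Fin N → ℂ) {v : EuclideanSpace ℝ (Fin N) → EuclideanSpace ℂ P}
    {g : EuclideanSpace ℝ (Fin N) → EuclideanSpace ℂ (P × P)}
    (hv : LocallyIntegrable v) (hg : LocallyIntegrable g)
    (h : opW (fun k => rs (s2 m k)) (fun _ => rs 0) v g) {χ : EuclideanSpace ℝ (Fin N) → ℂ} (hχ : IsT χ) (p q : P) :
    ∫ x, χ x * g x (p, q) = - ∫ x, (Dm m p χ x * v x q - Dm m q χ x * v x p) := by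
  have := weakC (EuclideanSpace.proj (𝕜 := ℂ) (p, q)) hv hg h hχ
  refine this.trans ?_
  congr 2
  ext x
  have e : ∀ k, (EuclideanSpace.proj (𝕜 := ℂ) (p, q)) (s2 m k (v x)) = m p k * v x q - m q k * v x p := fun _ => rfl
  simp only [e, Dm, Finset.sum_mul, ← Finset.sum_sub_distrib]
  refine Finset.sum_congr rfl fun k _ => by ring

end Comp
end Part14

section Part15
open Complex MeasureTheory Set Filter Topology
open scoped ENNReal NNReal ContDiff Convolution ComplexConjugate

section Half
variable {ι0 ι1 : Type} [Fintype ι0] [Fintype ι1]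

/-- pull back of coordinates -/
noncomputable def pull (e : ι1 → ι0) : EuclideanSpace ℂ ι0 →L[ℂ] EuclideanSpace ℂ ι1 :=
  mkC (fun v i => v (e i)) (fun _ _ _ => rfl) (fun _ _ _ => rfl)

lemma pull_apply (e : ι1 → ι0) (v i) : pull e v i = v (e i) := rfl

lemma pull_normsq (e : ι1 → ι0) (v) : ‖pull e v‖ ^ 2 = ∑ i, ‖v (e i)‖ ^ 2 := by
  rw [EuclideanSpace.norm_sq_eq]; rfl

lemma pull_norm_le (e : ι1 → ι0) (he : Function.Injective e) (v) : ‖pull e v‖ ^ 2 ≤ ‖v‖ ^ 2 := by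
  classical
  rw [pull_normsq, EuclideanSpace.norm_sq_eq]
  rw [← Finset.sum_image (s := Finset.univ) (g := e) (f := fun p => ‖v p‖ ^ 2) (fun a _ b _ h => he h)]
  exact Finset.sum_le_sum_of_subset_of_nonneg (Finset.subset_univ _) fun _ _ _ => by positivity

variable {N : ℕ} {φ : EuclideanSpace ℝ (Fin N) → ℝ}
variable {P I : Type} [Fintype P] [DecidableEq P] [Fintype I] [DecidableEq I]

lemma memLp_comp {v : EuclideanSpace ℝ (Fin N) → EuclideanSpace ℂ ι0} {μ : Measure (EuclideanSpace ℝ (Fin N))}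
    (hv : MemLp v 2 μ) (p : ι0) : MemLp (fun x => v x p) 2 μ :=
  (EuclideanSpace.proj (𝕜 := ℂ) p).comp_memLp' hv

lemma comp_sq_le (v : EuclideanSpace ℂ ι0) (p : ι0) : ‖v p‖ ^ 2 ≤ ‖v‖ ^ 2 := by
  rw [EuclideanSpace.norm_sq_eq]
  exact Finset.single_le_sum (f := fun p => ‖v p‖ ^ 2) (fun _ _ => by positivity) (Finset.mem_univ p)

lemma int_mul_isT (hφ : Continuous φ) {h χ : EuclideanSpace ℝ (Fin N) → ℂ} (hh : MemLp h 2 (wm φ)) (hχ : IsT χ) :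
    Integrable fun x => χ x * h x :=
  (locInt_of_wm hφ hh).integrable_smul_left_of_hasCompactSupport hχ.continuous hχ.2

lemma half (hφ : ContDiff ℝ ∞ φ) {c : ℝ} (hc : 0 < c)
    (hH : ∀ x, ∀ ξ : Fin N → ℝ, ∑ j, ∑ k, pd j (fun y => pd k φ y) x * ξ j * ξ k ≥ c * ∑ j, ξ j ^ 2)
    (m : P → Fin N → ℂ) (e : I → P) (he : Function.Injective e)
    (hm : ∀ p q, ∑ k, m (e p) k * conj (m (e q) k) = if p = q then 1 / 2 else 0)
    (v : Lp (EuclideanSpace ℂ P) 2 (wm φ)) (g F : Lp (EuclideanSpace ℂ (P × P)) 2 (wm φ))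
    (hg : opW (fun k => rs (s2 m k)) (fun _ => rs 0) v g)
    (hF : ∀ᵐ x, ∀ i i' : I, F x (e i, e i') = 0) :
    ∃ (D : Lp (EuclideanSpace ℂ I) 2 (wm φ)) (u : Lp (EuclideanSpace ℂ Unit) 2 (wm φ)),
      (∀ (χ : EuclideanSpace ℝ (Fin N) → ℂ) (i : I), IsT χ →
        ∫ x, χ x * v x (e i) = (- ∫ x, Dm m (e i) χ x * u x ()) + ∫ x, χ x * D x i) ∧
      c / 2 * ‖u‖ ^ 2 ≤ ∫ x, ∑ i, ‖v x (e i)‖ ^ 2 ∂(wm φ) ∧ c * ‖D‖ ^ 2 ≤ ‖F - g‖ ^ 2 := by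
  have hφc := hφ.continuous
  let A := pull e
  let e2 : I × I → P × P := fun i => (e i.1, e i.2)
  have he2 : Function.Injective e2 := he.prodMap he
  let A' := pull e2
  let a := A.compLp v
  let γ := A'.compLp g
  have ha : a =ᵐ[volume] fun x => A (v x) := (ac_wm hφc).ae_le (A.coeFn_compLp v)
  have hγ : γ =ᵐ[volume] fun x => A' (g x) := (ac_wm hφc).ae_le (A'.coeFn_compLp g)
  have h1 : opW (fun k => rs (s2 (fun i => m (e i)) k)) (fun _ => rs 0) a γ := by
    refine opW_congr ha.symm hγ.symm (opW_push (σ := s2 m) A A' (fun k x => ?_) (locInt_of_wm hφc (Lp.memLp v))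
      (locInt_of_wm hφc (Lp.memLp g)) hg)
    ext ⟨i, i'⟩
    rfl
  obtain ⟨a', u, b1, b2, b3, b4⟩ := solve1 hφ hc hH (fun i => m (e i)) hm a γ h1
  have na : ‖a‖ ^ 2 = ∫ x, ∑ i, ‖v x (e i)‖ ^ 2 ∂(wm φ) := by
    rw [normsq_Lp]
    refine integral_congr_ae ?_
    filter_upwards [A.coeFn_compLp v] with x hx
    simp only [a, hx, A, pull_normsq]
  have nγ : ‖γ‖ ^ 2 ≤ ‖F - g‖ ^ 2 := by
    rw [normsq_Lp, normsq_Lp]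
    refine integral_mono_ae (int_Lp _) (int_Lp _) ?_
    filter_upwards [A'.coeFn_compLp g, Lp.coeFn_sub F g, wm_ac.ae_le hF] with x h1 h2 h3
    simp only [γ, h1, h2]
    refine le_trans (le_of_eq ?_) (pull_norm_le e2 he2 _)
    rw [pull_normsq, pull_normsq]
    refine Finset.sum_congr rfl fun i _ => ?_
    simp [e2, h3]
  refine ⟨a - a', u, fun χ i hχ => ?_, ?_, ?_⟩
  · have hw := weak_s1 (fun i => m (e i)) (locInt_of_wm hφc (Lp.memLp u)) (locInt_of_wm hφc (Lp.memLp a')) b1 hχ i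
    have hw : ∫ x, χ x * a' x i = - ∫ x, Dm m (e i) χ x * u x () := hw
    rw [← hw, ← integral_add (int_mul_isT hφc (memLp_comp (Lp.memLp a') i) hχ)
      (int_mul_isT hφc (memLp_comp (Lp.memLp (a - a')) i) hχ)]
    refine integral_congr_ae ?_
    filter_upwards [ha, (ac_wm hφc).ae_le (Lp.coeFn_sub a a')] with x h1 h2
    have : v x (e i) = a x i := by rw [h1]; rfl
    rw [h2, this]
    simp only [Pi.sub_apply, PiLp.sub_apply]
    ring
  · refine b2.trans ?_
    rw [← na]
    gcongr
  · nlinarith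
end Half
end Part15

section Part16
open Complex MeasureTheory Set Filter Topology
open scoped ENNReal NNReal ContDiff Convolution ComplexConjugate

section MainPhi
variable {N : ℕ} {φ : EuclideanSpace ℝ (Fin N) → ℝ}
variable {P I : Type} [Fintype P] [DecidableEq P] [Fintype I] [DecidableEq I]

lemma pd_sum {ι : Type} (s : Finset ι) {f : ι → EuclideanSpace ℝ (Fin N) → ℂ} (hf : ∀ i, ContDiff ℝ ∞ (f i)) (k : Fin N) (x) :
    pd k (fun y => ∑ i ∈ s, f i y) x = ∑ i ∈ s, pd k (f i) x := by
  unfold pd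
  rw [fderiv_fun_sum (fun i _ => ((hf i).differentiable (by simp)).differentiableAt)]
  simp

lemma pd_cmul {f : EuclideanSpace ℝ (Fin N) → ℂ} (hf : ContDiff ℝ ∞ f) (a : ℂ) (k : Fin N) (x) :
    pd k (fun y => a * f y) x = a * pd k f x := by
  unfold pd
  rw [fderiv_const_mul ((hf.differentiable (by simp)).differentiableAt)]
  simp

lemma Dm_Dm (m : P → Fin N → ℂ) (p q : P) {f : EuclideanSpace ℝ (Fin N) → ℂ} (hf : ContDiff ℝ ∞ f) (x) :
    Dm m p (fun y => Dm m q f y) x = ∑ k, ∑ l, m p k * (m q l * pd k (fun y => pd l f y) x) := by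
  unfold Dm
  refine Finset.sum_congr rfl fun k _ => ?_
  rw [pd_sum Finset.univ (fun l => contDiff_const.mul (contDiff_pd hf l)), Finset.mul_sum]
  refine Finset.sum_congr rfl fun l _ => ?_
  rw [pd_cmul (contDiff_pd hf l)]

lemma Dm_comm (m : P → Fin N → ℂ) (p q : P) {f : EuclideanSpace ℝ (Fin N) → ℂ} (hf : ContDiff ℝ ∞ f) (x) :
    Dm m p (fun y => Dm m q f y) x = Dm m q (fun y => Dm m p f y) x := by
  rw [Dm_Dm m p q hf, Dm_Dm m q p hf, Finset.sum_comm]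
  refine Finset.sum_congr rfl fun k _ => Finset.sum_congr rfl fun l _ => ?_
  rw [pd_comm hf]; ring

set_option maxHeartbeats 1000000 in
lemma mainPhi (hφ : ContDiff ℝ ∞ φ) {c : ℝ} (hc : 0 < c)
    (hH : ∀ x, ∀ ξ : Fin N → ℝ, ∑ j, ∑ k, pd j (fun y => pd k φ y) x * ξ j * ξ k ≥ c * ∑ j, ξ j ^ 2)
    (m : I ⊕ I → Fin N → ℂ)
    (hm : ∀ p q, ∑ k, m p k * conj (m q k) = if p = q then 1 / 2 else 0)
    (F : Lp (EuclideanSpace ℂ ((I ⊕ I) × (I ⊕ I))) 2 (wm φ))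
    (Γ : Lp (EuclideanSpace ℂ (((I ⊕ I) × (I ⊕ I) × (I ⊕ I)) ⊕ ((I ⊕ I) × (I ⊕ I)))) 2 (wm φ))
    (hg : opW (fun k => rs (t3 m k)) (fun _ => rs z3) F Γ)
    (hF1 : ∀ᵐ x, ∀ i i' : I, F x (Sum.inl i, Sum.inl i') = 0)
    (hF2 : ∀ᵐ x, ∀ i i' : I, F x (Sum.inr i, Sum.inr i') = 0) :
    ∃ (u : EuclideanSpace ℝ (Fin N) → ℂ) (R : I → I → EuclideanSpace ℝ (Fin N) → ℂ)
      (D1 D2 : I → EuclideanSpace ℝ (Fin N) → ℂ),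
      MemLp u 2 (wm φ) ∧ (∀ i j, MemLp (R i j) 2 (wm φ)) ∧ (∀ i, MemLp (D1 i) 2 (wm φ)) ∧ (∀ i, MemLp (D2 i) 2 (wm φ)) ∧
      ∫ x, ‖u x‖ ^ 2 ∂(wm φ) ≤ 2 / c ^ 2 * ‖F‖ ^ 2 ∧
      (∀ i j, ∫ x, ‖R i j x‖ ^ 2 ∂(wm φ) ≤ ((1 + c) / (2 * c) + (1 + c) / (2 * c ^ 2)) * ‖Γ‖ ^ 2) ∧
      (∀ i, ∫ x, ‖D1 i x‖ ^ 2 ∂(wm φ) ≤ ((1 + c) / (2 * c) + (1 + c) / (2 * c ^ 2)) * ‖Γ‖ ^ 2) ∧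
      (∀ i, ∫ x, ‖D2 i x‖ ^ 2 ∂(wm φ) ≤ ((1 + c) / (2 * c) + (1 + c) / (2 * c ^ 2)) * ‖Γ‖ ^ 2) ∧
      ∀ (i j : I) (α : EuclideanSpace ℝ (Fin N) → ℂ), IsT α →
        ∫ x, F x (Sum.inl i, Sum.inr j) * α x =
          (∫ x, u x * Dm m (Sum.inl i) (fun y => Dm m (Sum.inr j) α y) x) + (∫ x, R i j x * α x)
          + (∫ x, D2 j x * Dm m (Sum.inl i) α x) + (∫ x, D1 i x * Dm m (Sum.inr j) α x) := by
  have hφc := hφ.continuous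
  obtain ⟨g, v, h1, h2, h3, h4⟩ := solve2 hφ hc hH m hm F Γ hg
  obtain ⟨D1, u1, a1, a2, a3⟩ := half hφ hc hH m Sum.inl Sum.inl_injective (fun p q => by
    rw [hm]; simp) v g F h1 hF1
  obtain ⟨D2, u2, b1, b2, b3⟩ := half hφ hc hH m Sum.inr Sum.inr_injective (fun p q => by
    rw [hm]; simp) v g F h1 hF2
  have hR : ‖F - g‖ ^ 2 ≤ (1 + c) / (2 * c) * ‖Γ‖ ^ 2 := by
    rw [div_mul_eq_mul_div, le_div_iff₀ (by positivity)]; linarith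
  have hR' : ‖F - g‖ ^ 2 / c ≤ (1 + c) / (2 * c ^ 2) * ‖Γ‖ ^ 2 := by
    calc _ ≤ ((1 + c) / (2 * c) * ‖Γ‖ ^ 2) / c := by gcongr
      _ = _ := by field_simp
  have nn1 : 0 ≤ (1 + c) / (2 * c) * ‖Γ‖ ^ 2 := by positivity
  have nn2 : 0 ≤ (1 + c) / (2 * c ^ 2) * ‖Γ‖ ^ 2 := by positivity
  have hcomp : ∀ {J : Type} [Fintype J] (D : Lp (EuclideanSpace ℂ J) 2 (wm φ)) (j : J),
      ∫ x, ‖D x j‖ ^ 2 ∂(wm φ) ≤ ‖D‖ ^ 2 := by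
    intro J _ D j
    rw [normsq_Lp]
    exact integral_mono ((memLp_comp (Lp.memLp D) j).integrable_norm_pow two_ne_zero) (int_Lp _) fun x => comp_sq_le _ _
  have hv : (∫ x, ∑ i, ‖v x (Sum.inl i)‖ ^ 2 ∂(wm φ)) + (∫ x, ∑ i, ‖v x (Sum.inr i)‖ ^ 2 ∂(wm φ)) = ‖v‖ ^ 2 := by
    rw [normsq_Lp, ← integral_add]
    · congr 1
      ext x
      rw [EuclideanSpace.norm_sq_eq, Fintype.sum_sum_type]
    · exact integrable_finsetSum _ fun i _ => (memLp_comp (Lp.memLp v) _).integrable_norm_pow two_ne_zero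
    · exact integrable_finsetSum _ fun i _ => (memLp_comp (Lp.memLp v) _).integrable_norm_pow two_ne_zero
  have mu1 := memLp_comp (Lp.memLp u1) ()
  have mu2 := memLp_comp (Lp.memLp u2) ()
  refine ⟨fun x => u2 x () - u1 x (), fun i j x => (F - g) x (Sum.inl i, Sum.inr j), fun i x => D1 x i,
    fun j x => - D2 x j, mu2.sub mu1, fun i j => memLp_comp (Lp.memLp _) _,
    fun i => memLp_comp (Lp.memLp _) _, fun i => (memLp_comp (Lp.memLp _) _).neg, ?_, ?_, ?_, ?_, ?_⟩
  · have i1 := (mu1.integrable_norm_pow two_ne_zero)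
    have i2 := (mu2.integrable_norm_pow two_ne_zero)
    have k1 := hcomp u1 ()
    have k2 := hcomp u2 ()
    have : ∫ x, ‖u2 x () - u1 x ()‖ ^ 2 ∂(wm φ) ≤ ∫ x, 2 * (‖u2 x ()‖ ^ 2 + ‖u1 x ()‖ ^ 2) ∂(wm φ) := by
      refine integral_mono ((mu2.sub mu1).integrable_norm_pow two_ne_zero) ((i2.add i1).const_mul 2) fun x => ?_
      have := norm_sub_le (u2 x ()) (u1 x ())
      have h0 := norm_nonneg (u2 x () - u1 x ())
      simp only
      nlinarith [sq_nonneg (‖u2 x ()‖ - ‖u1 x ()‖)]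
    refine this.trans ?_
    rw [integral_const_mul, integral_add i2 i1]
    have h3' : ‖g‖ ^ 2 ≤ ‖F‖ ^ 2 := by gcongr
    rw [div_mul_eq_mul_div, le_div_iff₀ (by positivity)]
    have q1 : c * (‖u1‖ ^ 2 + ‖u2‖ ^ 2) ≤ 2 * ‖v‖ ^ 2 := by linarith
    have q2 : c ^ 2 * (‖u1‖ ^ 2 + ‖u2‖ ^ 2) ≤ ‖F‖ ^ 2 := by
      have := mul_le_mul_of_nonneg_left q1 hc.le
      linarith
    have q3 := mul_le_mul_of_nonneg_left (add_le_add k1 k2) (sq_nonneg c)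
    nlinarith
  · intro i j
    exact (hcomp (F - g) _).trans (by rw [add_mul]; linarith)
  · intro i
    refine (hcomp D1 _).trans ?_
    have : ‖D1‖ ^ 2 ≤ ‖F - g‖ ^ 2 / c := by rw [le_div_iff₀ hc]; linarith
    rw [add_mul]; linarith
  · intro i
    simp only [norm_neg]
    refine (hcomp D2 _).trans ?_
    have : ‖D2‖ ^ 2 ≤ ‖F - g‖ ^ 2 / c := by rw [le_div_iff₀ hc]; linarith
    rw [add_mul]; linarith
  · intro i j α hα
    have A1 := Dm_isT m (Sum.inl i) hα
    have A2 := Dm_isT m (Sum.inr j) hα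
    have w0 := weak_s2 m (locInt_of_wm hφc (Lp.memLp v)) (locInt_of_wm hφc (Lp.memLp g)) h1 hα (Sum.inl i) (Sum.inr j)
    rw [integral_sub (int_mul_isT hφc (memLp_comp (Lp.memLp v) _) A1) (int_mul_isT hφc (memLp_comp (Lp.memLp v) _) A2)] at w0
    have w1 := a1 _ i A2
    have w2 := b1 _ j A1
    simp only [Dm_comm m (Sum.inr j) (Sum.inl i) hα.1] at w2
    have A3 := Dm_isT m (Sum.inl i) A2
    have e1 : ∫ x, F x (Sum.inl i, Sum.inr j) * α x = (∫ x, α x * g x (Sum.inl i, Sum.inr j)) +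
        ∫ x, (F - g) x (Sum.inl i, Sum.inr j) * α x := by
      have i2 : Integrable fun x => (F - g) x (Sum.inl i, Sum.inr j) * α x := by
        simpa only [mul_comm] using int_mul_isT hφc (memLp_comp (Lp.memLp (F - g)) (Sum.inl i, Sum.inr j)) hα
      rw [← integral_add (int_mul_isT hφc (memLp_comp (Lp.memLp g) _) hα) i2]
      refine integral_congr_ae ?_
      filter_upwards [(ac_wm hφc).ae_le (Lp.coeFn_sub F g)] with x hx
      rw [hx]
      simp only [Pi.sub_apply, PiLp.sub_apply]
      ring
    have e2 : ∫ x, (u2 x () - u1 x ()) * Dm m (Sum.inl i) (fun y => Dm m (Sum.inr j) α y) x =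
        (∫ x, Dm m (Sum.inl i) (fun y => Dm m (Sum.inr j) α y) x * u2 x ()) -
        ∫ x, Dm m (Sum.inl i) (fun y => Dm m (Sum.inr j) α y) x * u1 x () := by
      rw [← integral_sub (int_mul_isT hφc mu2 A3) (int_mul_isT hφc mu1 A3)]
      congr 1; ext x; ring
    have e3 : ∫ x, -D2 x j * Dm m (Sum.inl i) α x = - ∫ x, Dm m (Sum.inl i) α x * D2 x j := by
      rw [← integral_neg]; congr 1; ext x; ring
    have e4 : ∫ x, D1 x i * Dm m (Sum.inr j) α x = ∫ x, Dm m (Sum.inr j) α x * D1 x i := by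
      congr 1; ext x; ring
    rw [e1, e2, e3, e4, w0, w1, w2]
    ring
end MainPhi
end Part16

section Part17
open Complex MeasureTheory Set Filter Topology
open scoped ENNReal NNReal ContDiff Convolution ComplexConjugate

section Coef
variable {n : ℕ}

/-- coefficients of the Wirtinger derivatives -/
noncomputable def mw {n : ℕ} : Fin n ⊕ Fin n → Fin (2 * n) → ℂ
  | Sum.inl i, k => (if k = idx1 i then 1 / 2 else 0) + (if k = idx2 i then - (1 / 2 * I) else 0)
  | Sum.inr i, k => (if k = idx1 i then 1 / 2 else 0) + (if k = idx2 i then 1 / 2 * I else 0)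

lemma idx11 (i j : Fin n) : idx1 i = idx1 j ↔ i = j := by simp [idx1, Fin.ext_iff]
lemma idx22 (i j : Fin n) : idx2 i = idx2 j ↔ i = j := by simp [idx2, Fin.ext_iff]
lemma idx12 (i j : Fin n) : idx1 i ≠ idx2 j := by
  have := i.2
  simp only [idx1, idx2, ne_eq, Fin.mk.injEq]; omega

lemma mw_inl (i : Fin n) (G : Fin (2 * n) → ℂ) :
    ∑ k, mw (Sum.inl i) k * G k = 1 / 2 * (G (idx1 i) - I * G (idx2 i)) := by
  simp only [mw, add_mul, Finset.sum_add_distrib, ite_mul, zero_mul, Finset.sum_ite_eq', Finset.mem_univ, if_true]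
  ring

lemma mw_inr (i : Fin n) (G : Fin (2 * n) → ℂ) :
    ∑ k, mw (Sum.inr i) k * G k = 1 / 2 * (G (idx1 i) + I * G (idx2 i)) := by
  simp only [mw, add_mul, Finset.sum_add_distrib, ite_mul, zero_mul, Finset.sum_ite_eq', Finset.mem_univ, if_true]
  ring

lemma Dm_inl (i : Fin n) (f) : Dm mw (Sum.inl i) f = wz i f := by
  ext x; exact mw_inl i fun k => pd k f x

lemma Dm_inr (i : Fin n) (f) : Dm mw (Sum.inr i) f = wzbar i f := by
  ext x; exact mw_inr i fun k => pd k f x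

lemma mw_gram (p q : Fin n ⊕ Fin n) : ∑ k, mw p k * conj (mw q k) = if p = q then 1 / 2 else 0 := by
  have h2 : conj (2 : ℂ) = 2 := map_ofNat _ 2
  rcases p with i | i <;> rcases q with j | j
  · rw [mw_inl i (fun k => conj (mw (Sum.inl j) k))]
    by_cases h : i = j
    · subst h
      simp [mw, idx11, idx22, idx12, (idx12 _ _).symm]
      ring_nf; simp [h2]; norm_num
    · simp [mw, idx11, idx22, idx12, (idx12 _ _).symm, h]
  · rw [mw_inl i (fun k => conj (mw (Sum.inr j) k))]
    by_cases h : i = j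
    · subst h
      simp [mw, idx11, idx22, idx12, (idx12 _ _).symm]
      ring_nf; simp
    · simp [mw, idx11, idx22, idx12, (idx12 _ _).symm, h]
  · rw [mw_inr i (fun k => conj (mw (Sum.inl j) k))]
    by_cases h : i = j
    · subst h
      simp [mw, idx11, idx22, idx12, (idx12 _ _).symm]
      ring_nf; simp
    · simp [mw, idx11, idx22, idx12, (idx12 _ _).symm, h]
  · rw [mw_inr i (fun k => conj (mw (Sum.inr j) k))]
    by_cases h : i = j
    · subst h
      simp [mw, idx11, idx22, idx12, (idx12 _ _).symm]
      ring_nf; simp [h2]; norm_num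
    · simp [mw, idx11, idx22, idx12, (idx12 _ _).symm, h]
end Coef
end Part17

section Part18
open Complex MeasureTheory Set Filter Topology
open scoped ENNReal NNReal ContDiff Convolution ComplexConjugate

section FF
variable {n : ℕ}

/-- components of the antisymmetrised form -/
def ffc (f : Fin n → Fin n → ℂ) : (Fin n ⊕ Fin n) × (Fin n ⊕ Fin n) → ℂ
  | (Sum.inl i, Sum.inr j) => f i j
  | (Sum.inr j, Sum.inl i) => - f i j
  | (Sum.inl _, Sum.inl _) => 0
  | (Sum.inr _, Sum.inr _) => 0

lemma ffc_anti (f : Fin n → Fin n → ℂ) (p q) : ffc f (q, p) = - ffc f (p, q) := by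
  rcases p with i | i <;> rcases q with j | j <;> simp [ffc]

/-- the antisymmetrised form -/
noncomputable def ff (f : Fin n → Fin n → EuclideanSpace ℝ (Fin (2 * n)) → ℂ) (x : EuclideanSpace ℝ (Fin (2 * n))) :
    EuclideanSpace ℂ ((Fin n ⊕ Fin n) × (Fin n ⊕ Fin n)) := WithLp.toLp 2 (ffc fun i j => f i j x)

lemma ff_apply (f : Fin n → Fin n → EuclideanSpace ℝ (Fin (2 * n)) → ℂ) (x) (p) :
    ff f x p = ffc (fun i j => f i j x) p := rfl

lemma ff_normsq (f : Fin n → Fin n → EuclideanSpace ℝ (Fin (2 * n)) → ℂ) (x) :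
    ‖ff f x‖ ^ 2 = 2 * ∑ i, ∑ j, ‖f i j x‖ ^ 2 := by
  rw [EuclideanSpace.norm_sq_eq, Fintype.sum_prod_type]
  simp only [ff_apply, Fintype.sum_sum_type, ffc, norm_zero, norm_neg, ne_eq, OfNat.ofNat_ne_zero, not_false_eq_true,
    zero_pow, Finset.sum_const_zero, zero_add, add_zero]
  rw [Finset.sum_comm (f := fun j i => ‖f i j x‖ ^ 2)]
  ring

variable {f : Fin n → Fin n → EuclideanSpace ℝ (Fin (2 * n)) → ℂ}

lemma ff_memLp {μ : Measure (EuclideanSpace ℝ (Fin (2 * n)))} (hf : ∀ i j, MemLp (f i j) 2 μ) : MemLp (ff f) 2 μ := by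
  refine MemLp.of_eval_piLp fun p => ?_
  rcases p with ⟨i | i, j | j⟩
  · exact MemLp.zero
  · exact hf i j
  · exact (hf j i).neg
  · exact MemLp.zero

lemma ff_closed {Ω : Set (EuclideanSpace ℝ (Fin (2 * n)))} (hf : ∀ i j, MemLp (f i j) 2 volume)
    (hdbarf : ∀ (i j k : Fin n) (χ : EuclideanSpace ℝ (Fin (2 * n)) → ℂ), IsTestFun Ω χ →
      (∫ x, f i j x * wzbar k χ x) = ∫ x, f i k x * wzbar j χ x)
    (hdf : ∀ (i j k : Fin n) (χ : EuclideanSpace ℝ (Fin (2 * n)) → ℂ), IsTestFun Ω χ →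
      (∫ x, f i j x * wz k χ x) = ∫ x, f k j x * wz i χ x)
    {ζ : EuclideanSpace ℝ (Fin (2 * n)) → ℝ} (hζ : IsT ζ) (hζΩ : tsupport ζ ⊆ Ω) :
    ∫ x, ∑ k, pd k ζ x • t3 mw k (ff f x) = 0 := by
  have hl : LocallyIntegrable (ff f) := (ff_memLp hf).locallyIntegrable (by norm_num)
  have i0 : Integrable fun x => ∑ k, pd k ζ x • t3 mw k (ff f x) :=
    integrable_finsetSum _ fun k _ => opW_int2 (rs (t3 mw k)) hl hζ k
  let χ : EuclideanSpace ℝ (Fin (2 * n)) → ℂ := fun x => (ζ x : ℂ)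
  have hχ : IsT χ := ⟨Complex.ofRealCLM.contDiff.comp hζ.1, hζ.2.comp_left Complex.ofReal_zero⟩
  have hχs : IsTestFun Ω χ := ⟨hχ.1, hχ.2, (closure_mono (by
    intro x hx; simp only [χ, Function.mem_support, ne_eq, Complex.ofReal_eq_zero] at hx ⊢; exact hx)).trans hζΩ⟩
  have hpd : ∀ k x, pd k χ x = ((pd k ζ x : ℝ) : ℂ) := fun k x => pd_ofReal hζ.1 k x
  let J : Fin n ⊕ Fin n → Fin n ⊕ Fin n → Fin n ⊕ Fin n → ℂ := fun p q r => ∫ x, Dm mw p χ x * ff f x (q, r)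
  have iJ : ∀ p q r, Integrable fun x => Dm mw p χ x * ff f x (q, r) := by
    intro p q r
    have hp : MemLp (fun x => ff f x (q, r)) 2 volume := memLp_comp (ff_memLp hf) (q, r)
    exact (hp.locallyIntegrable (by norm_num)).integrable_smul_left_of_hasCompactSupport (Dm_isT mw p hχ).continuous (Dm_isT mw p hχ).2
  have j1 : ∀ p q r, J p r q = - J p q r := by
    intro p q r
    simp only [J, ff_apply]
    rw [← integral_neg]
    congr 1; ext x; rw [ffc_anti]; ring
  have j2 : ∀ p i j, J p (Sum.inl i) (Sum.inl j) = 0 := by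
    intro p i j; simp [J, ff_apply, ffc]
  have j3 : ∀ p i j, J p (Sum.inr i) (Sum.inr j) = 0 := by
    intro p i j; simp [J, ff_apply, ffc]
  have j4 : ∀ i j k, J (Sum.inl k) (Sum.inl i) (Sum.inr j) = J (Sum.inl i) (Sum.inl k) (Sum.inr j) := by
    intro i j k
    have := hdf i j k χ hχs
    simp only [J, ff_apply, ffc, Dm_inl]
    simpa only [mul_comm] using this
  have j5 : ∀ i j k, J (Sum.inr k) (Sum.inl i) (Sum.inr j) = J (Sum.inr j) (Sum.inl i) (Sum.inr k) := by
    intro i j k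
    have := hdbarf i j k χ hχs
    simp only [J, ff_apply, ffc, Dm_inr]
    simpa only [mul_comm] using this
  have jj : ∀ p q r, J p q r + J q r p + J r p q = 0 := by
    clear_value J
    intro p q r
    rcases p with i | i <;> rcases q with j | j <;> rcases r with k | k
    · rw [j2, j2, j2]; ring
    · linear_combination j2 (Sum.inr k) i j + j4 j k i + j1 (Sum.inl j) (Sum.inl i) (Sum.inr k)
    · linear_combination j2 (Sum.inr j) k i + j4 i j k + j1 (Sum.inl i) (Sum.inl k) (Sum.inr j)
    · linear_combination j3 (Sum.inl i) j k + j1 (Sum.inr j) (Sum.inl i) (Sum.inr k) + j5 i j k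
    · linear_combination j2 (Sum.inr i) j k + j4 k i j + j1 (Sum.inl k) (Sum.inl j) (Sum.inr i)
    · linear_combination j3 (Sum.inl j) k i + j1 (Sum.inr k) (Sum.inl j) (Sum.inr i) + j5 j k i
    · linear_combination j3 (Sum.inl k) i j + j1 (Sum.inr i) (Sum.inl k) (Sum.inr j) + j5 k i j
    · rw [j3, j3, j3]; ring
  ext s
  have e0 : (∫ x, ∑ k, pd k ζ x • t3 mw k (ff f x)) s = ∫ x, (∑ k, pd k ζ x • t3 mw k (ff f x)) s :=
    ((rs (EuclideanSpace.proj (𝕜 := ℂ) s)).integral_comp_comm i0).symm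
  rw [e0]
  rcases s with ⟨p, q, r⟩ | s
  · have e1 : ∀ x, (∑ k, pd k ζ x • t3 mw k (ff f x)) (Sum.inl (p, q, r)) =
        2 * (Dm mw p χ x * ff f x (q, r)) + 2 * (Dm mw q χ x * ff f x (r, p)) + 2 * (Dm mw r χ x * ff f x (p, q)) := by
      intro x
      have a1 : ff f x (r, q) = - ff f x (q, r) := ffc_anti _ _ _
      have a2 : ff f x (p, r) = - ff f x (r, p) := ffc_anti _ _ _
      have a3 : ff f x (q, p) = - ff f x (p, q) := ffc_anti _ _ _
      simp only [WithLp.ofLp_sum, Finset.sum_apply, PiLp.smul_apply, t3_inl, a1, a2, a3, Complex.real_smul, Dm, hpd,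
        Finset.sum_mul, Finset.mul_sum, ← Finset.sum_add_distrib]
      refine Finset.sum_congr rfl fun k _ => by ring
    simp only [e1]
    have i12 : Integrable fun x => 2 * (Dm mw p χ x * ff f x (q, r)) + 2 * (Dm mw q χ x * ff f x (r, p)) :=
      ((iJ p q r).const_mul 2).add ((iJ q r p).const_mul 2)
    rw [integral_add i12 ((iJ r p q).const_mul 2),
      integral_add ((iJ p q r).const_mul 2) ((iJ q r p).const_mul 2), integral_const_mul, integral_const_mul, integral_const_mul]
    have := jj p q r
    simp only [J] at this
    simp only [PiLp.zero_apply]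
    linear_combination 2 * this
  · have e1 : ∀ x, (∑ k, pd k ζ x • t3 mw k (ff f x)) (Sum.inr s) = 0 := by
      intro x
      simp only [WithLp.ofLp_sum, Finset.sum_apply, PiLp.smul_apply, t3_inr, smul_zero, Finset.sum_const_zero]
    simp only [e1, integral_zero, PiLp.zero_apply]

/-- error term -/
noncomputable def Gam (f : Fin n → Fin n → EuclideanSpace ℝ (Fin (2 * n)) → ℂ) (χ : EuclideanSpace ℝ (Fin (2 * n)) → ℝ)
    (x : EuclideanSpace ℝ (Fin (2 * n))) : EuclideanSpace ℂ (((Fin n ⊕ Fin n) × (Fin n ⊕ Fin n) × (Fin n ⊕ Fin n)) ⊕ ((Fin n ⊕ Fin n) × (Fin n ⊕ Fin n))) :=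
  ∑ k, pd k χ x • t3 mw k (ff f x)

lemma ff_opW {Ω : Set (EuclideanSpace ℝ (Fin (2 * n)))} (hf : ∀ i j, MemLp (f i j) 2 volume)
    (hdbarf : ∀ (i j k : Fin n) (χ : EuclideanSpace ℝ (Fin (2 * n)) → ℂ), IsTestFun Ω χ →
      (∫ x, f i j x * wzbar k χ x) = ∫ x, f i k x * wzbar j χ x)
    (hdf : ∀ (i j k : Fin n) (χ : EuclideanSpace ℝ (Fin (2 * n)) → ℂ), IsTestFun Ω χ →
      (∫ x, f i j x * wz k χ x) = ∫ x, f k j x * wz i χ x)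
    {χ : EuclideanSpace ℝ (Fin (2 * n)) → ℝ} (hχ : IsT χ) (hχΩ : tsupport χ ⊆ Ω) :
    opW (fun k => rs (t3 mw k)) (fun _ => rs z3) (fun x => χ x • ff f x) (Gam f χ) := by
  intro η hη
  have hl : LocallyIntegrable (ff f) := (ff_memLp hf).locallyIntegrable (by norm_num)
  have hζ : IsT (fun x => η x • χ x) := hη.smul_left hχ.1
  have h0 := ff_closed hf hdbarf hdf hζ ((tsupport_smul_subset_right _ _).trans hχΩ)
  have e1 : ∀ x, ∑ k, pd k (fun x => η x • χ x) x • t3 mw k (ff f x) =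
      η x • Gam f χ x - (η x • rs z3 (χ x • ff f x) - ∑ k, pd k η x • rs (t3 mw k) (χ x • ff f x)) := by
    intro x
    have z0 : z3 (ff f x) = 0 := by
      ext s
      rcases s with s | ⟨p, q⟩
      · rfl
      · rw [z3_inr, ff_apply, ff_apply, ffc_anti _ p q]; simp
    rw [map_smul, rs_apply, z0, smul_zero, smul_zero, zero_sub, sub_neg_eq_add, Gam, Finset.smul_sum, ← Finset.sum_add_distrib]
    refine Finset.sum_congr rfl fun k _ => ?_
    rw [pd_smul hη.1 hχ.1, map_smul, rs_apply, add_smul, smul_assoc, smul_assoc, add_comm]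
  simp only [e1] at h0
  have i2 := opW_int3 (fun k => rs (t3 mw k)) (B := fun _ => rs z3) continuous_const
    (α := fun x => χ x • ff f x) (hl.integrable_smul_left_of_hasCompactSupport hχ.continuous hχ.2).locallyIntegrable hη
  have i1 : Integrable fun x => η x • Gam f χ x := by
    have : LocallyIntegrable (Gam f χ) := by
      have := (integrable_finsetSum Finset.univ fun k _ => opW_int2 (rs (t3 mw k)) hl hχ k).locallyIntegrable
      exact this
    exact this.integrable_smul_left_of_hasCompactSupport hη.continuous hη.2
  rw [integral_sub i1 i2, sub_eq_zero] at h0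
  exact h0
end FF
end Part18

section Part19
open Complex MeasureTheory Set Filter Topology
open scoped ENNReal NNReal ContDiff Convolution ComplexConjugate

section Core
variable {n : ℕ}

lemma Dm_zero {N : ℕ} {P : Type} (m : P → Fin N → ℂ) (p : P) {f : EuclideanSpace ℝ (Fin N) → ℂ} {x}
    (hx : x ∉ tsupport f) : Dm m p f x = 0 := by
  unfold Dm
  refine Finset.sum_eq_zero fun k _ => ?_
  rw [image_eq_zero_of_notMem_tsupport (f := fun x => pd k f x) (fun h => hx (tsupport_pd_subset f k h)), mul_zero]

lemma tsupport_Dm {N : ℕ} {P : Type} (m : P → Fin N → ℂ) (p : P) (f : EuclideanSpace ℝ (Fin N) → ℂ) :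
    tsupport (fun y => Dm m p f y) ⊆ tsupport f := by
  refine closure_minimal (fun x hx => ?_) (isClosed_tsupport f)
  by_contra h
  exact hx (Dm_zero m p h)

lemma int_expw {Ω : Set (EuclideanSpace ℝ (Fin (2 * n)))} (hbd : Bornology.IsBounded Ω)
    {φ : EuclideanSpace ℝ (Fin (2 * n)) → ℝ} (hφ : ContinuousOn φ (closure Ω))
    {τ : EuclideanSpace ℝ (Fin (2 * n)) → ℂ} (hτ : Continuous τ) :
    IntegrableOn (fun x => ‖τ x‖ ^ 2 * Real.exp (φ x)) Ω := by
  have hK : IsCompact (closure Ω) := hbd.isCompact_closure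
  have : ContinuousOn (fun x => ‖τ x‖ ^ 2 * Real.exp (φ x)) (closure Ω) :=
    ((hτ.norm.pow 2).continuousOn).mul (Real.continuous_exp.comp_continuousOn hφ)
  exact (this.integrableOn_compact hK).mono_set subset_closure

lemma cmpPhi {Ω K : Set (EuclideanSpace ℝ (Fin (2 * n)))} (hΩ : IsOpen Ω) (hbd : Bornology.IsBounded Ω) (hKΩ : K ⊆ Ω)
    {φ Φ : EuclideanSpace ℝ (Fin (2 * n)) → ℝ} (hφ : ContinuousOn φ (closure Ω)) (hΦ : Continuous Φ)
    (hle : ∀ x ∈ K, Φ x ≤ φ x + 1 / 2)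
    {τ : EuclideanSpace ℝ (Fin (2 * n)) → ℂ} (hτ : Continuous τ) (h0 : ∀ x ∉ K, τ x = 0) :
    √(∫ x, ‖τ x‖ ^ 2 * Real.exp (Φ x)) ≤ √2 * √(∫ x in Ω, ‖τ x‖ ^ 2 * Real.exp (φ x)) := by
  rw [← Real.sqrt_mul (by norm_num)]
  refine Real.sqrt_le_sqrt ?_
  rw [← setIntegral_eq_integral_of_forall_compl_eq_zero (s := Ω) (fun x hx => by rw [h0 x (fun h => hx (hKΩ h))]; simp),
    ← integral_const_mul]
  refine setIntegral_mono_on (int_expw hbd hΦ.continuousOn hτ) ((int_expw hbd hφ hτ).const_mul 2) hΩ.measurableSet ?_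
  intro x hx
  by_cases hxK : x ∈ K
  · have h1 : Real.exp (Φ x) ≤ 2 * Real.exp (φ x) := by
      calc Real.exp (Φ x) ≤ Real.exp (φ x + 1 / 2) := Real.exp_le_exp.2 (hle x hxK)
        _ = Real.exp (1 / 2) * Real.exp (φ x) := by rw [Real.exp_add, mul_comm]
        _ ≤ 2 * Real.exp (φ x) := by
          gcongr
          have h := Real.exp_one_lt_d9
          have h2 : Real.exp (1 / 2) ^ 2 = Real.exp 1 := by rw [← Real.exp_nat_mul]; norm_num
          nlinarith [Real.exp_pos (1 / 2)]
    have := mul_le_mul_of_nonneg_left h1 (sq_nonneg ‖τ x‖)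
    linarith
  · rw [h0 x hxK]; simp

variable {f : Fin n → Fin n → EuclideanSpace ℝ (Fin (2 * n)) → ℂ}

lemma smul_memLp {G : Type} [NormedAddCommGroup G] [NormedSpace ℝ G] {χ : EuclideanSpace ℝ (Fin (2 * n)) → ℝ}
    (hχ : Continuous χ) (hc : HasCompactSupport χ) {w : EuclideanSpace ℝ (Fin (2 * n)) → G} (hw : MemLp w 2 volume) :
    MemLp (fun x => χ x • w x) 2 volume := by
  obtain ⟨C, hC⟩ := hc.exists_bound_of_continuous hχ
  refine hw.of_le_mul (c := C) (hχ.aestronglyMeasurable.smul hw.1) (Eventually.of_forall fun x => ?_)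
  rw [norm_smul]
  exact mul_le_mul_of_nonneg_right (hC x) (norm_nonneg _)

lemma gam_memLp (hf : ∀ i j, MemLp (f i j) 2 volume) {χ : EuclideanSpace ℝ (Fin (2 * n)) → ℝ} (hχ : IsT χ) :
    MemLp (Gam f χ) 2 volume := by
  refine memLp_finsetSum _ fun k _ => ?_
  exact smul_memLp (isT_pd hχ k).continuous (isT_pd hχ k).2 ((t3 mw k).comp_memLp' (ff_memLp hf))

lemma gam_zero {χ : EuclideanSpace ℝ (Fin (2 * n)) → ℝ} {x} (hx : ∀ k, pd k χ x = 0) : Gam f χ x = 0 := by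
  simp [Gam, hx]

lemma gam_bound (hf : ∀ i j, MemLp (f i j) 2 volume) {χ : EuclideanSpace ℝ (Fin (2 * n)) → ℝ} (hχ : IsT χ)
    {Φ : EuclideanSpace ℝ (Fin (2 * n)) → ℝ} (hΦ : Continuous Φ) {ε : ℝ}
    (h : ∀ x k, pd k χ x ≠ 0 → Real.exp (-Φ x) ≤ ε) :
    ∫ x, ‖Gam f χ x‖ ^ 2 ∂(wm Φ) ≤ ε * ∫ x, ‖Gam f χ x‖ ^ 2 := by
  rw [integral_wm hΦ, ← integral_const_mul]
  have i1 := (gam_memLp hf hχ).integrable_norm_pow two_ne_zero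
  refine integral_mono_of_nonneg (Eventually.of_forall fun x => ?_) (i1.const_mul ε) (Eventually.of_forall fun x => ?_)
  · exact smul_nonneg (Real.exp_pos _).le (sq_nonneg _)
  · simp only [smul_eq_mul]
    by_cases hx : ∀ k, pd k χ x = 0
    · rw [gam_zero hx]; simp
    · push Not at hx
      obtain ⟨k, hk⟩ := hx
      exact mul_le_mul_of_nonneg_right (h x k hk) (sq_nonneg _)

lemma F_bound {Ω : Set (EuclideanSpace ℝ (Fin (2 * n)))} (hΩ : IsOpen Ω)
    {φ Φ : EuclideanSpace ℝ (Fin (2 * n)) → ℝ} (hΦ : Continuous Φ) {χ : EuclideanSpace ℝ (Fin (2 * n)) → ℝ}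
    (hχΩ : tsupport χ ⊆ Ω) (hχ1 : ∀ x, 0 ≤ χ x ∧ χ x ≤ 1) (hle : ∀ x ∈ tsupport χ, φ x ≤ Φ x)
    (hA : IntegrableOn (fun x => (∑ i, ∑ j, ‖f i j x‖ ^ 2) * Real.exp (-φ x)) Ω) :
    ∫ x, ‖χ x • ff f x‖ ^ 2 ∂(wm Φ) ≤ 2 * ∫ x in Ω, (∑ i, ∑ j, ‖f i j x‖ ^ 2) * Real.exp (-φ x) := by
  rw [integral_wm hΦ, ← integral_const_mul, ← integral_indicator hΩ.measurableSet]
  refine integral_mono_of_nonneg (Eventually.of_forall fun x => ?_) ((integrable_indicator_iff hΩ.measurableSet).2 (hA.const_mul 2))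
    (Eventually.of_forall fun x => ?_)
  · exact smul_nonneg (Real.exp_pos _).le (sq_nonneg _)
  · have s0 : 0 ≤ ∑ i, ∑ j, ‖f i j x‖ ^ 2 := Finset.sum_nonneg fun i _ => Finset.sum_nonneg fun j _ => sq_nonneg _
    by_cases hx : x ∈ tsupport χ
    · simp only [indicator_of_mem (hχΩ hx), smul_eq_mul]
      rw [norm_smul, mul_pow, ff_normsq, Real.norm_eq_abs, sq_abs]
      have h1 : χ x ^ 2 ≤ 1 := by nlinarith [hχ1 x]
      have h2 : Real.exp (-Φ x) ≤ Real.exp (-φ x) := Real.exp_le_exp.2 (by linarith [hle x hx])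
      calc Real.exp (-Φ x) * (χ x ^ 2 * (2 * ∑ i, ∑ j, ‖f i j x‖ ^ 2))
          ≤ Real.exp (-φ x) * (1 * (2 * ∑ i, ∑ j, ‖f i j x‖ ^ 2)) := by gcongr
        _ = _ := by ring
    · simp only [image_eq_zero_of_notMem_tsupport hx, zero_smul, norm_zero]
      simp only [ne_eq, OfNat.ofNat_ne_zero, not_false_eq_true, zero_pow, smul_zero]
      refine indicator_nonneg (fun y _ => ?_) x
      exact mul_nonneg (by norm_num) (mul_nonneg (Finset.sum_nonneg fun i _ => Finset.sum_nonneg fun j _ => sq_nonneg _) (Real.exp_pos _).le)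
end Core
end Part19

section Part20
open Complex MeasureTheory Set Filter Topology
open scoped ENNReal NNReal ContDiff Convolution ComplexConjugate

section Core2
variable {n : ℕ} {f : Fin n → Fin n → EuclideanSpace ℝ (Fin (2 * n)) → ℂ}

/-- weighted norm -/
noncomputable def Tn (Ω : Set (EuclideanSpace ℝ (Fin (2 * n)))) (φ : EuclideanSpace ℝ (Fin (2 * n)) → ℝ)
    (τ : EuclideanSpace ℝ (Fin (2 * n)) → ℂ) : ℝ := √(∫ x in Ω, ‖τ x‖ ^ 2 * Real.exp (φ x))

lemma Tn_nonneg (Ω φ) (τ : EuclideanSpace ℝ (Fin (2 * n)) → ℂ) : 0 ≤ Tn Ω φ τ := Real.sqrt_nonneg _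

set_option maxHeartbeats 1000000 in
lemma core_eps {Ω K : Set (EuclideanSpace ℝ (Fin (2 * n)))} (hΩ : IsOpen Ω) (hbd : Bornology.IsBounded Ω)
    {φ Φ : EuclideanSpace ℝ (Fin (2 * n)) → ℝ} (hφ : ContinuousOn φ (closure Ω)) (hΦ : ContDiff ℝ ∞ Φ) {c ε : ℝ} (hc : 0 < c)
    (hε : 0 < ε)
    (hH : ∀ x, ∀ ξ : Fin (2 * n) → ℝ, ∑ j, ∑ k, pd j (fun y => pd k Φ y) x * ξ j * ξ k ≥ c * ∑ j, ξ j ^ 2)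
    (hf : ∀ i j, MemLp (f i j) 2 volume)
    (hdbarf : ∀ (i j k : Fin n) (χ : EuclideanSpace ℝ (Fin (2 * n)) → ℂ), IsTestFun Ω χ →
      (∫ x, f i j x * wzbar k χ x) = ∫ x, f i k x * wzbar j χ x)
    (hdf : ∀ (i j k : Fin n) (χ : EuclideanSpace ℝ (Fin (2 * n)) → ℂ), IsTestFun Ω χ →
      (∫ x, f i j x * wz k χ x) = ∫ x, f k j x * wz i χ x)
    (hA : IntegrableOn (fun x => (∑ i, ∑ j, ‖f i j x‖ ^ 2) * Real.exp (-φ x)) Ω)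
    {χ : EuclideanSpace ℝ (Fin (2 * n)) → ℝ} (hχ : IsT χ) (hχΩ : tsupport χ ⊆ Ω) (hχ1 : ∀ x, 0 ≤ χ x ∧ χ x ≤ 1)
    (hχK : ∀ x ∈ K, χ x = 1) (hle : ∀ x ∈ tsupport χ, φ x ≤ Φ x) (hleK : ∀ x ∈ K, Φ x ≤ φ x + 1 / 2)
    (hKΩ : K ⊆ Ω) (hΦε : ∀ x k, pd k χ x ≠ 0 → Real.exp (-Φ x) ≤ ε)
    (α : Fin n → Fin n → EuclideanSpace ℝ (Fin (2 * n)) → ℂ) (hα : ∀ i j, IsT (α i j)) (hαK : ∀ i j, tsupport (α i j) ⊆ K) :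
    ‖∑ i, ∑ j, ∫ x, f i j x * α i j x‖ ≤
      √(8 / c ^ 2 * ∫ x in Ω, (∑ i, ∑ j, ‖f i j x‖ ^ 2) * Real.exp (-φ x)) *
        Tn Ω φ (fun x => ∑ i, ∑ j, Dm mw (Sum.inl i) (fun y => Dm mw (Sum.inr j) (α i j) y) x)
      + √ε * ∑ i, ∑ j, √(((1 + c) / (2 * c) + (1 + c) / (2 * c ^ 2)) * ∫ x, ‖Gam f χ x‖ ^ 2) *
          (√2 * (Tn Ω φ (α i j) + Tn Ω φ (Dm mw (Sum.inl i) (α i j)) + Tn Ω φ (Dm mw (Sum.inr j) (α i j)))) := by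
  have hΦc := hΦ.continuous
  have mF : MemLp (fun x => χ x • ff f x) 2 (wm Φ) :=
    memLp_wm_of_vol hΦc hχ.2 (fun x hx => by simp [image_eq_zero_of_notMem_tsupport hx])
      (smul_memLp hχ.continuous hχ.2 (ff_memLp hf))
  have mG : MemLp (Gam f χ) 2 (wm Φ) :=
    memLp_wm_of_vol hΦc hχ.2 (fun x hx => gam_zero fun k =>
      image_eq_zero_of_notMem_tsupport (f := fun x => pd k χ x) (fun h => hx (tsupport_pd_subset χ k h))) (gam_memLp hf hχ)
  have hFae : mF.toLp =ᵐ[volume] fun x => χ x • ff f x := (ac_wm hΦc).ae_le mF.coeFn_toLp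
  have hGae : mG.toLp =ᵐ[volume] Gam f χ := (ac_wm hΦc).ae_le mG.coeFn_toLp
  obtain ⟨u, R, D1, D2, mu, mR, mD1, mD2, bu, bR, bD1, bD2, hid⟩ := mainPhi hΦ hc hH mw mw_gram mF.toLp mG.toLp
    (opW_congr hFae.symm hGae.symm (ff_opW hf hdbarf hdf hχ hχΩ))
    (by filter_upwards [hFae] with x hx i i'; rw [hx]; simp [ff_apply, ffc])
    (by filter_upwards [hFae] with x hx i i'; rw [hx]; simp [ff_apply, ffc])
  rw [normsq_toLp] at bu
  simp only [normsq_toLp] at bR bD1 bD2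
  have hFb := F_bound hΩ hΦc hχΩ hχ1 hle hA
  have hGb := gam_bound hf hχ hΦc hΦε
  set A := ∫ x in Ω, (∑ i, ∑ j, ‖f i j x‖ ^ 2) * Real.exp (-φ x) with hAdef
  set C1 := ∫ x, ‖Gam f χ x‖ ^ 2 with hC1
  set C := (1 + c) / (2 * c) + (1 + c) / (2 * c ^ 2) with hC
  have C0 : 0 ≤ C := by rw [hC]; exact add_nonneg (div_nonneg (by linarith) (by linarith)) (div_nonneg (by linarith) (by positivity))
  -- error terms
  have err : ∀ h τ : EuclideanSpace ℝ (Fin (2 * n)) → ℂ, MemLp h 2 (wm Φ) →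
      ∫ x, ‖h x‖ ^ 2 ∂(wm Φ) ≤ C * ∫ x, ‖Gam f χ x‖ ^ 2 ∂(wm Φ) → IsT τ → tsupport τ ⊆ K →
      ‖∫ x, h x * τ x‖ ≤ √ε * (√(C * C1) * (√2 * Tn Ω φ τ)) := by
    intro h τ hh hb hτ hτK
    refine (cs_wm hΦc hh hτ.continuous hτ.2).trans ?_
    have h1 : √(∫ x, ‖h x‖ ^ 2 ∂(wm Φ)) ≤ √ε * √(C * C1) := by
      rw [← Real.sqrt_mul hε.le]
      refine Real.sqrt_le_sqrt (hb.trans ?_)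
      calc _ ≤ C * (ε * C1) := mul_le_mul_of_nonneg_left hGb C0
        _ = _ := by ring
    have h2 := cmpPhi hΩ hbd hKΩ hφ hΦc hleK hτ.continuous
      (fun x hx => image_eq_zero_of_notMem_tsupport fun h => hx (hτK h))
    calc _ ≤ (√ε * √(C * C1)) * (√2 * Tn Ω φ τ) := mul_le_mul h1 h2 (Real.sqrt_nonneg _) (mul_nonneg (Real.sqrt_nonneg _) (Real.sqrt_nonneg _))
      _ = _ := by ring
  have hD1T : ∀ i j, IsT (fun y => Dm mw (Sum.inl i) (α i j) y) := fun i j => Dm_isT mw _ (hα i j)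
  have hD2T : ∀ i j, IsT (fun y => Dm mw (Sum.inr j) (α i j) y) := fun i j => Dm_isT mw _ (hα i j)
  have hD3T : ∀ i j, IsT (fun y => Dm mw (Sum.inl i) (fun y => Dm mw (Sum.inr j) (α i j) y) y) :=
    fun i j => Dm_isT mw _ (hD2T i j)
  have hGT : IsT (fun x => ∑ i, ∑ j, Dm mw (Sum.inl i) (fun y => Dm mw (Sum.inr j) (α i j) y) x) :=
    IsT.sum fun i => IsT.sum fun j => hD3T i j
  have id2 : ∀ i j, ∫ x, f i j x * α i j x = (∫ x, u x * Dm mw (Sum.inl i) (fun y => Dm mw (Sum.inr j) (α i j) y) x)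
      + ((∫ x, R i j x * α i j x)
          + (∫ x, D2 j x * Dm mw (Sum.inl i) (α i j) x) + (∫ x, D1 i x * Dm mw (Sum.inr j) (α i j) x)) := by
    intro i j
    have := hid i j (α i j) (hα i j)
    rw [← add_assoc, ← add_assoc, ← this]
    refine integral_congr_ae ?_
    filter_upwards [hFae] with x hx
    rw [hx]
    by_cases hxK : x ∈ K
    · simp [hχK x hxK, ff_apply, ffc]
    · rw [image_eq_zero_of_notMem_tsupport (fun h => hxK (hαK i j h))]; simp
  have iu : ∀ i j, Integrable fun x => u x * Dm mw (Sum.inl i) (fun y => Dm mw (Sum.inr j) (α i j) y) x := by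
    intro i j
    have := int_mul_isT hΦc mu (hD3T i j)
    simpa only [mul_comm] using this
  have id3 : ∑ i, ∑ j, ∫ x, f i j x * α i j x =
      (∫ x, u x * ∑ i, ∑ j, Dm mw (Sum.inl i) (fun y => Dm mw (Sum.inr j) (α i j) y) x) +
      ∑ i, ∑ j, ((∫ x, R i j x * α i j x)
          + (∫ x, D2 j x * Dm mw (Sum.inl i) (α i j) x) + (∫ x, D1 i x * Dm mw (Sum.inr j) (α i j) x)) := by
    simp only [id2, Finset.sum_add_distrib, Finset.mul_sum]
    rw [integral_finsetSum _ fun i _ => integrable_finsetSum _ fun j _ => iu i j]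
    congr 1
    refine Finset.sum_congr rfl fun i _ => ?_
    rw [integral_finsetSum _ fun j _ => iu i j]
  rw [id3]
  refine (norm_add_le _ _).trans (add_le_add ?_ ?_)
  · refine (cs_wm hΦc mu hGT.continuous hGT.2).trans ?_
    have h2 := cmpPhi hΩ hbd hKΩ hφ hΦc hleK hGT.continuous (fun x hx => by
      refine Finset.sum_eq_zero fun i _ => Finset.sum_eq_zero fun j _ => ?_
      exact Dm_zero _ _ fun h => hx (hαK i j (tsupport_Dm _ _ _ h)))
    have h1 : √(∫ x, ‖u x‖ ^ 2 ∂(wm Φ)) ≤ √(4 / c ^ 2 * A) := by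
      refine Real.sqrt_le_sqrt (bu.trans ?_)
      calc _ ≤ 2 / c ^ 2 * (2 * A) := mul_le_mul_of_nonneg_left hFb (div_nonneg (by norm_num) (sq_nonneg c))
        _ = _ := by ring
    refine (mul_le_mul h1 h2 (Real.sqrt_nonneg _) (Real.sqrt_nonneg _)).trans (le_of_eq ?_)
    rw [← mul_assoc, mul_comm (√(4 / c ^ 2 * A)), ← Real.sqrt_mul (by norm_num)]
    have e : 2 * (4 / c ^ 2 * A) = 8 / c ^ 2 * A := by ring
    rw [e]
    rfl
  · refine (norm_sum_le _ _).trans ?_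
    rw [Finset.mul_sum]
    refine Finset.sum_le_sum fun i _ => ?_
    refine (norm_sum_le _ _).trans ?_
    rw [Finset.mul_sum]
    refine Finset.sum_le_sum fun j _ => ?_
    have q1 := err (R i j) (α i j) (mR i j) (bR i j) (hα i j) (hαK i j)
    have q2 := err (D2 j) _ (mD2 j) (bD2 j) (hD1T i j) ((tsupport_Dm _ _ _).trans (hαK i j))
    have q3 := err (D1 i) _ (mD1 i) (bD1 i) (hD2T i j) ((tsupport_Dm _ _ _).trans (hαK i j))
    refine (norm_add₃_le).trans ?_
    refine (add_le_add (add_le_add q1 q2) q3).trans (le_of_eq ?_)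
    ring

lemma core {Ω : Set (EuclideanSpace ℝ (Fin (2 * n)))} (hΩ : IsOpen Ω) (hcv : Convex ℝ Ω) (hbd : Bornology.IsBounded Ω)
    {U : Set (EuclideanSpace ℝ (Fin (2 * n)))} (hU : IsOpen U) (hΩU : closure Ω ⊆ U)
    {φ : EuclideanSpace ℝ (Fin (2 * n)) → ℝ} (hφ : ContDiffOn ℝ ∞ φ U) (hφ0 : ∀ x ∈ Ω, 0 ≤ φ x) {c : ℝ} (hc : 0 < c)
    (hH : ∀ x ∈ Ω, ∀ ξ : Fin (2 * n) → ℝ, ∑ j, ∑ k, pd j (fun y => pd k φ y) x * ξ j * ξ k ≥ c * ∑ j, ξ j ^ 2)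
    (hf : ∀ i j, MemLp (f i j) 2 volume)
    (hdbarf : ∀ (i j k : Fin n) (χ : EuclideanSpace ℝ (Fin (2 * n)) → ℂ), IsTestFun Ω χ →
      (∫ x, f i j x * wzbar k χ x) = ∫ x, f i k x * wzbar j χ x)
    (hdf : ∀ (i j k : Fin n) (χ : EuclideanSpace ℝ (Fin (2 * n)) → ℂ), IsTestFun Ω χ →
      (∫ x, f i j x * wz k χ x) = ∫ x, f k j x * wz i χ x)
    (hA : IntegrableOn (fun x => (∑ i, ∑ j, ‖f i j x‖ ^ 2) * Real.exp (-φ x)) Ω)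
    (α : Fin n → Fin n → EuclideanSpace ℝ (Fin (2 * n)) → ℂ) (hα : ∀ i j, IsTestFun Ω (α i j)) :
    ‖∑ i, ∑ j, ∫ x, f i j x * α i j x‖ ≤
      √(8 / c ^ 2 * ∫ x in Ω, (∑ i, ∑ j, ‖f i j x‖ ^ 2) * Real.exp (-φ x)) *
        √(∫ x in Ω, ‖∑ i, ∑ j, wz i (fun y => wzbar j (α i j) y) x‖ ^ 2 * Real.exp (φ x)) := by
  have hT : ∀ i j, IsT (α i j) := fun i j => ⟨(hα i j).1, (hα i j).2.1⟩
  let K := ⋃ i, ⋃ j, tsupport (α i j)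
  have hK : IsCompact K := isCompact_iUnion fun i => isCompact_iUnion fun j => (hα i j).2.1
  have hKΩ : K ⊆ Ω := iUnion_subset fun i => iUnion_subset fun j => (hα i j).2.2
  have hαK : ∀ i j, tsupport (α i j) ⊆ K := fun i j =>
    (subset_iUnion (fun j => tsupport (α i j)) j).trans (subset_iUnion (fun i => ⋃ j, tsupport (α i j)) i)
  obtain ⟨χ, hχ, hχΩ, hχ1, hχK, W⟩ := lemmaW hK hΩ hcv hKΩ hU (subset_closure.trans hΩU) hφ hφ0 hc hH
  have hφc : ContinuousOn φ (closure Ω) := hφ.continuousOn.mono hΩU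
  set Y := √(8 / c ^ 2 * ∫ x in Ω, (∑ i, ∑ j, ‖f i j x‖ ^ 2) * Real.exp (-φ x)) *
        √(∫ x in Ω, ‖∑ i, ∑ j, wz i (fun y => wzbar j (α i j) y) x‖ ^ 2 * Real.exp (φ x)) with hY
  obtain ⟨M, hM0, hM⟩ : ∃ M : ℝ, 0 ≤ M ∧ ∀ ε > 0, ‖∑ i, ∑ j, ∫ x, f i j x * α i j x‖ ≤ Y + √ε * M := by
    refine ⟨∑ i, ∑ j, √(((1 + c) / (2 * c) + (1 + c) / (2 * c ^ 2)) * ∫ x, ‖Gam f χ x‖ ^ 2) *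
      (√2 * (Tn Ω φ (α i j) + Tn Ω φ (wz i (α i j)) + Tn Ω φ (wzbar j (α i j)))), ?_, fun ε hε => ?_⟩
    rotate_left
    · obtain ⟨Φ, hΦ, hΦH, hle, hleK, hΦε⟩ := W ε hε
      have := core_eps hΩ hbd hφc hΦ hc hε hΦH hf hdbarf hdf hA hχ hχΩ hχ1 hχK hle hleK hKΩ hΦε α hT hαK
      simp only [Dm_inl, Dm_inr] at this
      exact this
    · refine Finset.sum_nonneg fun i _ => Finset.sum_nonneg fun j _ => ?_
      exact mul_nonneg (Real.sqrt_nonneg _) (mul_nonneg (Real.sqrt_nonneg _)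
        (add_nonneg (add_nonneg (Tn_nonneg _ _ _) (Tn_nonneg _ _ _)) (Tn_nonneg _ _ _)))
  refine le_of_forall_pos_le_add fun δ hδ => ?_
  have h1 : 0 < δ / (M + 1) := div_pos hδ (by linarith)
  refine (hM ((δ / (M + 1)) ^ 2) (pow_pos h1 2)).trans ?_
  rw [Real.sqrt_sq h1.le, div_mul_eq_mul_div]
  gcongr
  rw [div_le_iff₀ (by linarith)]
  nlinarith
end Core2
end Part20

section Part21
open Complex MeasureTheory Set Filter Topology
open scoped ENNReal NNReal ContDiff Convolution ComplexConjugate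

section Final
variable {n : ℕ}

lemma Dm_cadd {N : ℕ} {P : Type} (m : P → Fin N → ℂ) (p : P) {f g : EuclideanSpace ℝ (Fin N) → ℂ}
    (hf : IsT f) (hg : IsT g) (a b : ℂ) (x) :
    Dm m p (fun y => a * f y + b * g y) x = a * Dm m p f x + b * Dm m p g x := by
  have h : ∀ k, pd k (fun y => a * f y + b * g y) x = a * pd k f x + b * pd k g x := by
    intro k
    rw [← pd_cmul hf.1, ← pd_cmul hg.1]
    unfold pd
    rw [fderiv_fun_add (((hf.cmul a).1.differentiable (by simp)).differentiableAt)
      (((hg.cmul b).1.differentiable (by simp)).differentiableAt)]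
    rfl
  unfold Dm
  rw [Finset.mul_sum, Finset.mul_sum, ← Finset.sum_add_distrib]
  refine Finset.sum_congr rfl fun k _ => ?_
  rw [h]; ring

lemma ww_cadd (i j : Fin n) {f g : EuclideanSpace ℝ (Fin (2 * n)) → ℂ} (hf : IsT f) (hg : IsT g) (a b : ℂ) (x) :
    wz i (fun y => wzbar j (fun y => a * f y + b * g y) y) x =
      a * wz i (fun y => wzbar j f y) x + b * wz i (fun y => wzbar j g y) x := by
  simp only [← Dm_inl, ← Dm_inr]
  have : (fun y => Dm mw (Sum.inr j) (fun y => a * f y + b * g y) y) =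
      fun y => a * Dm mw (Sum.inr j) f y + b * Dm mw (Sum.inr j) g y := by
    ext y; exact Dm_cadd _ _ hf hg a b y
  rw [this]
  exact Dm_cadd _ _ (Dm_isT mw _ hf) (Dm_isT mw _ hg) a b x

lemma ww_isT (i j : Fin n) {f : EuclideanSpace ℝ (Fin (2 * n)) → ℂ} (hf : IsT f) :
    IsT (fun x => wz i (fun y => wzbar j f y) x) := by
  have := Dm_isT mw (Sum.inl i) (Dm_isT mw (Sum.inr j) hf)
  simpa only [Dm_inl, Dm_inr] using this

lemma IsTestFun.isT {Ω : Set (EuclideanSpace ℝ (Fin (2 * n)))} {f : EuclideanSpace ℝ (Fin (2 * n)) → ℂ}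
    (h : IsTestFun Ω f) : IsT f := ⟨h.1, h.2.1⟩

lemma IsTestFun.cadd {Ω : Set (EuclideanSpace ℝ (Fin (2 * n)))} {f g : EuclideanSpace ℝ (Fin (2 * n)) → ℂ}
    (hf : IsTestFun Ω f) (hg : IsTestFun Ω g) (a b : ℂ) : IsTestFun Ω (fun x => a * f x + b * g x) := by
  have h := (hf.isT.cmul a).add (hg.isT.cmul b)
  refine ⟨h.1, h.2, ?_⟩
  refine (closure_minimal (t := tsupport f ∪ tsupport g) ?_
    ((isClosed_tsupport f).union (isClosed_tsupport g))).trans (union_subset hf.2.2 hg.2.2)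
  intro x hx
  by_contra hcon
  rw [mem_union, not_or] at hcon
  apply hx
  simp [image_eq_zero_of_notMem_tsupport hcon.1, image_eq_zero_of_notMem_tsupport hcon.2]

lemma IsTestFun.zero (Ω : Set (EuclideanSpace ℝ (Fin (2 * n)))) : IsTestFun Ω (fun _ => (0 : ℂ)) := by
  refine ⟨contDiff_const, HasCompactSupport.zero, ?_⟩
  have : tsupport (fun _ : EuclideanSpace ℝ (Fin (2 * n)) => (0 : ℂ)) = ∅ := tsupport_eq_empty_iff.2 rfl
  rw [this]; exact empty_subset _

/-- families of test functions -/
def famSub (Ω : Set (EuclideanSpace ℝ (Fin (2 * n)))) :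
    Submodule ℂ (Fin n → Fin n → EuclideanSpace ℝ (Fin (2 * n)) → ℂ) where
  carrier := {α | ∀ i j, IsTestFun Ω (α i j)}
  add_mem' {a b} ha hb i j := by
    have := (ha i j).cadd (hb i j) 1 1
    simp only [one_mul] at this
    exact this
  zero_mem' i j := IsTestFun.zero Ω
  smul_mem' c a ha i j := by
    have := (ha i j).cadd (ha i j) c 0
    simp only [zero_mul, add_zero] at this
    exact this

/-- the formal adjoint operator -/
noncomputable def GG (α : Fin n → Fin n → EuclideanSpace ℝ (Fin (2 * n)) → ℂ) (x : EuclideanSpace ℝ (Fin (2 * n))) : ℂ :=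
  ∑ i, ∑ j, wz i (fun y => wzbar j (α i j) y) x

lemma GG_add {Ω : Set (EuclideanSpace ℝ (Fin (2 * n)))} (α β : famSub Ω) (x) :
    GG (α + β : famSub Ω).1 x = GG α.1 x + GG β.1 x := by
  unfold GG
  rw [← Finset.sum_add_distrib]
  refine Finset.sum_congr rfl fun i _ => ?_
  rw [← Finset.sum_add_distrib]
  refine Finset.sum_congr rfl fun j _ => ?_
  have := ww_cadd i j (α.2 i j).isT (β.2 i j).isT 1 1 x
  simp only [one_mul] at this
  exact this

lemma GG_smul {Ω : Set (EuclideanSpace ℝ (Fin (2 * n)))} (a : ℂ) (α : famSub Ω) (x) :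
    GG (a • α : famSub Ω).1 x = a * GG α.1 x := by
  unfold GG
  rw [Finset.mul_sum]
  refine Finset.sum_congr rfl fun i _ => ?_
  rw [Finset.mul_sum]
  refine Finset.sum_congr rfl fun j _ => ?_
  have := ww_cadd i j (α.2 i j).isT (α.2 i j).isT a 0 x
  simp only [zero_mul, add_zero] at this
  exact this

lemma GG_cont {Ω : Set (EuclideanSpace ℝ (Fin (2 * n)))} (α : famSub Ω) : Continuous (GG α.1) := by
  unfold GG
  exact continuous_finsetSum _ fun i _ => continuous_finsetSum _ fun j _ => (ww_isT i j (α.2 i j).isT).continuous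

lemma GG_single {χ : EuclideanSpace ℝ (Fin (2 * n)) → ℂ} (i j : Fin n) (x) :
    GG (fun i' j' => if i' = i ∧ j' = j then χ else fun _ => 0) x = wz i (fun y => wzbar j χ y) x := by
  have h0 : ∀ i' j' : Fin n, wz i' (fun y => wzbar j' (fun _ => (0 : ℂ)) y) x = 0 := by
    intro i' j'
    simp [wz, wzbar, pd]
  unfold GG
  rw [Finset.sum_eq_single i, Finset.sum_eq_single j]
  · simp
  · intro j' _ hj; simp [hj, h0]
  · simp
  · intro i' _ hi; simp [hi, h0]
  · simp

/-- `e^{φ/2} G` is in `L²(Ω)` -/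
lemma GG_memLp {Ω : Set (EuclideanSpace ℝ (Fin (2 * n)))} (hΩ : IsOpen Ω) (hbd : Bornology.IsBounded Ω)
    {φ : EuclideanSpace ℝ (Fin (2 * n)) → ℝ} (hφ : ContinuousOn φ (closure Ω)) (α : famSub Ω) :
    MemLp (fun x => (Real.exp (φ x / 2) : ℂ) * GG α.1 x) 2 (volume.restrict Ω) := by
  have hm : AEStronglyMeasurable (fun x => (Real.exp (φ x / 2) : ℂ) * GG α.1 x) (volume.restrict Ω) := by
    refine ContinuousOn.aestronglyMeasurable ?_ hΩ.measurableSet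
    refine ContinuousOn.mul ?_ (GG_cont α).continuousOn
    exact Complex.continuous_ofReal.comp_continuousOn
      (Real.continuous_exp.comp_continuousOn ((hφ.mono subset_closure).div_const 2))
  rw [memLp_two_iff_integrable_sq_norm hm]
  refine (int_expw hbd hφ (GG_cont α)).congr (Eventually.of_forall fun x => ?_)
  simp only [norm_mul, mul_pow, Complex.norm_real, Real.norm_eq_abs, Real.abs_exp]
  rw [← Real.exp_nat_mul, mul_comm]
  congr 2
  push_cast; ring
end Final
end Part21

/-- the Poincaré–Lelong equation on a strictly convex bounded domain
`Ω ⊂ ℂ^n ≅ ℝ^{2n}`: if `φ ≥ 0` is smooth on `Ω̄` with real Hessian `≥ c > 0`, then for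
every `d`-closed `(1,1)`-form `f ∈ L²_{(1,1)}(Ω, e^{−φ})` there is `u ∈ L²(Ω, e^{−φ})` with
`i∂∂̄u = f` distributionally and `∫_Ω |u|² e^{−φ} ≤ (8/c²) ∫_Ω |f|² e^{−φ}`. -/
theorem poincare_lelong {n : ℕ}
    (Ω : Set (EuclideanSpace ℝ (Fin (2 * n)))) (hΩopen : IsOpen Ω) (hΩne : Ω.Nonempty)
    (hΩconv : StrictConvex ℝ Ω) (hΩbdd : Bornology.IsBounded Ω)
    (U : Set (EuclideanSpace ℝ (Fin (2 * n)))) (hUopen : IsOpen U) (hΩU : closure Ω ⊆ U)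
    (φ : EuclideanSpace ℝ (Fin (2 * n)) → ℝ) (hφ : ContDiffOn ℝ (⊤ : ℕ∞) φ U)
    (hφ0 : ∀ x ∈ closure Ω, 0 ≤ φ x)
    (c : ℝ) (hc : 0 < c)
    (hHess : ∀ x ∈ closure Ω, ∀ ξ : Fin (2 * n) → ℝ,
      (∑ j, ∑ k, pd j (fun y => pd k φ y) x * ξ j * ξ k) ≥ c * ∑ j, (ξ j) ^ 2)
    (f : Fin n → Fin n → EuclideanSpace ℝ (Fin (2 * n)) → ℂ)
    (hfm : ∀ i j, AEStronglyMeasurable (f i j) (volume.restrict Ω))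
    (hfL2 : IntegrableOn
      (fun x => (∑ i, ∑ j, ‖f i j x‖ ^ 2) * Real.exp (-φ x)) Ω)
    (hdbarf : ∀ (i j k : Fin n) (χ : EuclideanSpace ℝ (Fin (2 * n)) → ℂ), IsTestFun Ω χ →
      (∫ x in Ω, f i j x * wzbar k χ x) = ∫ x in Ω, f i k x * wzbar j χ x)
    (hdf : ∀ (i j k : Fin n) (χ : EuclideanSpace ℝ (Fin (2 * n)) → ℂ), IsTestFun Ω χ →
      (∫ x in Ω, f i j x * wz k χ x) = ∫ x in Ω, f k j x * wz i χ x) :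
    ∃ u : EuclideanSpace ℝ (Fin (2 * n)) → ℂ,
      AEStronglyMeasurable u (volume.restrict Ω) ∧
      IntegrableOn (fun x => ‖u x‖ ^ 2 * Real.exp (-φ x)) Ω ∧
      (∀ (i j : Fin n) (χ : EuclideanSpace ℝ (Fin (2 * n)) → ℂ), IsTestFun Ω χ →
        Complex.I * ∫ x in Ω, u x * wz i (fun y => wzbar j χ y) x
          = ∫ x in Ω, f i j x * χ x) ∧
      (∫ x in Ω, ‖u x‖ ^ 2 * Real.exp (-φ x))
        ≤ (8 / c ^ 2) * ∫ x in Ω, (∑ i, ∑ j, ‖f i j x‖ ^ 2) * Real.exp (-φ x) := by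
  have hφc : ContinuousOn φ (closure Ω) := hφ.continuousOn.mono hΩU
  have hmeas := hΩopen.measurableSet
  let fh : Fin n → Fin n → EuclideanSpace ℝ (Fin (2 * n)) → ℂ := fun i j => Ω.indicator (f i j)
  have fhΩ : ∀ i j, ∀ x ∈ Ω, fh i j x = f i j x := fun i j x hx => Set.indicator_of_mem hx _
  have fhint : ∀ i j (τ : EuclideanSpace ℝ (Fin (2 * n)) → ℂ), ∫ x, fh i j x * τ x = ∫ x in Ω, f i j x * τ x := by
    intro i j τ
    rw [← integral_indicator hmeas]
    congr 1
    ext x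
    by_cases hx : x ∈ Ω <;> simp [fh, hx]
  have fhA : ∀ x ∈ Ω, (∑ i, ∑ j, ‖fh i j x‖ ^ 2) * Real.exp (-φ x) = (∑ i, ∑ j, ‖f i j x‖ ^ 2) * Real.exp (-φ x) := by
    intro x hx
    simp only [fhΩ _ _ x hx]
  have hfL : ∀ i j, MemLp (fh i j) 2 volume := by
    intro i j
    refine (memLp_indicator_iff_restrict hmeas).2 ?_
    rw [memLp_two_iff_integrable_sq_norm (hfm i j)]
    obtain ⟨M, hM⟩ := hΩbdd.isCompact_closure.exists_bound_of_continuousOn hφc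
    refine Integrable.mono' (hfL2.const_mul (Real.exp M)) ((hfm i j).norm.pow 2) ?_
    filter_upwards [ae_restrict_mem hmeas] with x hx
    have h1 : φ x ≤ M := (le_abs_self _).trans (hM x (subset_closure hx))
    have h2 : ‖f i j x‖ ^ 2 ≤ ∑ i, ∑ j, ‖f i j x‖ ^ 2 :=
      (Finset.single_le_sum (f := fun j => ‖f i j x‖ ^ 2) (fun j _ => sq_nonneg _) (Finset.mem_univ j)).trans
        (Finset.single_le_sum (f := fun i => ∑ j, ‖f i j x‖ ^ 2)
          (fun i _ => Finset.sum_nonneg fun j _ => sq_nonneg _) (Finset.mem_univ i))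
    have h3 : 1 ≤ Real.exp M * Real.exp (-φ x) := by
      rw [← Real.exp_add]; exact Real.one_le_exp (by linarith)
    rw [Real.norm_of_nonneg (sq_nonneg _)]
    have h4 : 0 ≤ ∑ i, ∑ j, ‖f i j x‖ ^ 2 := (sq_nonneg _).trans h2
    calc ‖f i j x‖ ^ 2 ≤ (∑ i, ∑ j, ‖f i j x‖ ^ 2) * 1 := by rw [mul_one]; exact h2
      _ ≤ (∑ i, ∑ j, ‖f i j x‖ ^ 2) * (Real.exp M * Real.exp (-φ x)) := mul_le_mul_of_nonneg_left h3 h4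
      _ = _ := by ring
  have hA' : IntegrableOn (fun x => (∑ i, ∑ j, ‖fh i j x‖ ^ 2) * Real.exp (-φ x)) Ω :=
    hfL2.congr_fun (fun x hx => (fhA x hx).symm) hmeas
  have hAeq : ∫ x in Ω, (∑ i, ∑ j, ‖fh i j x‖ ^ 2) * Real.exp (-φ x) =
      ∫ x in Ω, (∑ i, ∑ j, ‖f i j x‖ ^ 2) * Real.exp (-φ x) := setIntegral_congr_fun hmeas fhA
  have hcore := fun α : famSub Ω => core hΩopen hΩconv.convex hΩbdd hUopen hΩU hφ (fun x hx => hφ0 x (subset_closure hx)) hc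
    (fun x hx => hHess x (subset_closure hx)) hfL
    (fun i j k χ hχ => by rw [fhint, fhint]; exact hdbarf i j k χ hχ)
    (fun i j k χ hχ => by rw [fhint, fhint]; exact hdf i j k χ hχ) hA' α.1 α.2
  simp only [hAeq] at hcore
  set A := ∫ x in Ω, (∑ i, ∑ j, ‖f i j x‖ ^ 2) * Real.exp (-φ x) with hAdef
  have A0 : 0 ≤ A := integral_nonneg fun x => mul_nonneg
    (Finset.sum_nonneg fun i _ => Finset.sum_nonneg fun j _ => sq_nonneg _) (Real.exp_pos _).le
  have ifα : ∀ (α : famSub Ω) i j, Integrable fun x => fh i j x * α.1 i j x := by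
    intro α i j
    have h1 : MemLp (α.1 i j) 2 volume := (α.2 i j).isT.continuous.memLp_of_hasCompactSupport (α.2 i j).2.1
    exact MemLp.integrable_mul (hfL i j) h1
  let L : famSub Ω →ₗ[ℂ] Lp ℂ 2 (volume.restrict Ω) :=
    { toFun := fun α => (GG_memLp hΩopen hΩbdd hφc α).toLp _
      map_add' := fun α β => by
        rw [← MemLp.toLp_add]
        refine MemLp.toLp_congr _ _ (Filter.Eventually.of_forall fun x => ?_)
        simp only [GG_add, Pi.add_apply]; ring
      map_smul' := fun a α => by
        rw [RingHom.id_apply, ← MemLp.toLp_const_smul]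
        refine MemLp.toLp_congr _ _ (Filter.Eventually.of_forall fun x => ?_)
        simp only [GG_smul, Pi.smul_apply, smul_eq_mul]; ring }
  let l : famSub Ω →ₗ[ℂ] ℂ :=
    { toFun := fun α => ∑ i, ∑ j, ∫ x, fh i j x * α.1 i j x
      map_add' := fun α β => by
        rw [← Finset.sum_add_distrib]
        refine Finset.sum_congr rfl fun i _ => ?_
        rw [← Finset.sum_add_distrib]
        refine Finset.sum_congr rfl fun j _ => ?_
        rw [← integral_add (ifα α i j) (ifα β i j)]
        refine integral_congr_ae (Filter.Eventually.of_forall fun x => ?_)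
        exact mul_add _ _ _
      map_smul' := fun a α => by
        rw [RingHom.id_apply, smul_eq_mul, Finset.mul_sum]
        refine Finset.sum_congr rfl fun i _ => ?_
        rw [Finset.mul_sum]
        refine Finset.sum_congr rfl fun j _ => ?_
        rw [← integral_const_mul]
        refine integral_congr_ae (Filter.Eventually.of_forall fun x => ?_)
        exact mul_left_comm _ _ _ }
  have hexp : ∀ x, ‖(Real.exp (φ x / 2) : ℂ)‖ ^ 2 = Real.exp (φ x) := by
    intro x
    rw [Complex.norm_real, Real.norm_eq_abs, Real.abs_exp, ← Real.exp_nat_mul]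
    congr 1; push_cast; ring
  have hLn : ∀ α, ‖L α‖ = √(∫ x in Ω, ‖GG α.1 x‖ ^ 2 * Real.exp (φ x)) := by
    intro α
    rw [← Real.sqrt_sq (norm_nonneg (L α))]
    congr 1
    refine (normsq_toLp (GG_memLp hΩopen hΩbdd hφc α)).trans ?_
    refine integral_congr_ae (Filter.Eventually.of_forall fun x => ?_)
    simp only [norm_mul, mul_pow, hexp]
    ring
  obtain ⟨w, hwn, hw⟩ := riesz_range L l (√(8 / c ^ 2 * A)) (Real.sqrt_nonneg _) (fun α => by
    rw [hLn]; exact hcore α)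
  have mw2 := Lp.memLp w
  have hwsq : ∀ x, ‖-Complex.I * (starRingEnd ℂ (w x) * (Real.exp (φ x / 2) : ℂ))‖ ^ 2 * Real.exp (-φ x) = ‖w x‖ ^ 2 := by
    intro x
    rw [norm_mul, norm_mul, mul_pow, mul_pow, hexp, norm_neg, Complex.norm_I, RCLike.norm_conj, Real.exp_neg]
    field_simp
  refine ⟨fun x => -Complex.I * (starRingEnd ℂ (w x) * (Real.exp (φ x / 2) : ℂ)), ?_, ?_, ?_, ?_⟩
  · refine AEStronglyMeasurable.const_mul (AEStronglyMeasurable.mul ?_ ?_) _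
    · exact Complex.continuous_conj.comp_aestronglyMeasurable mw2.1
    · refine ContinuousOn.aestronglyMeasurable ?_ hmeas
      exact Complex.continuous_ofReal.comp_continuousOn
        (Real.continuous_exp.comp_continuousOn ((hφc.mono subset_closure).div_const 2))
  · simp only [hwsq]
    exact mw2.integrable_norm_pow two_ne_zero
  · intro i j χ hχ
    let α : famSub Ω := ⟨fun i' j' => if i' = i ∧ j' = j then χ else fun _ => 0, fun i' j' => by
      by_cases h : i' = i ∧ j' = j
      · simp only [h, and_self, if_true]; exact hχ
      · simp only [h, if_false]; exact IsTestFun.zero Ω⟩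
    have h1 := hw α
    have h2 : l α = ∫ x in Ω, f i j x * χ x := by
      rw [← fhint]
      change ∑ i', ∑ j', ∫ x, fh i' j' x * (if i' = i ∧ j' = j then χ else fun _ => 0) x = _
      rw [Finset.sum_eq_single i, Finset.sum_eq_single j]
      · simp
      · intro j' _ hj; simp [hj]
      · simp
      · intro i' _ hi; simp [hi]
      · simp
    rw [← h2, ← h1, L2.inner_def, ← integral_const_mul]
    refine integral_congr_ae ?_
    filter_upwards [(GG_memLp hΩopen hΩbdd hφc α).coeFn_toLp] with x hx
    have h3 : (L α) x = (Real.exp (φ x / 2) : ℂ) * wz i (fun y => wzbar j χ y) x := by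
      refine hx.trans ?_
      congr 1
      exact GG_single i j x
    rw [h3, RCLike.inner_apply]
    linear_combination (-(starRingEnd ℂ (w x) * (Real.exp (φ x / 2) : ℂ)) * wz i (fun y => wzbar j χ y) x) * Complex.I_sq
  · simp only [hwsq]
    have h1 : ‖w‖ ^ 2 = ∫ x in Ω, ‖w x‖ ^ 2 := by
      have := normsq_toLp mw2
      rwa [Lp.toLp_coeFn] at this
    rw [← h1]
    calc ‖w‖ ^ 2 ≤ (√(8 / c ^ 2 * A)) ^ 2 := pow_le_pow_left₀ (norm_nonneg _) hwn 2
      _ = _ := Real.sq_sqrt (mul_nonneg (div_nonneg (by norm_num) (sq_nonneg c)) A0)
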